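/- There exists a strong SO₃-equivariant deformation retraction from Hom(P²) to SO₃; that is, a jointly continuous map ρ : Hom(P²) × [0,1] → Hom(P²) such that ρ(f,0) = f for all f ∈ Hom(P²), for every f the homeomorphism ρ(f,1) is induced by some Q ∈ SO₃, ρ(Q̄,t) = Q̄ for every map Q̄ induced by Q ∈ SO₃ and every t ∈ [0,1], and ρ(Q̄ ∘ f, t) = Q̄ ∘ ρ(f,t) for every Q ∈ SO₃, f ∈ Hom(P²), and t ∈ [0,1]. -/

import Mathlib

open Metric unitInterval

noncomputable section

/-- The Euclidean 3-space. -/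
abbrev E3 : Type := EuclideanSpace ℝ (Fin 3)

/-- The unit 2-sphere in `ℝ³`. -/
abbrev Sph : Type := Metric.sphere (0 : E3) 1

/-- The antipodal equivalence relation `x ~ -x` on the sphere. -/
instance antipodalSetoid : Setoid Sph where
  r x y := (x : E3) = (y : E3) ∨ (x : E3) = -(y : E3)
  iseqv := by
    refine ⟨fun x => Or.inl rfl, ?_, ?_⟩
    · rintro x y (h | h)
      · exact Or.inl h.symm
      · exact Or.inr (by rw [h, neg_neg])
    · rintro x y z (h1 | h1) (h2 | h2)
      · exact Or.inl (h1.trans h2)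
      · exact Or.inr (h1.trans h2)
      · exact Or.inr (by rw [h1, h2])
      · exact Or.inl (by rw [h1, h2, neg_neg])

/-- The real projective plane, as the quotient of the sphere by the antipodal relation,
with the quotient topology. -/
abbrev P2 : Type := Quotient antipodalSetoid

/-- The group of self-homeomorphisms of the projective plane, as a subspace of `C(P², P²)`
with the compact-open topology. -/
abbrev HomP2 : Type := {f : C(P2, P2) // IsHomeomorph f}

/-- `g` is the self-homeomorphism of `P²` induced by the (orthogonal) matrix `Q`,
i.e. `g ∘ π = π ∘ Q` where `π` is the quotient map. -/
def InducedBy (g : HomP2) (Q : Matrix (Fin 3) (Fin 3) ℝ) : Prop :=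
  ∀ x y : Sph, (y : E3) = Q.mulVec (x : E3) → g.1 ⟦x⟧ = ⟦y⟧

/-- Composition in `Hom(P²)`. -/
def compH (g f : HomP2) : HomP2 :=
  ⟨g.1.comp f.1, by rw [ContinuousMap.coe_comp]; exact g.2.comp f.2⟩


open Set Filter Topology
open ComplexConjugate
open Complex (exp normSq_eq_norm_sq normSq_apply add_re ofReal_re sub_im sub_re cosh exp_ne_zero norm_real abs_im_le_norm exp_log exp_add abs_re_le_norm continuous_im mul_im add_im ofReal_im continuous_re norm_exp ofReal_zero re_add_im norm_le_of_forall_mem_frontier_norm_le mul_re exp_re I_re I_im norm_le_abs_re_add_abs_im continuous_ofReal conj_im neg_re ofReal_exp re_le_norm equivRealProdCLM conj_re norm_deriv_le_div_of_mapsTo_ball mul_conj normSq div_ofReal_im exp_zero log_im log_re)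
open Real (pi_pos log cos exp_pos norm_of_nonneg exp_le_exp exp_le_one_iff exp_neg pi_gt_three sin sin_sq_add_cos_sq exp_injective)
open scoped Real
open Function
local notation "𝕚" => Complex.I
variable {X : Type*} [TopologicalSpace X] {w z : ℂ} {F G : X → ℂ → ℂ} {J : ℂ → ℂ} {U : Set ℂ}
lemma cxt {z w : ℂ} : z.re = w.re → z.im = w.im → z = w := Complex.ext
abbrev DD : Set ℂ := ball (0:ℂ) 1
abbrev cD : Set ℂ := closedBall (0:ℂ) 1
lemma tlu_of_equi {ι X : Type*} [TopologicalSpace X] {F : ι → X → ℂ} {f : X → ℂ} {l : Filter ι}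
    [l.NeBot] {s : Set X}
    (he : ∀ x ∈ s, ∀ ε > 0, ∃ t ∈ 𝓝[s] x, ∀ n, ∀ y ∈ t, dist (F n y) (F n x) ≤ ε)
    (hp : ∀ x ∈ s, Tendsto (fun n => F n x) l (𝓝 (f x))) : TendstoLocallyUniformlyOn F f l s := by
  rw [tendstoLocallyUniformlyOn_iff]
  intro ε hε x hx
  obtain ⟨t, ht, h⟩ := he x hx (ε/4) (by positivity)
  refine ⟨t ∩ s, Filter.inter_mem ht self_mem_nhdsWithin, ?_⟩
  have h1 := (Metric.tendsto_nhds.1 (hp x hx)) (ε/4) (by positivity)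
  filter_upwards [h1] with n hn y hy
  have h2 : dist (f y) (f x) ≤ ε/4 :=
    le_of_tendsto ((hp y hy.2).dist (hp x hx)) (Eventually.of_forall fun m => h m y hy.1)
  have h3 := h n y hy.1
  have := dist_triangle4 (f y) (f x) (F n x) (F n y)
  rw [dist_comm (f x), dist_comm (F n x) (F n y)] at this
  linarith
lemma montel {ι : Type*} {F : ι → ℂ → ℂ} (l : Ultrafilter ι) (hU : IsOpen U) {M : ℝ}
    (hd : ∀ n, DifferentiableOn ℂ (F n) U) (hM : ∀ n, ∀ z ∈ U, ‖F n z‖ ≤ M) :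
    ∃ f, TendstoLocallyUniformlyOn F f (l : Filter ι) U := by
  have h1 : ∀ z, ∃ w, z ∈ U → Tendsto (fun n => F n z) l (𝓝 w) := by
    intro z
    by_cases hz : z ∈ U
    · obtain ⟨w, -, hw⟩ := (isCompact_closedBall (0:ℂ) M).ultrafilter_le_nhds (l.map fun n => F n z)
        (by
          rw [le_principal_iff]
          change _ ∈ Filter.map _ _
          exact Filter.eventually_map.2 (Filter.Eventually.of_forall fun n => by simpa using hM n z hz))
      exact ⟨w, fun _ => hw⟩
    · exact ⟨0, fun h => absurd h hz⟩
  choose f hf using h1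
  refine ⟨f, tlu_of_equi ?_ hf⟩
  intro z hz ε hε
  obtain ⟨R, hR, hb⟩ := Metric.isOpen_iff.1 hU z hz
  have hM0 : 0 ≤ M ∨ IsEmpty ι := by
    rcases isEmpty_or_nonempty ι with h | ⟨⟨n⟩⟩
    · exact Or.inr h
    · exact Or.inl ((norm_nonneg _).trans (hM n z hz))
  rcases hM0 with hM0 | hE
  swap
  · exact ⟨univ, univ_mem, fun n => (hE.false n).elim⟩
  refine ⟨ball z (min R (ε * R / (2*M+1))), mem_nhdsWithin_of_mem_nhds (ball_mem_nhds _ (by positivity)), ?_⟩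
  intro n y hy
  rw [mem_ball, lt_min_iff] at hy
  have := Complex.dist_le_div_mul_dist_of_mapsTo_ball (f := F n) (c := z) (z := y) (R₁ := R) (R₂ := 2*M+1)
    ((hd n).mono hb) (fun w hw => by
      rw [mem_closedBall, dist_eq_norm]
      have h1 := norm_sub_le (F n w) (F n z)
      have := hM n w (hb hw); have := hM n z hz
      linarith) hy.1
  refine this.trans ?_
  rw [div_mul_eq_mul_div, div_le_iff₀ hR]
  have h2 := hy.2.le
  rw [le_div_iff₀ (by positivity)] at h2
  linarith
lemma inj_not_const {f : ℂ → ℂ} (hU : IsOpen U)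
    (hi : InjOn f U) {z : ℂ} (hz : z ∈ U) : ¬ ∀ᶠ w in 𝓝 z, f w = f z := by
  intro h
  have h2 : ∀ᶠ w in 𝓝 z, w = z := by
    filter_upwards [h, hU.mem_nhds hz] with w hw hwU using hi hwU hz hw
  have h3 : ∀ᶠ w in 𝓝[≠] z, w = z := h2.filter_mono nhdsWithin_le_nhds
  obtain ⟨w, hw, hw'⟩ := (h3.and self_mem_nhdsWithin).exists
  exact hw' hw
lemma inj_nhds_le {f : ℂ → ℂ} (hU : IsOpen U) (hf : DifferentiableOn ℂ f U)
    (hi : InjOn f U) {z : ℂ} (hz : z ∈ U) : 𝓝 (f z) ≤ map f (𝓝 z) :=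
  ((hf.analyticAt (hU.mem_nhds hz)).eventually_constant_or_nhds_le_map_nhds).resolve_left
    (inj_not_const hU hi hz)
lemma inj_isOpen_image {f : ℂ → ℂ} (hU : IsOpen U) (hf : DifferentiableOn ℂ f U)
    (hi : InjOn f U) {V : Set ℂ} (hV : IsOpen V) (hVU : V ⊆ U) : IsOpen (f '' V) := by
  rw [isOpen_iff_mem_nhds]
  rintro _ ⟨z, hz, rfl⟩
  exact inj_nhds_le hU hf hi (hVU hz) (image_mem_map (hV.mem_nhds hz))
lemma inj_inv_cont {X : Type*} [TopologicalSpace X] {f : ℂ → ℂ} {p g : X → ℂ} (hU : IsOpen U)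
    (hf : DifferentiableOn ℂ f U)
    (hi : InjOn f U) {V : Set X} (hg : MapsTo g V U) (hfg : ∀ z ∈ V, f (g z) = p z)
    (hp : ContinuousOn p V) : ContinuousOn g V := by
  intro v hv
  rw [ContinuousWithinAt, tendsto_def]
  intro N hN
  have h1 : f '' (N ∩ U) ∈ 𝓝 (f (g v)) :=
    inj_nhds_le hU hf hi (hg hv) (image_mem_map (inter_mem hN (hU.mem_nhds (hg hv))))
  rw [hfg v hv] at h1
  filter_upwards [(hp v hv) h1, self_mem_nhdsWithin] with x hx hxV
  obtain ⟨n, hn, hn2⟩ := hx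
  rw [← hfg x hxV] at hn2
  rw [mem_preimage, ← hi hn.2 (hg hxV) hn2]
  exact hn.1
lemma inj_deriv_ne {f : ℂ → ℂ} (hU : IsOpen U) (hf : DifferentiableOn ℂ f U)
    (hi : InjOn f U) {z : ℂ} (hz : z ∈ U) : deriv f z ≠ 0 := by
  set g := invFunOn f U with hg
  have hV : IsOpen (f '' U) := inj_isOpen_image hU hf hi hU Subset.rfl
  have hgU : MapsTo g (f '' U) U := fun y hy => invFunOn_mem hy
  have hfg : ∀ y ∈ f '' U, f (g y) = id y := fun y hy => invFunOn_eq hy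
  have hgf : ∀ x ∈ U, g (f x) = x := fun x hx => hi.leftInvOn_invFunOn hx
  have hgc : ContinuousOn g (f '' U) := inj_inv_cont hU hf hi hgU hfg continuousOn_id
  have key : ∀ y ∈ f '' U, deriv f (g y) ≠ 0 → DifferentiableAt ℂ g y := by
    intro y hy hne
    have hd : HasDerivAt f (deriv f (g y)) (g y) :=
      ((hf _ (hgU hy)).differentiableAt (hU.mem_nhds (hgU hy))).hasDerivAt
    exact (HasDerivAt.of_local_left_inverse (hgc.continuousAt (hV.mem_nhds hy)) hd hne
      (by filter_upwards [hV.mem_nhds hy] with x hx using hfg x hx)).differentiableAt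
  have hfa := hf.analyticAt (hU.mem_nhds hz)
  have hev : ∀ᶠ w in 𝓝[≠] z, deriv f w ≠ 0 := by
    rcases hfa.deriv.eventually_eq_zero_or_eventually_ne_zero with h | h
    · exfalso
      obtain ⟨r, hr, hb⟩ := Metric.eventually_nhds_iff_ball.1 (h.and (hU.mem_nhds hz))
      apply inj_not_const hU hi hz
      filter_upwards [ball_mem_nhds z hr] with w hw
      refine Convex.is_const_of_fderivWithin_eq_zero (𝕜 := ℂ) (convex_ball z r)
        (hf.mono fun w hw => (hb w hw).2) ?_ hw (mem_ball_self hr)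
      intro x hx
      rw [fderivWithin_of_isOpen isOpen_ball hx]
      ext
      simp [(hb x hx).1]
    · exact h
  have hgd : DifferentiableAt ℂ g (f z) := by
    have hfz : f z ∈ f '' U := mem_image_of_mem _ hz
    have h1 : ∀ᶠ y in 𝓝[≠] f z, DifferentiableAt ℂ g y := by
      rw [eventually_nhdsWithin_iff] at hev ⊢
      have := (hgc.continuousAt (hV.mem_nhds hfz))
      rw [ContinuousAt, hgf z hz] at this
      filter_upwards [this.eventually hev, hV.mem_nhds hfz] with y hy hyU hyne
      refine key y hyU (hy ?_)
      intro h
      apply hyne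
      have := hfg y hyU
      simp only [mem_singleton_iff] at h ⊢
      rw [h] at this
      exact this.symm
    exact (Complex.analyticAt_of_differentiable_on_punctured_nhds_of_continuousAt h1
      (hgc.continuousAt (hV.mem_nhds hfz))).differentiableAt
  intro h0
  have hd : HasDerivAt f (deriv f z) z := ((hf _ hz).differentiableAt (hU.mem_nhds hz)).hasDerivAt
  have hc : HasDerivAt (g ∘ f) (deriv g (f z) * deriv f z) z := hgd.hasDerivAt.comp z hd
  have hid : HasDerivAt (g ∘ f) 1 z := (hasDerivAt_id z).congr_of_eventuallyEq
    (by filter_upwards [hU.mem_nhds hz] with w hw using hgf w hw)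
  have := hc.unique hid
  rw [h0] at this
  simp at this
lemma inj_inv_holo {f p g : ℂ → ℂ} {U V : Set ℂ} (hU : IsOpen U) (hf : DifferentiableOn ℂ f U)
    (hi : InjOn f U) (hV : IsOpen V) (hg : MapsTo g V U) (hfg : ∀ z ∈ V, f (g z) = p z)
    (hp : DifferentiableOn ℂ p V) : DifferentiableOn ℂ g V := by
  have hgc := inj_inv_cont hU hf hi hg hfg hp.continuousOn
  intro v hv
  apply DifferentiableAt.differentiableWithinAt
  have hs : HasStrictDerivAt f (deriv f (g v)) (g v) :=
    (hf.analyticAt (hU.mem_nhds (hg hv))).hasStrictDerivAt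
  have hne := inj_deriv_ne hU hf hi (hg hv)
  have h1 := hs.eventually_left_inverse hne
  have h2 := (hgc.continuousAt (hV.mem_nhds hv)).eventually h1
  have h3 : g =ᶠ[𝓝 v] (hs.localInverse _ _ _ hne) ∘ p := by
    filter_upwards [h2, hV.mem_nhds hv] with x hx hxV
    rw [Function.comp, ← hfg x hxV]; exact hx.symm
  refine DifferentiableAt.congr_of_eventuallyEq ?_ h3
  have h4 := (hs.to_localInverse hne).hasDerivAt.differentiableAt
  rw [hfg v hv] at h4
  exact h4.comp v (hp.differentiableAt (hV.mem_nhds hv))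
lemma hurwitz {ι : Type*} {l : Filter ι} [l.NeBot] {F : ι → ℂ → ℂ} {f : ℂ → ℂ} (hU : IsOpen U)
    (hd : ∀ᶠ n in l, DifferentiableOn ℂ (F n) U) (hn : ∀ᶠ n in l, ∀ z ∈ U, F n z ≠ 0)
    (ht : TendstoLocallyUniformlyOn F f l U) {z : ℂ} (hz : z ∈ U) (hz0 : f z = 0) :
    ∀ᶠ w in 𝓝 z, f w = 0 := by
  have hf : DifferentiableOn ℂ f U := ht.differentiableOn hd hU
  rcases (hf.analyticAt (hU.mem_nhds hz)).eventually_eq_zero_or_eventually_ne_zero with h | h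
  · exact h
  exfalso
  rw [eventually_nhdsWithin_iff] at h
  obtain ⟨r, hr, hb⟩ := Metric.nhds_basis_closedBall.eventually_iff.1 (h.and (hU.mem_nhds hz))
  have hbU : closedBall z r ⊆ U := fun w hw => (hb hw).2
  have hsU : sphere z r ⊆ U := sphere_subset_closedBall.trans hbU
  obtain ⟨w0, hw0, hmin⟩ := (isCompact_sphere z r).exists_isMinOn (NormedSpace.sphere_nonempty.2 hr.le)
    ((hf.continuousOn.mono hsU).norm)
  have hm : 0 < ‖f w0‖ := by
    rw [norm_pos_iff]
    refine (hb (sphere_subset_closedBall hw0)).1 ?_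
    rintro rfl
    simp at hw0; linarith
  have hunif : TendstoUniformlyOn F f l (closedBall z r) :=
    (tendstoLocallyUniformlyOn_iff_forall_isCompact hU).1 ht _ hbU (isCompact_closedBall z r)
  rw [tendstoUniformlyOn_iff] at hunif
  obtain ⟨n, hn1, hn2, hn3⟩ := ((hunif (‖f w0‖/2) (by positivity)).and (hd.and hn)).exists
  have hinv : DifferentiableOn ℂ (fun w => (F n w)⁻¹) (closedBall z r) :=
    (hn2.mono hbU).inv fun w hw => hn3 w (hbU hw)
  have hmax := norm_le_of_forall_mem_frontier_norm_le (U := ball z r) isBounded_ball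
    (DifferentiableOn.diffContOnCl (by rwa [closure_ball z hr.ne']))
    (C := (‖f w0‖/2)⁻¹) (by
      intro w hw
      rw [frontier_ball z hr.ne'] at hw
      rw [norm_inv]
      apply inv_anti₀ (by positivity)
      have h1 : ‖f w0‖ ≤ ‖f w‖ := hmin hw
      have h2 := hn1 w (sphere_subset_closedBall hw)
      rw [dist_eq_norm] at h2
      have := norm_sub_norm_le (f w) (F n w)
      linarith) (subset_closure (mem_ball_self hr))
  rw [norm_inv] at hmax
  have h1 := hn1 z (mem_closedBall_self hr.le)
  rw [hz0, dist_zero_left] at h1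
  have h2 : 0 < ‖F n z‖ := norm_pos_iff.2 (hn3 z hz)
  have := (inv_le_inv₀ h2 (by positivity)).1 hmax
  linarith

open ComplexConjugate in
def Mb (w z : ℂ) : ℂ := (z - w) / (1 - conj w * z)
lemma Mb_den (hw : ‖w‖ < 1) (hz : ‖z‖ < 1) : 1 - conj w * z ≠ 0 := by
  intro h
  have h1 : ‖conj w * z‖ = 1 := by rw [← sub_eq_zero.1 h]; simp
  rw [norm_mul, Complex.norm_conj] at h1
  nlinarith [norm_nonneg w, norm_nonneg z]
lemma Mb_lt (hw : ‖w‖ < 1) (hz : ‖z‖ < 1) : ‖Mb w z‖ < 1 := by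
  rw [Mb, norm_div, div_lt_one (norm_pos_iff.2 (Mb_den hw hz))]
  apply lt_of_pow_lt_pow_left₀ 2 (norm_nonneg _)
  have h1 : ‖w‖^2 < 1 := by nlinarith [norm_nonneg w]
  have h2 : ‖z‖^2 < 1 := by nlinarith [norm_nonneg z]
  rw [← normSq_eq_norm_sq] at h1 h2 ⊢
  rw [← normSq_eq_norm_sq]
  simp only [normSq_apply, sub_re, sub_im, mul_re, mul_im,
    conj_re, conj_im, Complex.one_re, Complex.one_im] at *
  nlinarith [mul_pos (sub_pos.2 h1) (sub_pos.2 h2)]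
lemma Mb_inj {w z z' : ℂ} (hw : ‖w‖ < 1) (hz : ‖z‖ < 1) (hz' : ‖z'‖ < 1) (h : Mb w z = Mb w z') :
    z = z' := by
  rw [Mb, Mb, div_eq_div_iff (Mb_den hw hz) (Mb_den hw hz')] at h
  have h1 : (z - z') * (1 - conj w * w) = 0 := by linear_combination h
  rcases mul_eq_zero.1 h1 with h2 | h2
  · exact sub_eq_zero.1 h2
  · exact absurd h2 (Mb_den hw hw)
lemma Mb_deriv (hw : ‖w‖ < 1) (hz : ‖z‖ < 1) :
    HasDerivAt (Mb w) ((1 - conj w * w) / (1 - conj w * z)^2) z := by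
  have h := ((hasDerivAt_id z).sub_const w).div
    (((hasDerivAt_id z).const_mul (conj w)).const_sub 1) (Mb_den hw hz)
  refine h.congr_deriv ?_
  simp only [id]
  congr 1; ring
lemma sqrt_holo {s q : ℂ → ℂ} (hU : IsOpen U) (hs : ContinuousOn s U)
    (hq : DifferentiableOn ℂ q U) (hsq : ∀ z ∈ U, s z ^ 2 = q z) (hq0 : ∀ z ∈ U, q z ≠ 0) {z : ℂ} (hz : z ∈ U) :
    HasDerivAt s (deriv q z / (2 * s z)) z := by
  have hs0 : s z ≠ 0 := fun h => hq0 z hz (by rw [← hsq z hz, h]; simp)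
  have hqd : HasDerivAt q (deriv q z) z := (hq.differentiableAt (hU.mem_nhds hz)).hasDerivAt
  have hsc := hs.continuousAt (hU.mem_nhds hz)
  rw [hasDerivAt_iff_tendsto_slope] at hqd ⊢
  have h1 : Tendsto (fun w => s w + s z) (𝓝[≠] z) (𝓝 (2 * s z)) := by
    have : Tendsto (fun w => s w + s z) (𝓝[≠] z) (𝓝 (s z + s z)) :=
      (hsc.tendsto.mono_left nhdsWithin_le_nhds).add_const _
    rwa [← two_mul] at this
  refine (hqd.div h1 (by simpa using hs0)).congr' ?_
  have h2 : ∀ᶠ w in 𝓝[≠] z, s w + s z ≠ 0 := h1.eventually_ne (by simpa using hs0)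
  filter_upwards [h2, mem_nhdsWithin_of_mem_nhds (hU.mem_nhds hz)] with w hw hwU
  simp only [Pi.div_apply, slope_def_field]
  rw [← hsq w hwU, ← hsq z hz]
  rw [div_div, mul_comm, ← div_div, show (s w^2 - s z^2) = (s w - s z) * (s w + s z) by ring,
    mul_div_assoc, div_self hw, mul_one]
lemma riemann_abs (hU : IsOpen U) (hUc : IsPreconnected U) {a : ℂ} (ha : a ∈ U) {M : ℝ}
    (hM : ∀ z ∈ U, ‖z‖ ≤ M)
    (hroot : ∀ q : ℂ → ℂ, DifferentiableOn ℂ q U → (∀ z ∈ U, q z ≠ 0) →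
      ∃ s : ℂ → ℂ, ContinuousOn s U ∧ ∀ z ∈ U, s z ^ 2 = q z) :
    ∃ g : ℂ → ℂ, DifferentiableOn ℂ g U ∧ InjOn g U ∧ g '' U = DD ∧ g a = 0 := by
  let P : (ℂ → ℂ) → Prop := fun g => DifferentiableOn ℂ g U ∧ InjOn g U ∧ MapsTo g U DD ∧ g a = 0
  obtain ⟨r, hr, hrU⟩ := Metric.isOpen_iff.1 hU a ha
  have hbd : BddAbove ((fun g => ‖deriv g a‖) '' {g | P g}) := by
    refine ⟨1 / r, ?_⟩
    rintro _ ⟨g, hg, rfl⟩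
    refine norm_deriv_le_div_of_mapsTo_ball (hg.1.mono hrU) ?_ hr
    intro z hz
    rw [hg.2.2.2]
    exact ball_subset_closedBall (hg.2.2.1 (hrU hz))
  have hM0 : 0 ≤ M := (norm_nonneg _).trans (hM a ha)
  have hP0 : P (fun z => (z - a) / (2*M+1 : ℝ)) := by
    have hne : ((2*M+1 : ℝ):ℂ) ≠ 0 := by exact_mod_cast (by positivity : (2*M+1:ℝ) ≠ 0)
    refine ⟨by fun_prop, ?_, ?_, by simp⟩
    · intro x _ y _ h
      simp only [div_left_inj' hne, sub_left_inj] at h; exact h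
    · intro z hz
      rw [mem_ball_zero_iff, norm_div, norm_real, norm_of_nonneg (by positivity),
        div_lt_one (by positivity)]
      have := norm_sub_le z a
      have := hM z hz; have := hM a ha
      linarith
  set sg := sSup ((fun g => ‖deriv g a‖) '' {g | P g}) with hsg
  have hsgpos : 0 < sg := by
    refine lt_of_lt_of_le ?_ (le_csSup hbd ⟨_, hP0, rfl⟩)
    exact norm_pos_iff.2 (inj_deriv_ne hU hP0.1 hP0.2.1 ha)
  obtain ⟨u, -, hu, hu2⟩ := exists_seq_tendsto_sSup (S := (fun g => ‖deriv g a‖) '' {g | P g}) ⟨_, _, hP0, rfl⟩ hbd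
  choose G hG hGu using hu2
  obtain ⟨g, hg⟩ := montel (hyperfilter ℕ) hU (M := 1) (fun n => (hG n).1)
    (fun n z hz => (mem_ball_zero_iff.1 ((hG n).2.2.1 hz)).le)
  have hle : (hyperfilter ℕ : Filter ℕ) ≤ atTop := Nat.hyperfilter_le_atTop
  have hgd : DifferentiableOn ℂ g U := hg.differentiableOn (Eventually.of_forall fun n => (hG n).1) hU
  have hgder : ‖deriv g a‖ = sg := by
    have h1 := (hg.deriv (Eventually.of_forall fun n => (hG n).1) hU).tendsto_at ha
    refine tendsto_nhds_unique h1.norm ((hu.mono_left hle).congr fun n => ?_)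
    exact (hGu n).symm
  have hga : g a = 0 := by
    refine tendsto_nhds_unique (hg.tendsto_at ha) (tendsto_const_nhds.congr fun n => ((hG n).2.2.2).symm)
  have hgi : InjOn g U := by
    intro z1 h1 z2 h2 h12
    by_contra hne
    have hU' : IsOpen (U \ {z1}) := hU.sdiff isClosed_singleton
    have hev := hurwitz (l := (hyperfilter ℕ : Filter ℕ)) (F := fun n z => G n z - G n z1)
      (f := fun z => g z - g z1) hU'
      (Eventually.of_forall fun n => ((hG n).1.mono sdiff_subset).sub_const _)
      (Eventually.of_forall fun n z hz h => hz.2 ((hG n).2.1 hz.1 h1 (sub_eq_zero.1 h)))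
      (by
        rw [tendstoLocallyUniformlyOn_iff]
        intro ε hε x hx
        obtain ⟨t, ht, h⟩ := (tendstoLocallyUniformlyOn_iff.1 hg) (ε/2) (by positivity) x hx.1
        refine ⟨t, nhdsWithin_mono _ sdiff_subset ht, ?_⟩
        filter_upwards [h, Metric.tendsto_nhds.1 (hg.tendsto_at h1) (ε/2) (by positivity)] with n hn hn' y hy
        have := hn y hy
        rw [dist_eq_norm] at *
        have h3 := norm_sub_le (g y - G n y) (g z1 - G n z1)
        rw [norm_sub_rev (g z1)] at h3
        rw [show g y - g z1 - (G n y - G n z1) = (g y - G n y) - (g z1 - G n z1) by ring]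
        linarith) (z := z2) ⟨h2, fun h => hne h.symm⟩ (sub_eq_zero.2 h12.symm)
    have h3 : EqOn g (fun _ => g z1) U := (hgd.analyticOnNhd hU).eqOn_of_preconnected_of_eventuallyEq
      analyticOnNhd_const hUc h2 (by filter_upwards [hev] with w hw using sub_eq_zero.1 hw)
    have h4 : deriv g a = 0 := by
      rw [(h3.eventuallyEq_of_mem (hU.mem_nhds ha)).deriv_eq]; simp
    rw [h4] at hgder; simp at hgder; linarith
  have hgm : MapsTo g U DD := by
    have h1 : g '' U ⊆ cD := by
      rintro _ ⟨z, hz, rfl⟩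
      rw [mem_closedBall_zero_iff]
      exact le_of_tendsto (hg.tendsto_at hz).norm
        (Eventually.of_forall fun n => (mem_ball_zero_iff.1 ((hG n).2.2.1 hz)).le)
    have h2 := interior_maximal h1 (inj_isOpen_image hU hgd hgi hU Subset.rfl)
    rw [interior_closedBall _ one_ne_zero] at h2
    exact mapsTo_iff_image_subset.2 h2
  refine ⟨g, hgd, hgi, Subset.antisymm (mapsTo_iff_image_subset.1 hgm) ?_, hga⟩
  intro w hw
  by_contra hnot
  have hw1 : ‖w‖ < 1 := mem_ball_zero_iff.1 hw
  have hg1 : ∀ z ∈ U, ‖g z‖ < 1 := fun z hz => mem_ball_zero_iff.1 (hgm hz)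
  have hw0 : w ≠ 0 := by rintro rfl; exact hnot ⟨a, ha, hga⟩
  have hqd : DifferentiableOn ℂ (fun z => Mb w (g z)) U := fun z hz =>
    ((Mb_deriv hw1 (hg1 z hz)).differentiableAt.comp z (hgd.differentiableAt (hU.mem_nhds hz))).differentiableWithinAt
  have hq0 : ∀ z ∈ U, Mb w (g z) ≠ 0 := by
    intro z hz h
    rw [Mb, div_eq_zero_iff] at h
    rcases h with h | h
    · exact hnot ⟨z, hz, sub_eq_zero.1 h⟩
    · exact Mb_den hw1 (hg1 z hz) h
  obtain ⟨s, hsc, hs⟩ := hroot _ hqd hq0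
  have hsd := fun z (hz : z ∈ U) => sqrt_holo hU hsc hqd hs hq0 hz
  have hs1 : ∀ z ∈ U, ‖s z‖ < 1 := by
    intro z hz
    have := Mb_lt hw1 (hg1 z hz)
    rw [← hs z hz, norm_pow] at this
    exact (pow_lt_one_iff_of_nonneg (norm_nonneg _) two_ne_zero).1 this
  have hPn : P (fun z => Mb (s a) (s z)) := by
    refine ⟨fun z hz => ?_, ?_, ?_, by simp [Mb]⟩
    · exact ((Mb_deriv (hs1 a ha) (hs1 z hz)).differentiableAt.comp z (hsd z hz).differentiableAt).differentiableWithinAt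
    · intro x hx y hy h
      have h1 := Mb_inj (hs1 a ha) (hs1 x hx) (hs1 y hy) h
      have h2 : Mb w (g x) = Mb w (g y) := by rw [← hs x hx, ← hs y hy, h1]
      exact hgi hx hy (Mb_inj hw1 (hg1 x hx) (hg1 y hy) h2)
    · intro z hz
      exact mem_ball_zero_iff.2 (Mb_lt (hs1 a ha) (hs1 z hz))
  have hlt := le_csSup hbd ⟨_, hPn, rfl⟩
  rw [← hsg] at hlt
  have hsa : s a ^ 2 = -w := by rw [hs a ha, hga]; simp [Mb]
  have hD1 : deriv (fun z => Mb w (g z)) a = (1 - conj w * w) * deriv g a := by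
    have := (Mb_deriv hw1 (hg1 a ha)).comp a (hgd.differentiableAt (hU.mem_nhds ha)).hasDerivAt
    rw [hga] at this
    simpa [comp_def] using this.deriv
  have hD2 : deriv (fun z => Mb (s a) (s z)) a =
      (1 - conj (s a) * s a) / (1 - conj (s a) * s a)^2 * (deriv (fun z => Mb w (g z)) a / (2 * s a)) := by
    simpa [comp_def] using ((Mb_deriv (hs1 a ha) (hs1 a ha)).comp a (hsd a ha)).deriv
  set x := ‖s a‖ with hx
  have hx1 : x < 1 := hs1 a ha
  have hx0 : 0 < x := by
    rw [hx, norm_pos_iff]; intro h; rw [h] at hsa; simp at hsa; exact hw0 hsa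
  have hxw : ‖w‖ = x^2 := by rw [hx, ← norm_pow, hsa, norm_neg]
  have e1 : ∀ v : ℂ, 1 - conj v * v = ((1 - ‖v‖^2 : ℝ) : ℂ) := by
    intro v; rw [← Complex.normSq_eq_conj_mul_self, normSq_eq_norm_sq]; push_cast; ring
  have : ‖deriv (fun z => Mb (s a) (s z)) a‖ = (1 + x^2) / (2 * x) * sg := by
    rw [hD2, hD1, e1, e1, hxw, norm_mul, norm_div, norm_div, norm_mul, norm_mul, norm_pow, hgder,
      norm_real, norm_real, norm_of_nonneg (by nlinarith), norm_of_nonneg (by nlinarith [pow_le_one₀ hx0.le hx1.le (n := 4)]), ← hx]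
    have : 1 - x^2 ≠ 0 := by nlinarith
    have hx0' := hx0.ne'
    simp only [RCLike.norm_ofNat]
    field_simp
    ring
  simp only [this] at hlt
  have h2 : 1 < (1 + x^2) / (2 * x) := by
    rw [lt_div_iff₀ (by positivity)]; nlinarith [sq_nonneg (1-x), mul_pos (sub_pos.2 hx1) (sub_pos.2 hx1)]
  nlinarith
structure Adm (J : ℂ → ℂ) : Prop where
  cont : ContinuousOn J cD
  inj : InjOn J cD
  isOpen : IsOpen (J '' DD)
lemma DD_sub : DD ⊆ cD := ball_subset_closedBall
lemma DD_sc : IsSimplyConnected DD := by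
  have : ContractibleSpace DD := (convex_ball (0:ℂ) 1).contractibleSpace ⟨0, by simp⟩
  exact (inferInstance : SimplyConnectedSpace DD)
def Ji (J : ℂ → ℂ) : ℂ → ℂ := invFunOn J cD
lemma Adm.Ji_left (hJ : Adm J) {x : ℂ} (hx : x ∈ cD) : Ji J (J x) = x :=
  hJ.inj.leftInvOn_invFunOn hx
lemma cont_inv_of_compact {f g : ℂ → ℂ} {K : Set ℂ} (hK : IsCompact K) (hf : ContinuousOn f K)
    (hg : ∀ x ∈ K, g (f x) = x) : ContinuousOn g (f '' K) := by
  rw [continuousOn_iff_isClosed]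
  intro t ht
  refine ⟨f '' (K ∩ t), ((hK.inter_right ht).image_of_continuousOn (hf.mono inter_subset_left)).isClosed, ?_⟩
  ext y
  constructor
  · rintro ⟨h, x, hx, rfl⟩
    refine ⟨⟨x, ⟨hx, ?_⟩, rfl⟩, x, hx, rfl⟩
    rwa [mem_preimage, hg x hx] at h
  · rintro ⟨⟨x, hx, rfl⟩, -⟩
    refine ⟨?_, x, hx.1, rfl⟩
    rw [mem_preimage, hg x hx.1]; exact hx.2
lemma Adm.Ji_cont (hJ : Adm J) : ContinuousOn (Ji J) (J '' cD) :=
  cont_inv_of_compact (isCompact_closedBall 0 1) hJ.cont fun _ hx => hJ.Ji_left hx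
lemma riemann (hJ : Adm J) :
    ∃ g : ℂ → ℂ, DifferentiableOn ℂ g (J '' DD) ∧ InjOn g (J '' DD) ∧ g '' (J '' DD) = DD ∧ g (J 0) = 0 := by
  obtain ⟨M, hM⟩ := ((isCompact_closedBall (0:ℂ) 1).image_of_continuousOn hJ.cont).isBounded.exists_norm_le
  refine riemann_abs hJ.isOpen ((convex_ball (0:ℂ) 1).isPreconnected.image _ (hJ.cont.mono DD_sub))
    ⟨0, by simp, rfl⟩ (M := M) (fun z hz => hM z (image_mono DD_sub hz)) ?_
  intro q hq hq0
  obtain ⟨f, hf, hf2⟩ := Complex.exists_continuousOn_pow_eq DD_sc isOpen_ball (g := q ∘ J)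
    (hq.continuousOn.comp (hJ.cont.mono DD_sub) (mapsTo_image _ _)) (by
      rintro ⟨x, hx, h⟩; exact hq0 _ ⟨x, hx, rfl⟩ h) two_ne_zero
  refine ⟨f ∘ Ji J, hf.comp (hJ.Ji_cont.mono (image_mono DD_sub)) ?_, ?_⟩
  · rintro _ ⟨x, hx, rfl⟩; rw [hJ.Ji_left (DD_sub hx)]; exact hx
  · rintro _ ⟨x, hx, rfl⟩
    rw [Function.comp, hJ.Ji_left (DD_sub hx)]; exact hf2 x

open MeasureTheory in
lemma area_bound {f : ℂ → ℂ} {W : Set ℂ} (hW : IsOpen W) (hf : DifferentiableOn ℂ f W) (hi : InjOn f W)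
    {M : ℝ} (hM : ∀ z ∈ W, ‖f z‖ ≤ M) :
    ∫⁻ s : ℝ, ∫⁻ θ : ℝ, W.indicator (fun z => ENNReal.ofReal (‖deriv f z‖^2)) (s + θ * 𝕚)
      ≤ ENNReal.ofReal M ^ 2 * NNReal.pi := by
  have h1 := lintegral_abs_det_fderiv_eq_addHaar_image (volume : Measure ℂ) hW.measurableSet
    (f' := fun z => (ContinuousLinearMap.toSpanSingleton ℂ (deriv f z)).restrictScalars ℝ)
    (fun z hz => (hf.differentiableAt (hW.mem_nhds hz)).hasDerivAt.hasFDerivAt.restrictScalars ℝ |>.hasFDerivWithinAt) hi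
  have h2 : volume (f '' W) ≤ ENNReal.ofReal M ^ 2 * NNReal.pi := by
    rw [← Complex.volume_closedBall (0:ℂ)]
    apply measure_mono
    rintro _ ⟨z, hz, rfl⟩
    simpa using hM z hz
  rw [← h1, ← lintegral_indicator hW.measurableSet] at h2
  refine le_trans (le_of_eq ?_) h2
  have h3 : ∀ z, ENNReal.ofReal |((ContinuousLinearMap.toSpanSingleton ℂ (deriv f z)).restrictScalars ℝ).det| = ENNReal.ofReal (‖deriv f z‖^2) := by
    intro z
    congr 1
    simp [ContinuousLinearMap.det, LinearMap.det_restrictScalars, Algebra.norm_complex_apply, normSq_eq_norm_sq]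
  simp only [h3]
  have hm : Measurable (W.indicator (fun z => ENNReal.ofReal (‖deriv f z‖^2))) := by
    exact Measurable.indicator (by fun_prop) hW.measurableSet
  rw [← (Complex.volume_preserving_equiv_real_prod.symm _).lintegral_comp hm, Measure.volume_eq_prod,
    lintegral_prod _ (by fun_prop)]
  congr 1; ext s; congr 1; ext θ
  congr 1
  simp [Complex.measurableEquivRealProd_symm_apply, Complex.ext_iff]
open MeasureTheory in
lemma seg_bound {f : ℂ → ℂ} {W : Set ℂ} (hW : IsOpen W) (hf : DifferentiableOn ℂ f W) {s a b : ℝ}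
    (hab : a ≤ b) (hl : b - a ≤ 2 * π) (hseg : ∀ θ ∈ Icc a b, (s + θ * 𝕚 : ℂ) ∈ W) {η : ℝ} (hη : 0 < η)
    (hd : η ≤ ‖f (s + b * 𝕚) - f (s + a * 𝕚)‖) :
    ENNReal.ofReal (η^2 / (2 * π)) ≤
      ∫⁻ θ : ℝ, W.indicator (fun z => ENNReal.ofReal (‖deriv f z‖^2)) (s + θ * 𝕚) := by
  have hpi := pi_pos
  have hc : ContinuousOn (fun θ : ℝ => deriv f (s + θ * 𝕚)) (Icc a b) :=
    (hf.deriv hW).continuousOn.comp (by fun_prop) hseg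
  have hD : ∀ θ ∈ uIcc a b, HasDerivAt (fun θ : ℝ => f (s + θ * 𝕚)) (deriv f (s + θ * 𝕚) * 𝕚) θ := by
    intro θ hθ
    rw [uIcc_of_le hab] at hθ
    have h1 : HasDerivAt (fun θ : ℂ => (s + θ * 𝕚 : ℂ)) 𝕚 (θ : ℂ) := by
      simpa using ((hasDerivAt_id (θ:ℂ)).mul_const 𝕚).const_add (s : ℂ)
    exact ((hf.differentiableAt (hW.mem_nhds (hseg θ hθ))).hasDerivAt.comp (θ:ℂ) h1).comp_ofReal
  have hc2 : ContinuousOn (fun θ : ℝ => deriv f (s + θ * 𝕚) * 𝕚) (uIcc a b) := by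
    rw [uIcc_of_le hab]; exact hc.mul continuousOn_const
  have hint := intervalIntegral.integral_eq_sub_of_hasDerivAt hD hc2.intervalIntegrable
  have hsq : IntervalIntegrable (fun θ : ℝ => ‖deriv f (s + θ * 𝕚)‖^2) volume a b := by
    apply ContinuousOn.intervalIntegrable
    rw [uIcc_of_le hab]; exact hc.norm.pow 2
  have hn : η ≤ ∫ θ in a..b, ‖deriv f (s + θ * 𝕚)‖ := by
    refine hd.trans ?_
    rw [← hint]
    refine (intervalIntegral.norm_integral_le_integral_norm hab).trans (le_of_eq ?_)
    simp
  have hn2 : (∫ θ in a..b, ‖deriv f (s + θ * 𝕚)‖) ≤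
      ∫ θ in a..b, ((π / η) * ‖deriv f (s + θ * 𝕚)‖^2 + η / (4 * π)) := by
    apply intervalIntegral.integral_mono_on hab
    · apply ContinuousOn.intervalIntegrable
      rw [uIcc_of_le hab]; exact hc.norm
    · exact (hsq.const_mul _).add (by simp)
    · intro θ _
      set x := ‖deriv f (s + θ * 𝕚)‖
      have : (π / η) * x^2 + η / (4 * π) - x = (2 * π * x - η)^2 / (4 * π * η) := by
        field_simp; ring
      have : 0 ≤ (2 * π * x - η)^2 / (4 * π * η) := by positivity
      linarith
  rw [intervalIntegral.integral_add (hsq.const_mul _) (by simp), intervalIntegral.integral_const_mul,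
    intervalIntegral.integral_const, smul_eq_mul] at hn2
  have hn3 : η^2 / (2 * π) ≤ ∫ θ in a..b, ‖deriv f (s + θ * 𝕚)‖^2 := by
    set Y := ∫ θ in a..b, ‖deriv f (s + θ * 𝕚)‖^2
    have h5 : (b - a) * (η / (4 * π)) ≤ η / 2 := by
      calc _ ≤ 2 * π * (η / (4 * π)) := by gcongr
        _ = η / 2 := by field_simp; norm_num
    have h6 : η / 2 ≤ π / η * Y := by linarith
    rw [div_mul_eq_mul_div, le_div_iff₀ hη] at h6
    rw [div_le_iff₀ (by positivity)]; nlinarith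
  calc _ ≤ ENNReal.ofReal (∫ θ in a..b, ‖deriv f (s + θ * 𝕚)‖^2) := ENNReal.ofReal_le_ofReal hn3
    _ = ∫⁻ θ in Ioc a b, ENNReal.ofReal (‖deriv f (s + θ * 𝕚)‖^2) := by
      rw [intervalIntegral.integral_of_le hab, ofReal_integral_eq_lintegral_ofReal]
      · exact hsq.1
      · exact ae_of_all _ fun θ => by positivity
    _ ≤ _ := by
      rw [← lintegral_indicator measurableSet_Ioc]
      apply lintegral_mono
      intro θ
      by_cases h : θ ∈ Ioc a b
      · simp [h, hseg θ (Ioc_subset_Icc_self h)]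
      · simp [h]
lemma length_area0 {φ : ℂ → ℂ} (hφ : DifferentiableOn ℂ φ DD) (hi : InjOn φ DD) {M : ℝ}
    (hM : ∀ z ∈ DD, ‖φ z‖ ≤ M) {η δ : ℝ} (hη : 0 < η) (hδ : 0 < δ) (hδ1 : δ < 1)
    (h : 4 * π ^ 2 * M ^ 2 < η ^ 2 * (-log δ)) {ρ : ℝ} (hρ : 0 ≤ ρ) :
    ∃ s : ℝ, log δ < s ∧ s < log δ / 2 ∧ ∀ a b : ℝ, -π < a → a ≤ b → b < π →
      (-ρ + exp (s + a * 𝕚)) ∈ DD → (-ρ + exp (s + b * 𝕚)) ∈ DD →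
      ‖φ (-ρ + exp (s + b * 𝕚)) - φ (-ρ + exp (s + a * 𝕚))‖ < η := by
  by_contra hcon
  push Not at hcon
  have hpi := pi_pos
  have hlog : log δ < 0 := Real.log_neg hδ hδ1
  set W : Set ℂ := {ζ | |ζ.im| < π ∧ -ρ + exp ζ ∈ DD} with hWdef
  have hW : IsOpen W := by
    apply IsOpen.inter
    · exact isOpen_lt (f := fun ζ : ℂ => |ζ.im|) (by fun_prop) continuous_const
    · exact isOpen_ball.preimage (f := fun ζ : ℂ => -ρ + exp ζ) (by fun_prop)
  set f : ℂ → ℂ := fun ζ => φ (-ρ + exp ζ)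
  have hf : DifferentiableOn ℂ f W := by
    apply hφ.comp (by fun_prop)
    intro ζ hζ; exact hζ.2
  have hfi : InjOn f W := by
    intro x hx y hy hxy
    have := hi hx.2 hy.2 hxy
    have h2 : exp x = exp y := by simpa using this
    have hx' := abs_lt.1 hx.1
    have hy' := abs_lt.1 hy.1
    exact Complex.exp_inj_of_neg_pi_lt_of_le_pi hx'.1 hx'.2.le hy'.1 hy'.2.le h2
  have hA := area_bound hW hf hfi (M := M) (fun z hz => hM _ hz.2)
  have hB : ∀ s ∈ Ioo (log δ) (log δ / 2), ENNReal.ofReal (η^2 / (2 * π)) ≤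
      ∫⁻ θ : ℝ, W.indicator (fun z => ENNReal.ofReal (‖deriv f z‖^2)) (s + θ * 𝕚) := by
    intro s hs
    obtain ⟨a, b, ha, hab, hb, haD, hbD, hd⟩ := hcon s hs.1 hs.2
    refine seg_bound hW hf hab (by linarith) ?_ hη hd
    intro θ hθ
    refine ⟨by simp [abs_lt]; exact ⟨by linarith [hθ.1], by linarith [hθ.2]⟩, ?_⟩
    have key : ∀ t : ℝ, -ρ + exp (s + t * 𝕚) ∈ DD ↔
        ρ^2 + Real.exp s^2 - 2 * ρ * Real.exp s * cos t < 1 := by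
      intro t
      rw [mem_ball_zero_iff, ← sq_lt_one_iff₀ (norm_nonneg _), ← normSq_eq_norm_sq, normSq_apply]
      simp only [add_re, add_im, neg_re, Complex.neg_im, ofReal_re, ofReal_im,
        exp_re, Complex.exp_im, mul_re, mul_im, I_re, I_im]
      have := sin_sq_add_cos_sq t
      constructor <;> intro h <;> ring_nf at h ⊢ <;> nlinarith
    rw [key] at haD hbD ⊢
    have hcos : min (cos a) (cos b) ≤ cos θ := by
      rcases le_total 0 θ with h0 | h0
      · exact (min_le_right _ _).trans (Real.cos_le_cos_of_nonneg_of_le_pi h0 hb.le hθ.2)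
      · refine (min_le_left _ _).trans ?_
        rw [← Real.cos_neg a, ← Real.cos_neg θ]
        exact Real.cos_le_cos_of_nonneg_of_le_pi (by linarith) (by linarith) (by linarith [hθ.1])
    have he := exp_pos s
    have h0 : 0 ≤ 2 * ρ * Real.exp s := by positivity
    rcases min_le_iff.1 hcos with h1 | h1
    · nlinarith [mul_le_mul_of_nonneg_left h1 h0]
    · nlinarith [mul_le_mul_of_nonneg_left h1 h0]
  have hC : ENNReal.ofReal (η^2 / (2 * π)) * ENNReal.ofReal (log δ / 2 - log δ) ≤ ENNReal.ofReal M ^ 2 * NNReal.pi := by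
    refine le_trans ?_ hA
    rw [← Real.volume_Ioo, ← MeasureTheory.setLIntegral_const]
    exact (MeasureTheory.setLIntegral_mono' measurableSet_Ioo hB).trans (MeasureTheory.setLIntegral_le_lintegral _ _)
  have hM0 : 0 ≤ M := (norm_nonneg _).trans (hM 0 (by simp))
  have e1 : (NNReal.pi : ENNReal) = ENNReal.ofReal π := by
    rw [← NNReal.coe_real_pi, ENNReal.ofReal_coe_nnreal]
  rw [e1, ← ENNReal.ofReal_mul (by positivity), ← ENNReal.ofReal_pow hM0, ← ENNReal.ofReal_mul (by positivity),
    ENNReal.ofReal_le_ofReal_iff (by positivity)] at hC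
  rw [div_mul_eq_mul_div, div_le_iff₀ (by positivity)] at hC
  nlinarith
lemma length_area {φ : ℂ → ℂ} (hφ : DifferentiableOn ℂ φ DD) (hi : InjOn φ DD) {M : ℝ}
    (hM : ∀ z ∈ DD, ‖φ z‖ ≤ M) {η δ : ℝ} (hη : 0 < η) (hδ : 0 < δ) (hδ1 : δ < 1)
    (h : 4 * π ^ 2 * M ^ 2 < η ^ 2 * (-log δ)) (z : ℂ) :
    ∃ r : ℝ, δ < r ∧ r < √δ ∧ ∀ z1 ∈ DD, ∀ z2 ∈ DD, dist z1 z = r → dist z2 z = r → ‖φ z1 - φ z2‖ ≤ η := by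
  have hpi := pi_pos
  obtain ⟨u, hu, huz⟩ : ∃ u : ℂ, ‖u‖ = 1 ∧ u * (-‖z‖) = z := by
    by_cases hz : z = 0
    · exact ⟨1, by simp, by simp [hz]⟩
    · have : (‖z‖:ℂ) ≠ 0 := by simpa using hz
      exact ⟨-z / ‖z‖, by simp [hz], by field_simp⟩
  have hu0 : u ≠ 0 := by rintro rfl; simp at hu
  have huD : ∀ w, u * w ∈ DD ↔ w ∈ DD := by intro w; simp [hu]
  obtain ⟨s, hs1, hs2, hs⟩ := length_area0 (φ := fun w => φ (u * w))
    (hφ.comp (by fun_prop) fun w hw => (huD w).2 hw)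
    (fun x hx y hy hxy => by simpa [hu0] using hi ((huD x).2 hx) ((huD y).2 hy) hxy)
    (fun w hw => hM _ ((huD w).2 hw)) hη hδ hδ1 h (norm_nonneg z)
  have hr1 : δ < Real.exp s := by rwa [← Real.log_lt_iff_lt_exp hδ]
  have hr2 : Real.exp s < √δ := by
    rw [← Real.lt_log_iff_exp_lt (by positivity), Real.log_sqrt hδ.le]; exact hs2
  refine ⟨Real.exp s, hr1, hr2, ?_⟩
  set p : ℝ → ℂ := fun θ => u * (-‖z‖ + exp (s + θ * 𝕚)) with hp
  have hpc : Continuous p := by fun_prop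
  have hopen : ∀ a b : ℝ, a ∈ Ioo (-π) π → b ∈ Ioo (-π) π → p a ∈ DD → p b ∈ DD →
      ‖φ (p a) - φ (p b)‖ ≤ η := by
    intro a b ha hb haD hbD
    rw [huD] at haD hbD
    rcases le_total a b with hab | hab
    · have := hs a b ha.1 hab hb.2 haD hbD
      rw [norm_sub_rev]; exact this.le
    · exact (hs b a hb.1 hab ha.2 hbD haD).le
  have hrep : ∀ w, dist w z = Real.exp s → ∃ θ ∈ Ioc (-π) π, p θ = w := by
    intro w hw
    refine ⟨((w - z) / u).arg, Complex.arg_mem_Ioc _, ?_⟩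
    have h1 : ‖(w - z) / u‖ = Real.exp s := by rw [norm_div, hu, div_one, ← dist_eq_norm, hw]
    have h2 : exp (s + ((w - z) / u).arg * 𝕚) = (w - z) / u := by
      rw [exp_add, ← ofReal_exp, ← h1, Complex.norm_mul_exp_arg_mul_I]
    simp only [hp, h2, mul_add, huz]; field_simp; ring
  have happ : ∀ θ ∈ Ioc (-π) π, (𝓝[Ioo (-π) π] θ).NeBot := by
    intro θ hθ
    rw [← mem_closure_iff_nhdsWithin_neBot, closure_Ioo (by linarith)]
    exact Ioc_subset_Icc_self hθ
  have hcl : ∀ θ, p θ ∈ DD → Tendsto (fun t => φ (p t)) (𝓝[Ioo (-π) π] θ) (𝓝 (φ (p θ))) := by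
    intro θ hθ
    exact (((hφ.continuousOn.continuousAt (isOpen_ball.mem_nhds hθ)).comp hpc.continuousAt).tendsto).mono_left nhdsWithin_le_nhds
  have hev : ∀ θ, p θ ∈ DD → ∀ᶠ t in 𝓝[Ioo (-π) π] θ, t ∈ Ioo (-π) π ∧ p t ∈ DD := by
    intro θ hθ
    exact (eventually_mem_nhdsWithin).and (((hpc.continuousAt.eventually (isOpen_ball.mem_nhds hθ))).filter_mono nhdsWithin_le_nhds)
  intro z1 hz1 z2 hz2 h1 h2
  obtain ⟨a, ha, rfl⟩ := hrep z1 h1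
  obtain ⟨b, hb, rfl⟩ := hrep z2 h2
  have := happ a ha
  have := happ b hb
  refine le_of_tendsto (((hcl a hz1)).sub_const _).norm ?_
  filter_upwards [hev a hz1] with t ht
  refine le_of_tendsto (((hcl b hz2)).const_sub _).norm ?_
  filter_upwards [hev b hz2] with t' ht'
  exact hopen t t' ht.1 ht'.1 ht.2 ht'.2

lemma conn_compl_ball {x0 : ℂ} {τ : ℝ} (hτ : 0 < τ) (h : τ < 1 - ‖x0‖) : IsPreconnected (DD \ closedBall x0 τ) := by
  apply isPreconnected_of_forall_pair
  intro y hy y' hy'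
  have key : ∀ y ∈ DD \ closedBall x0 τ, ∃ b > τ, ∀ τ' > τ, τ' < b → τ' < 1 - ‖x0‖ →
      ∃ t ⊆ DD \ closedBall x0 τ, IsPreconnected t ∧ y ∈ t ∧ sphere x0 τ' ⊆ t := by
    intro y hy
    have hd : τ < ‖y - x0‖ := by simpa [dist_eq_norm] using hy.2
    refine ⟨‖y - x0‖, hd, fun τ' h1 h2 h3 => ?_⟩
    have hd0 : 0 < ‖y - x0‖ := hτ.trans hd
    have hsp : sphere x0 τ' ⊆ DD \ closedBall x0 τ := by
      intro w hw
      rw [mem_sphere, dist_eq_norm] at hw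
      refine ⟨?_, by simp [dist_eq_norm]; linarith⟩
      rw [mem_ball_zero_iff]
      calc ‖w‖ = ‖(w - x0) + x0‖ := by simp
        _ ≤ _ := norm_add_le _ _
        _ < 1 := by linarith
    set q : ℝ → ℂ := fun l => x0 + l * (y - x0)
    have hqn : ∀ l ≥ 0, ‖q l - x0‖ = l * ‖y - x0‖ := by
      intro l hl; simp [q, abs_of_nonneg hl]
    set l0 := τ' / ‖y - x0‖
    have hl0 : 0 < l0 := div_pos (by linarith) hd0
    have hl1 : l0 ≤ 1 := (div_le_one hd0).2 h2.le
    have hq0 : q l0 ∈ sphere x0 τ' := by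
      rw [mem_sphere, dist_eq_norm, hqn _ hl0.le]; simp only [l0]; field_simp
    refine ⟨sphere x0 τ' ∪ q '' Icc l0 1, ?_, ?_, ?_, subset_union_left⟩
    · apply union_subset hsp
      rintro _ ⟨l, hl, rfl⟩
      constructor
      · have hx0 : x0 ∈ DD := by simp; linarith
        have := (convex_ball (0:ℂ) 1) hx0 hy.1 (a := 1 - l) (b := l) (by linarith [hl.2]) (by linarith [hl.1]) (by ring)
        convert this using 1
        simp [q]; ring
      · simp only [mem_closedBall, dist_eq_norm, hqn l (by linarith [hl.1]), not_le]
        have := hl.1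
        rw [div_le_iff₀ hd0] at this
        linarith
    · have hq1 : q l0 ∈ q '' Icc l0 1 := ⟨l0, ⟨le_rfl, hl1⟩, rfl⟩
      apply IsPreconnected.union (q l0) hq0 hq1
      · exact isPreconnected_sphere (by simp [Complex.rank_real_complex]) _ _
      · exact isPreconnected_Icc.image _ (by fun_prop)
    · right; exact ⟨1, ⟨hl1, le_rfl⟩, by simp [q]⟩
  obtain ⟨b, hb, H⟩ := key y hy
  obtain ⟨b', hb', H'⟩ := key y' hy'
  obtain ⟨τ', h1, h2⟩ := exists_between (lt_min (lt_min hb hb') h)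
  simp only [lt_min_iff] at h2
  obtain ⟨t, ht, htp, hyt, hst⟩ := H τ' h1 h2.1.1 h2.2
  obtain ⟨t', ht', htp', hyt', hst'⟩ := H' τ' h1 h2.1.2 h2.2
  have hne : x0 + τ' ∈ sphere x0 τ' := by simp; linarith
  exact ⟨t ∪ t', union_subset ht ht', Or.inl hyt, Or.inr hyt', htp.union _ (hst hne) (hst' hne) htp'⟩
lemma conn_nbhd {x0 : ℂ} (hx0 : x0 ∈ DD) {τ : ℝ} (hτ : 0 < τ) (hτ1 : τ < 1) :
    ∃ B : Set ℂ, closedBall x0 τ ∩ DD ⊆ B ∧ IsPreconnected (DD \ B) ∧ ∀ x ∈ B ∩ DD, ‖x - x0‖ ≤ 4 * √τ := by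
  rcases le_or_gt (1 - ‖x0‖) τ with h | h
  · have hx0n : ‖x0‖ < 1 := by simpa using hx0
    have hp : 0 < ‖x0‖ := by linarith
    refine ⟨{x | ‖x0‖ * (1 - 2 * τ) ≤ (x * conj x0).re}, ?_, ?_, ?_⟩
    · rintro x ⟨hx, -⟩
      rw [mem_closedBall, dist_eq_norm] at hx
      simp only [mem_ofPred_eq]
      have e : x * conj x0 = (x - x0) * conj x0 + x0 * conj x0 := by ring
      have e2 : x0 * conj x0 = ((‖x0‖^2 : ℝ) : ℂ) := by rw [mul_conj, normSq_eq_norm_sq]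
      rw [e, e2, add_re, ofReal_re]
      have h3 : |((x - x0) * conj x0).re| ≤ τ * ‖x0‖ := by
        refine (abs_re_le_norm _).trans ?_
        rw [norm_mul, Complex.norm_conj]; gcongr
      have := (abs_le.1 h3).1
      nlinarith
    · apply Convex.isPreconnected
      have : DD \ {x | ‖x0‖ * (1 - 2 * τ) ≤ (x * conj x0).re} = DD ∩ {x | (x * conj x0).re < ‖x0‖ * (1 - 2 * τ)} := by
        ext x; simp
      rw [this]
      refine (convex_ball _ _).inter (convex_halfSpace_lt (f := fun x : ℂ => (x * conj x0).re) ⟨?_, ?_⟩ _)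
      · intro x y; simp; ring
      · intro c x; simp; ring
    · rintro x ⟨hx, hxD⟩
      have hx1 : ‖x‖ < 1 := by simpa using hxD
      simp only [mem_ofPred_eq] at hx
      apply le_of_sq_le_sq _ (by positivity)
      rw [mul_pow, Real.sq_sqrt hτ.le, ← normSq_eq_norm_sq, Complex.normSq_sub, normSq_eq_norm_sq, normSq_eq_norm_sq]
      nlinarith [norm_nonneg x]
  · refine ⟨closedBall x0 τ, inter_subset_left, conn_compl_ball hτ h, ?_⟩
    rintro x ⟨hx, -⟩
    rw [mem_closedBall, dist_eq_norm] at hx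
    have : τ ≤ √τ := by
      rw [Real.le_sqrt hτ.le hτ.le]; nlinarith
    have := Real.sqrt_nonneg τ
    linarith
structure KD (M d0 τ η : ℝ) (φ k h : ℂ → ℂ) : Prop where
  holo : DifferentiableOn ℂ φ DD
  inj : InjOn φ DD
  bd : ∀ z ∈ DD, ‖φ z‖ ≤ M
  kD : MapsTo k DD DD
  hD : MapsTo h DD DD
  kc : ContinuousOn k DD
  hc : ContinuousOn h DD
  kh : ∀ x ∈ DD, k (h x) = x
  hk : ∀ z ∈ DD, h (k z) = z
  h0 : h 0 = 0
  low : ∀ z ∈ DD, 1/2 ≤ ‖z‖ → d0 ≤ ‖k z‖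
  mod : ∀ z1 ∈ DD, ∀ z2 ∈ DD, ‖φ z1 - φ z2‖ ≤ η → ‖k z1 - k z2‖ ≤ τ
lemma equi_k (M : ℝ) {d0 : ℝ} (hd0 : 0 < d0) {ε : ℝ} (hε : 0 < ε) :
    ∃ τ > 0, ∀ η > 0, ∃ δ > 0, ∀ φ k h : ℂ → ℂ, KD M d0 τ η φ k h → ∀ z1 ∈ DD, ∀ z2 ∈ DD, ‖z1 - z2‖ ≤ δ → ‖k z1 - k z2‖ ≤ ε := by
  obtain ⟨τ, hτ, hτ1, hτd, hτε⟩ : ∃ τ > 0, τ < 1 ∧ 4 * √τ < d0 ∧ 8 * √τ ≤ ε := by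
    set a := min (1/2) (min (d0/8) (ε/8))
    have ha : 0 < a := by positivity
    refine ⟨a^2, by positivity, ?_, ?_, ?_⟩
    · have : a ≤ 1/2 := min_le_left _ _
      nlinarith
    · rw [Real.sqrt_sq ha.le]
      have : a ≤ d0/8 := (min_le_right _ _).trans (min_le_left _ _)
      linarith
    · rw [Real.sqrt_sq ha.le]
      have : a ≤ ε/8 := (min_le_right _ _).trans (min_le_right _ _)
      linarith
  have hττ : τ ≤ ε := by
    have : τ ≤ √τ := by rw [Real.le_sqrt hτ.le hτ.le]; nlinarith
    linarith [Real.sqrt_nonneg τ]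
  refine ⟨τ, hτ, fun m hm => ?_⟩
  set η := m / 2
  have hη : 0 < η := half_pos hm
  obtain ⟨δ, hδ, hδ1, hδ2, hδl⟩ : ∃ δ > 0, δ < 1 ∧ √δ < 1/4 ∧ 4 * π ^ 2 * M ^ 2 < η ^ 2 * (-log δ) := by
    set A := 4 * π ^ 2 * M ^ 2 / η^2 + 4
    have hA : 4 ≤ A := by
      have : 0 ≤ 4 * π ^ 2 * M ^ 2 / η^2 := by positivity
      linarith
    refine ⟨Real.exp (-A), exp_pos _, by rw [Real.exp_lt_one_iff]; linarith, ?_, ?_⟩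
    · rw [Real.sqrt_lt' (by norm_num), exp_neg, inv_lt_comm₀ (exp_pos _) (by norm_num)]
      have h1 : Real.exp 4 ≤ Real.exp A := exp_le_exp.2 hA
      have h2 : Real.exp 4 = Real.exp 1 ^ 4 := by rw [← Real.exp_nat_mul]; norm_num
      have h3 : (2.7:ℝ) < Real.exp 1 := by have := Real.exp_one_gt_d9; linarith
      have h4 : (2.7:ℝ)^4 < Real.exp 1 ^ 4 := by gcongr
      norm_num at h4 ⊢; linarith
    · rw [Real.log_exp]
      simp only [A, neg_neg, mul_add]
      rw [mul_div_cancel₀ _ (by positivity)]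
      nlinarith [sq_pos_of_pos hη]
  refine ⟨δ, hδ, fun φ k h H z hz z2 hz2 hdist => ?_⟩
  obtain ⟨r, hr1, hr2, hr⟩ := length_area H.holo H.inj H.bd hη hδ hδ1 hδl z
  have hz2r : ‖z2 - z‖ < r := by rw [norm_sub_rev]; linarith
  have hr0 : 0 < r := hδ.trans hr1
  have hz1 : ‖z‖ < 1 := by simpa using hz
  rcases lt_or_ge ‖z‖ (3/4) with hc | hc
  · have hsub : closedBall z r ⊆ DD := by
      intro w hw
      rw [mem_closedBall, dist_eq_norm] at hw
      rw [mem_ball_zero_iff]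
      calc ‖w‖ = ‖(w - z) + z‖ := by simp
        _ ≤ _ := norm_add_le _ _
        _ < 1 := by linarith
    have hw' : z + r ∈ closedBall z r := by simp [abs_of_pos hr0]
    have hmax : ∀ w ∈ closedBall z r, ‖φ w - φ (z + r)‖ ≤ η := by
      intro w hw
      rw [← closure_ball z hr0.ne'] at hw
      refine norm_le_of_forall_mem_frontier_norm_le (f := fun w => φ w - φ (z + r)) isBounded_ball ?_ ?_ hw
      · apply DifferentiableOn.diffContOnCl
        rw [closure_ball z hr0.ne']
        exact (H.holo.mono hsub).sub_const _
      · intro x hx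
        rw [frontier_ball z hr0.ne', mem_sphere] at hx
        refine hr x (hsub (by rw [mem_closedBall]; exact hx.le)) _ (hsub hw') hx ?_
        simp [abs_of_pos hr0]
    refine le_trans (H.mod z hz z2 hz2 ?_) hττ
    have h1 := hmax z (mem_closedBall_self hr0.le)
    have h2 := hmax z2 (by rw [mem_closedBall, dist_eq_norm]; exact hz2r.le)
    calc ‖φ z - φ z2‖ = ‖(φ z - φ (z+r)) - (φ z2 - φ (z + r))‖ := by congr 1; ring
      _ ≤ _ := norm_sub_le _ _
      _ ≤ m := by simp only [η] at h1 h2; linarith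
  · have hzp : 0 < ‖z‖ := by linarith
    obtain ⟨c0, hc0D, hc0⟩ : ∃ c0 ∈ DD, dist c0 z = r := by
      have hz0 : (‖z‖:ℂ) ≠ 0 := by exact_mod_cast hzp.ne'
      refine ⟨z - r * (z / ‖z‖), ?_, ?_⟩
      · have e : z - r * (z / ‖z‖) = ((‖z‖ - r : ℝ) : ℂ) * (z / ‖z‖) := by
          push_cast; field_simp
        rw [mem_ball_zero_iff, e, norm_mul, norm_div, norm_real, norm_real, Real.norm_eq_abs, Real.norm_eq_abs,
          abs_of_pos hzp, div_self hzp.ne', abs_of_pos (by linarith)]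
        linarith
      · rw [dist_eq_norm]; simp [abs_of_pos hr0, hzp.ne']
    have far : ∀ w, dist w z = r → 1/2 ≤ ‖w‖ := by
      intro w hw
      rw [dist_eq_norm] at hw
      have := norm_sub_norm_le z w
      rw [norm_sub_rev] at this
      linarith
    have hx0 := H.low c0 hc0D (far c0 hc0)
    obtain ⟨B, hB1, hB2, hB3⟩ := conn_nbhd (H.kD hc0D) hτ hτ1
    have h0B : (0:ℂ) ∈ DD \ B := by
      refine ⟨by simp, fun h0 => ?_⟩
      have := hB3 0 ⟨h0, by simp⟩
      rw [zero_sub, norm_neg] at this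
      linarith
    have hT : IsPreconnected (h '' (DD \ B)) := hB2.image _ (H.hc.mono sdiff_subset)
    have hT2 : IsPreconnected ((fun w => dist w z) '' (h '' (DD \ B))) := hT.image _ (by fun_prop)
    have hmain : ∀ w ∈ DD, ‖w - z‖ < r → k w ∈ B := by
      intro w hw hwr
      by_contra hkB
      have h1 : dist w z ∈ (fun w => dist w z) '' (h '' (DD \ B)) :=
        ⟨w, ⟨k w, ⟨H.kD hw, hkB⟩, H.hk w hw⟩, rfl⟩
      have h2 : dist 0 z ∈ (fun w => dist w z) '' (h '' (DD \ B)) := ⟨0, ⟨0, h0B, H.h0⟩, rfl⟩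
      have h3 : r ∈ _ := hT2.Icc_subset h1 h2 ⟨by rw [dist_eq_norm]; exact hwr.le, by simp; linarith⟩
      obtain ⟨_, ⟨x, hx, rfl⟩, hxr⟩ := h3
      apply hx.2
      apply hB1
      refine ⟨?_, hx.1⟩
      rw [mem_closedBall, dist_eq_norm]
      have := H.mod _ (H.hD hx.1) _ hc0D ((hr _ (H.hD hx.1) _ hc0D hxr hc0).trans (by simp only [η]; linarith))
      rwa [H.kh x hx.1] at this
    have h1 := hB3 _ ⟨hmain z hz (by simpa using hr0), H.kD hz⟩
    have h2 := hB3 _ ⟨hmain z2 hz2 hz2r, H.kD hz2⟩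
    calc ‖k z - k z2‖ = ‖(k z - k c0) - (k z2 - k c0)‖ := by congr 1; ring
      _ ≤ _ := norm_sub_le _ _
      _ ≤ ε := by linarith

structure PU (J k h : ℂ → ℂ) : Prop where
  holo : DifferentiableOn ℂ (J ∘ k) DD
  kD : MapsTo k DD DD
  hD : MapsTo h DD DD
  kc : ContinuousOn k DD
  hc : ContinuousOn h DD
  kh : ∀ x ∈ DD, k (h x) = x
  hk : ∀ z ∈ DD, h (k z) = z
  h0 : h 0 = 0
  pos : ∃ c : ℝ, 0 < c ∧ deriv (J ∘ k) 0 = c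
lemma zero_DD : (0:ℂ) ∈ DD := by simp
lemma PU.k0 {J k h : ℂ → ℂ} (H : PU J k h) : k 0 = 0 := by
  have := H.kh 0 zero_DD; rwa [H.h0] at this
lemma PU.inj {J k h : ℂ → ℂ} (H : PU J k h) (hJ : Adm J) : InjOn (J ∘ k) DD := by
  intro x hx y hy hxy
  have := hJ.inj (DD_sub (H.kD hx)) (DD_sub (H.kD hy)) hxy
  rw [← H.hk x hx, this, H.hk y hy]
lemma PU.exists (hJ : Adm J) : ∃ k h, PU J k h := by
  obtain ⟨g, hg, hgi, hgs, hg0⟩ := riemann hJ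
  set ψ := invFunOn g (J '' DD)
  have hgD : MapsTo g (J '' DD) DD := by rw [mapsTo_iff_image_subset, hgs]
  have hψm : MapsTo ψ DD (J '' DD) := fun z hz => invFunOn_mem (by rw [← hgs] at hz; exact hz)
  have hgψ : ∀ z ∈ DD, g (ψ z) = z := fun z hz => invFunOn_eq (by rw [← hgs] at hz; exact hz)
  have hψg : ∀ y ∈ J '' DD, ψ (g y) = y := fun y hy => hgi (hψm (hgD hy)) hy (hgψ _ (hgD hy))
  have hψ : DifferentiableOn ℂ ψ DD := inj_inv_holo hJ.isOpen hg hgi isOpen_ball hψm hgψ differentiableOn_id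
  have hψi : InjOn ψ DD := fun x hx y hy h => by rw [← hgψ x hx, h, hgψ y hy]
  have ha := inj_deriv_ne isOpen_ball hψ hψi zero_DD
  set a := deriv ψ 0
  have han : 0 < ‖a‖ := norm_pos_iff.2 ha
  have hna : (‖a‖:ℂ) ≠ 0 := by exact_mod_cast han.ne'
  set u : ℂ := conj a / ‖a‖
  have hu : ‖u‖ = 1 := by simp [u, ha]
  have hu0 : u ≠ 0 := by intro h; simp [h] at hu
  have huD : ∀ w, u * w ∈ DD ↔ w ∈ DD := by intro w; simp [hu]
  have huD' : ∀ w, u⁻¹ * w ∈ DD ↔ w ∈ DD := by intro w; simp [hu]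
  have hkm : ∀ z ∈ DD, Ji J (ψ (u * z)) ∈ DD ∧ J (Ji J (ψ (u * z))) = ψ (u * z) := by
    intro z hz
    obtain ⟨x, hx, hxe⟩ := hψm ((huD z).2 hz)
    rw [← hxe, hJ.Ji_left (DD_sub hx)]; exact ⟨hx, rfl⟩
  have heq : ∀ z ∈ DD, (J ∘ fun z => Ji J (ψ (u * z))) z = ψ (u * z) := fun z hz => (hkm z hz).2
  have hlin : DifferentiableOn ℂ (fun z => ψ (u * z)) DD := hψ.comp (by fun_prop) fun z hz => (huD z).2 hz
  refine ⟨fun z => Ji J (ψ (u * z)), fun x => u⁻¹ * g (J x), ?_, ?_, ?_, ?_, ?_, ?_, ?_, ?_, ?_⟩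
  · exact hlin.congr heq
  · exact fun z hz => (hkm z hz).1
  · exact fun x hx => (huD' _).2 (hgD ⟨x, hx, rfl⟩)
  · exact hJ.Ji_cont.comp hlin.continuousOn fun z hz => image_mono DD_sub (hψm ((huD z).2 hz))
  · exact continuousOn_const.mul (hg.continuousOn.comp (hJ.cont.mono DD_sub) (mapsTo_image _ _))
  · intro x hx
    simp only [mul_inv_cancel_left₀ hu0]
    rw [hψg _ ⟨x, hx, rfl⟩, hJ.Ji_left (DD_sub hx)]
  · intro z hz
    simp only [(hkm z hz).2]
    rw [hgψ _ ((huD z).2 hz), inv_mul_cancel_left₀ hu0]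
  · simp [hg0]
  · refine ⟨‖a‖, han, ?_⟩
    have e : (J ∘ fun z => Ji J (ψ (u * z))) =ᶠ[𝓝 0] fun z => ψ (u * z) := by
      filter_upwards [isOpen_ball.mem_nhds zero_DD] with z hz using heq z hz
    rw [e.deriv_eq]
    have h1 : HasDerivAt (fun z : ℂ => u * z) u 0 := by simpa using (hasDerivAt_id (0:ℂ)).const_mul u
    have h2 : HasDerivAt ψ a (u * 0) := by
      rw [mul_zero]; exact (hψ.differentiableAt (isOpen_ball.mem_nhds zero_DD)).hasDerivAt
    have h3 : HasDerivAt (fun z => ψ (u * z)) (a * u) 0 := h2.comp 0 h1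
    rw [h3.deriv]
    simp only [u]
    rw [mul_div_assoc', mul_conj, normSq_eq_norm_sq]
    field_simp; push_cast; ring
lemma Adm.modulus (hJ : Adm J) {τ : ℝ} (hτ : 0 < τ) : ∃ η > 0, ∀ x ∈ cD, ∀ y ∈ cD,
    ‖J x - J y‖ ≤ η → ‖x - y‖ ≤ τ := by
  have hK : IsCompact (J '' cD) := (isCompact_closedBall (0:ℂ) 1).image_of_continuousOn hJ.cont
  have := hK.uniformContinuousOn_of_continuous hJ.Ji_cont
  rw [uniformContinuousOn_iff] at this
  obtain ⟨δ, hδ, h⟩ := this τ hτ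
  refine ⟨δ/2, by positivity, fun x hx y hy hxy => ?_⟩
  have := h (J x) ⟨x, hx, rfl⟩ (J y) ⟨y, hy, rfl⟩ (by rw [dist_eq_norm]; linarith)
  rw [hJ.Ji_left hx, hJ.Ji_left hy, dist_eq_norm] at this
  exact this.le
lemma cD_split {x : ℂ} (hx : x ∈ cD) : x ∈ DD ∨ ‖x‖ = 1 := by
  rw [mem_closedBall_zero_iff] at hx
  rcases hx.lt_or_eq with h | h
  · left; simpa using h
  · right; exact h
lemma Adm.inradius (hJ : Adm J) {d : ℝ} (hd : ∀ x, ‖x‖ = 1 → d ≤ ‖J x - J 0‖) :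
    ball (J 0) d ⊆ J '' DD := by
  rcases le_or_gt d 0 with h0 | h0
  · rw [ball_eq_empty.2 h0]; exact empty_subset _
  have hK : IsClosed (J '' cD) := ((isCompact_closedBall (0:ℂ) 1).image_of_continuousOn hJ.cont).isClosed
  refine (convex_ball (J 0) d).isPreconnected.subset_left_of_subset_union hJ.isOpen hK.isOpen_compl ?_ ?_ ⟨J 0, mem_ball_self h0, 0, zero_DD, rfl⟩
  · exact disjoint_compl_right.mono_left (image_mono DD_sub)
  · intro y hy
    by_cases h : y ∈ J '' cD
    · left
      obtain ⟨x, hx, rfl⟩ := h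
      rcases cD_split hx with hx | hx
      · exact ⟨x, hx, rfl⟩
      · have := hd x hx
        rw [mem_ball, dist_eq_norm] at hy
        linarith
    · right; exact h
lemma Adm.equi (hJ : Adm J) {ε : ℝ} (hε : 0 < ε) : ∃ δ > 0, ∃ δ0 > 0, ∀ J' : ℂ → ℂ, Adm J' →
    (∀ x ∈ cD, ‖J' x - J x‖ ≤ δ0) → ∀ k h, PU J' k h → ∀ z1 ∈ DD, ∀ z2 ∈ DD, ‖z1 - z2‖ ≤ δ → ‖k z1 - k z2‖ ≤ ε := by
  obtain ⟨M, hM⟩ := ((isCompact_closedBall (0:ℂ) 1).image_of_continuousOn hJ.cont).isBounded.exists_norm_le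
  have h0c : (0:ℂ) ∈ cD := by simp
  obtain ⟨d, hd, hdJ⟩ : ∃ d > 0, ∀ x, ‖x‖ = 1 → 4 * d ≤ ‖J x - J 0‖ := by
    obtain ⟨η, hη, h⟩ := hJ.modulus (τ := 1/2) (by norm_num)
    refine ⟨η/4, by positivity, fun x hx => ?_⟩
    by_contra hc
    have := h x (by simp [hx]) 0 h0c (by linarith)
    rw [sub_zero, hx] at this; norm_num at this
  obtain ⟨d0, hd0, hd0J⟩ : ∃ d0 > 0, ∀ x ∈ cD, ‖x‖ < d0 → ‖J x - J 0‖ < d/2 := by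
    have := Metric.continuousOn_iff.1 hJ.cont 0 h0c (d/2) (by positivity)
    obtain ⟨d0, h1, h2⟩ := this
    exact ⟨d0, h1, fun x hx hx' => by simpa [dist_eq_norm] using h2 x hx (by simpa using hx')⟩
  obtain ⟨τ, hτ, H⟩ := equi_k (M + 1) hd0 hε
  obtain ⟨η, hη, hηJ⟩ := hJ.modulus hτ
  obtain ⟨δ, hδ, H⟩ := H (η/2) (by positivity)
  refine ⟨δ, hδ, min 1 (min (d/4) (η/4)), by positivity, fun J' hJ' hc k h hP => H (J' ∘ k) k h ?_⟩
  have hc1 : ∀ x ∈ cD, ‖J' x - J x‖ ≤ 1 := fun x hx => (hc x hx).trans (min_le_left _ _)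
  have hc2 : ∀ x ∈ cD, ‖J' x - J x‖ ≤ d/4 := fun x hx => (hc x hx).trans ((min_le_right _ _).trans (min_le_left _ _))
  have hc3 : ∀ x ∈ cD, ‖J' x - J x‖ ≤ η/4 := fun x hx => (hc x hx).trans ((min_le_right _ _).trans (min_le_right _ _))
  have tri : ∀ x ∈ cD, ∀ y ∈ cD, ∀ e, (∀ x ∈ cD, ‖J' x - J x‖ ≤ e) → |‖J x - J y‖ - ‖J' x - J' y‖| ≤ 2 * e := by
    intro x hx y hy e he
    refine (abs_norm_sub_norm_le _ _).trans ?_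
    calc _ = ‖(J' y - J y) - (J' x - J x)‖ := by congr 1; ring
      _ ≤ _ := norm_sub_le _ _
      _ ≤ _ := by linarith [he x hx, he y hy]
  refine ⟨hP.holo, hP.inj hJ', ?_, hP.kD, hP.hD, hP.kc, hP.hc, hP.kh, hP.hk, hP.h0, ?_, ?_⟩
  · intro z hz
    have hz' := DD_sub (hP.kD hz)
    calc ‖J' (k z)‖ = ‖(J' (k z) - J (k z)) + J (k z)‖ := by congr 1; ring
      _ ≤ _ := norm_add_le _ _
      _ ≤ M + 1 := by linarith [hc1 _ hz', hM _ ⟨_, hz', rfl⟩]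
  · intro z hz hz2
    have hzc := DD_sub (hP.kD hz)
    by_contra hcon
    push Not at hcon
    have h1 := hd0J _ hzc hcon
    have h2 := abs_le.1 (tri _ hzc 0 h0c _ hc2)
    have h3 : ‖J' (k z) - J' 0‖ < d := by linarith [h2.1]
    have hin : ball (J' 0) (2 * d) ⊆ J' '' DD := by
      apply hJ'.inradius
      intro x hx
      have h5 := abs_le.1 (tri x (by simp [hx]) 0 h0c _ hc2)
      linarith [hdJ x hx, h5.2]
    set g : ℂ → ℂ := fun y => h (Ji J' y)
    have hgm : MapsTo g (J' '' DD) DD := by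
      rintro _ ⟨x, hx, rfl⟩
      simp only [g, hJ'.Ji_left (DD_sub hx)]; exact hP.hD hx
    have hg : DifferentiableOn ℂ g (J' '' DD) := by
      refine inj_inv_holo (p := id) isOpen_ball hP.holo (hP.inj hJ') hJ'.isOpen hgm ?_ differentiableOn_id
      rintro _ ⟨x, hx, rfl⟩
      simp [g, hJ'.Ji_left (DD_sub hx), hP.kh x hx]
    have hg0 : g (J' 0) = 0 := by simp [g, hJ'.Ji_left h0c, hP.h0]
    have hS := Complex.dist_le_div_mul_dist_of_mapsTo_ball (f := g) (c := J' 0) (R₁ := 2 * d) (R₂ := 1) (z := J' (k z))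
      (hg.mono hin) (by rw [hg0]; exact (hgm.mono_left hin).mono_right DD_sub) (by rw [mem_ball, dist_eq_norm]; linarith)
    rw [hg0, dist_zero_right, dist_eq_norm] at hS
    have : g (J' (k z)) = z := by simp [g, hJ'.Ji_left hzc, hP.hk z hz]
    rw [this] at hS
    have : 1 / (2 * d) * ‖J' (k z) - J' 0‖ < 1/2 := by
      rw [div_mul_eq_mul_div, one_mul, div_lt_iff₀ (by positivity)]; linarith
    linarith
  · intro z1 h1 z2 h2 h12
    have h1' := DD_sub (hP.kD h1)
    have h2' := DD_sub (hP.kD h2)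
    apply hηJ _ h1' _ h2'
    have h5 := abs_le.1 (tri _ h1' _ h2' _ hc3)
    simp only [Function.comp] at h12
    linarith [h5.2]

structure Unif (J k h : ℂ → ℂ) : Prop extends PU J k h where
  kcc : ContinuousOn k cD
  hcc : ContinuousOn h cD
  km : MapsTo k cD cD
  hm : MapsTo h cD cD
  khc : ∀ x ∈ cD, k (h x) = x
  hkc : ∀ z ∈ cD, h (k z) = z
lemma closure_DD : closure DD = cD := closure_ball _ one_ne_zero
lemma cD_nebot {x : ℂ} (hx : x ∈ cD) : (𝓝[DD] x).NeBot := by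
  rw [← mem_closure_iff_nhdsWithin_neBot, closure_DD]; exact hx
lemma const_of_arc {f : ℂ → ℂ} (hf : DifferentiableOn ℂ f DD) (hc : ContinuousOn f cD) {y0 u : ℂ} (hu : ‖u‖ = 1)
    {N : Set ℂ} (hN : IsOpen N) (huN : u ∈ N) (h : ∀ z ∈ N, ‖z‖ = 1 → f z = y0) : f 0 = y0 := by
  have hcomp : IsCompact (sphere (0:ℂ) 1) := isCompact_sphere 0 1
  obtain ⟨t, ht⟩ := hcomp.elim_finite_subcover (fun v : sphere (0:ℂ) 1 => (fun z => v.1 * z) ⁻¹' N)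
    (fun v => hN.preimage (by fun_prop)) (by
      intro z hz
      have hz1 : ‖z‖ = 1 := by simpa using hz
      have hz0 : z ≠ 0 := by rintro rfl; simp at hz1
      rw [mem_iUnion]
      exact ⟨⟨u / z, by simp [hu, hz1]⟩, by simp [hz0, huN]⟩)
  have hrot : ∀ v : sphere (0:ℂ) 1, ‖v.1‖ = 1 := fun v => by simpa using v.2
  have hQ : ‖∏ v ∈ t, (f (v.1 * 0) - y0)‖ ≤ 0 := by
    refine norm_le_of_forall_mem_frontier_norm_le (f := fun z => ∏ v ∈ t, (f (v.1 * z) - y0)) (U := DD) isBounded_ball ?_ ?_ (subset_closure zero_DD)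
    · constructor
      · apply DifferentiableOn.fun_finsetProd
        intro v _
        refine DifferentiableOn.sub_const ?_ _
        exact hf.comp (by fun_prop) fun z hz => by simpa [hrot v] using hz
      · rw [closure_DD]
        apply continuousOn_finsetProd
        intro v _
        refine ContinuousOn.sub ?_ continuousOn_const
        exact hc.comp (by fun_prop) fun z hz => by simpa [hrot v] using hz
    · intro z hz
      rw [frontier_ball _ one_ne_zero] at hz
      have hz1 : ‖z‖ = 1 := by simpa using hz
      have := ht hz
      simp only [mem_iUnion] at this
      obtain ⟨v, hv, hvz⟩ := this
      rw [Finset.prod_eq_zero hv]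
      · simp
      · rw [h _ hvz (by simp [hrot v, hz1]), sub_self]
  rw [norm_le_zero_iff, Finset.prod_eq_zero_iff] at hQ
  obtain ⟨v, -, hv⟩ := hQ
  simpa using sub_eq_zero.1 hv
def sideL (ξ1 ξ2 w : ℂ) : ℝ := ((w - ξ1) * conj (ξ2 - ξ1)).im
lemma sideL_circle {ξ1 ξ2 w : ℂ} (h1 : ‖ξ1‖ = 1) (h2 : ‖ξ2‖ = 1) (h12 : ξ1 ≠ ξ2) (hw : ‖w‖ = 1) (h : sideL ξ1 ξ2 w = 0) :
    w = ξ1 ∨ w = ξ2 := by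
  have hn : ∀ x : ℂ, ‖x‖ = 1 → x.re * x.re + x.im * x.im = 1 := by
    intro x hx; rw [← normSq_apply, normSq_eq_norm_sq, hx]; norm_num
  have d0 : ξ2 - ξ1 ≠ 0 := sub_ne_zero.2 h12.symm
  have hS : 0 < normSq (ξ2 - ξ1) := Complex.normSq_pos.2 d0
  obtain ⟨t, ht⟩ : ∃ t : ℝ, w - ξ1 = t * (ξ2 - ξ1) := by
    refine ⟨((w - ξ1) * conj (ξ2 - ξ1)).re / normSq (ξ2 - ξ1), ?_⟩
    have e : (((w - ξ1) * conj (ξ2 - ξ1)).re : ℂ) = (w - ξ1) * conj (ξ2 - ξ1) := by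
      apply cxt <;> simp only [ofReal_re, ofReal_im]
      exact h.symm
    rw [Complex.ofReal_div, e, ← mul_conj]
    have : conj (ξ2 - ξ1) ≠ 0 := (map_ne_zero _).2 d0
    field_simp
  have hre := congrArg Complex.re ht
  have him := congrArg Complex.im ht
  simp at hre him
  have a1 := hn _ h1
  have a2 := hn _ h2
  have aw := hn _ hw
  have hS' : 0 < (ξ2.re - ξ1.re)^2 + (ξ2.im - ξ1.im)^2 := by
    rw [normSq_apply] at hS; simp at hS; nlinarith
  have e1 : w.re = ξ1.re + t * (ξ2.re - ξ1.re) := by linarith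
  have e2 : w.im = ξ1.im + t * (ξ2.im - ξ1.im) := by linarith
  rw [e1, e2] at aw
  have : t * (t - 1) * ((ξ2.re - ξ1.re)^2 + (ξ2.im - ξ1.im)^2) = 0 := by
    linear_combination aw - a1 - t * (a2 - a1)
  rcases mul_eq_zero.1 ((mul_eq_zero.1 this).resolve_right hS'.ne') with h | h
  · left; rw [h] at ht; simpa [sub_eq_zero] using ht
  · right; rw [sub_eq_zero.1 h] at ht; simpa using ht
lemma Unif.exists (hJ : Adm J) : ∃ k h, Unif J k h := by
  obtain ⟨k0, h0, H⟩ := PU.exists hJ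
  have hlim : ∀ x ∈ cD, ∃ y, Tendsto k0 (𝓝[DD] x) (𝓝 y) := by
    intro x hx
    have := cD_nebot hx
    have hC : Cauchy (map k0 (𝓝[DD] x)) := by
      rw [Metric.cauchy_iff]
      refine ⟨inferInstance, fun ε hε => ?_⟩
      obtain ⟨δ, hδ, δ0, hδ0, hE⟩ := hJ.equi (half_pos hε)
      refine ⟨k0 '' (ball x (δ/2) ∩ DD), image_mem_map (inter_mem (mem_nhdsWithin_of_mem_nhds (ball_mem_nhds _ (by positivity))) self_mem_nhdsWithin), ?_⟩
      rintro _ ⟨a, ha, rfl⟩ _ ⟨b, hb, rfl⟩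
      have := hE J hJ (fun x _ => by simp [hδ0.le]) k0 h0 H a ha.2 b hb.2 (by
        rw [← dist_eq_norm]
        have := dist_triangle_right a b x
        have h1 := ha.1; have h2 := hb.1
        rw [mem_ball] at h1 h2; linarith)
      rw [dist_eq_norm]; linarith
    exact CompleteSpace.complete hC
  set k := extendFrom DD k0
  have hkc : ContinuousOn k cD := continuousOn_extendFrom (by rw [closure_DD]) hlim
  have hkk : EqOn k k0 DD := by
    intro x hx
    exact extendFrom_eq (by rw [closure_DD]; exact DD_sub hx) (H.kc x hx)
  have hkt : ∀ x ∈ cD, Tendsto k0 (𝓝[DD] x) (𝓝 (k x)) := fun x hx => tendsto_extendFrom (hlim x hx)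
  have hkm : MapsTo k cD cD := by
    intro x hx
    have := cD_nebot hx
    refine isClosed_closedBall.mem_of_tendsto (hkt x hx) ?_
    filter_upwards [self_mem_nhdsWithin] with z hz using DD_sub (H.kD hz)
  have hkb : ∀ x, ‖x‖ = 1 → ‖k x‖ = 1 := by
    intro x hx
    have hxc : x ∈ cD := by simp [hx]
    rcases cD_split (hkm hxc) with h | h
    · exfalso
      have := cD_nebot hxc
      have h1 : Tendsto (fun z => h0 (k0 z)) (𝓝[DD] x) (𝓝 (h0 (k x))) :=
        ((H.hc.continuousAt (isOpen_ball.mem_nhds h)).tendsto).comp (hkt x hxc)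
      have h2 : Tendsto (fun z => h0 (k0 z)) (𝓝[DD] x) (𝓝 x) := by
        refine (tendsto_id.mono_left nhdsWithin_le_nhds).congr' ?_
        filter_upwards [self_mem_nhdsWithin] with z hz using (H.hk z hz).symm
      have h3 := tendsto_nhds_unique h1 h2
      have := H.hD h
      rw [h3, mem_ball_zero_iff, hx] at this
      exact lt_irrefl _ this
    · exact h
  have hkD : MapsTo k DD DD := fun z hz => by rw [hkk hz]; exact H.kD hz
  have hholo : DifferentiableOn ℂ (J ∘ k) DD := H.holo.congr fun z hz => by simp [hkk hz]
  have hcont : ContinuousOn (J ∘ k) cD := hJ.cont.comp hkc hkm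
  have hinj : InjOn k cD := by
    intro ζ1 h1 ζ2 h2 h12
    rcases cD_split h1 with g1 | g1
    · rcases cD_split h2 with g2 | g2
      · rw [hkk g1, hkk g2] at h12
        rw [← H.hk _ g1, h12, H.hk _ g2]
      · exfalso
        have := hkD g1
        rw [mem_ball_zero_iff, h12, hkb _ g2] at this
        exact lt_irrefl _ this
    rcases cD_split h2 with g2 | g2
    · exfalso
      have := hkD g2
      rw [mem_ball_zero_iff, ← h12, hkb _ g1] at this
      exact lt_irrefl _ this
    by_contra hne
    set x0 := k ζ1 with hx0
    have hx0n : ‖x0‖ = 1 := hkb _ g1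
    have nosep : ∀ ξ1 ξ2, ‖ξ1‖ = 1 → ‖ξ2‖ = 1 → ξ1 ≠ ξ2 → k ξ1 ≠ x0 → k ξ2 ≠ x0 → sideL ξ1 ξ2 ζ1 < 0 → ¬ 0 < sideL ξ1 ξ2 ζ2 := by
      intro ξ1 ξ2 n1 n2 n12 k1 k2 s1 s2
      have hLc : Continuous (sideL ξ1 ξ2) := by unfold sideL; fun_prop
      have hKc : IsCompact (cD ∩ {w | sideL ξ1 ξ2 w = 0}) :=
        (isCompact_closedBall 0 1).inter_right (isClosed_eq hLc continuous_const)
      have hKi := hKc.image_of_continuousOn (hkc.mono inter_subset_left)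
      have hx0K : x0 ∉ k '' (cD ∩ {w | sideL ξ1 ξ2 w = 0}) := by
        rintro ⟨w, ⟨hw, hw0⟩, hwx⟩
        rcases cD_split hw with hw | hw
        · have := hkD hw
          rw [mem_ball_zero_iff, hwx, hx0n] at this
          exact lt_irrefl _ this
        · rcases sideL_circle n1 n2 n12 hw hw0 with rfl | rfl
          · exact k1 hwx
          · exact k2 hwx
      obtain ⟨ε, hε, hb⟩ := Metric.isOpen_iff.1 hKi.isClosed.isOpen_compl x0 hx0K
      have hT : IsPreconnected (sideL ξ1 ξ2 '' (h0 '' (ball x0 ε ∩ DD))) := by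
        refine ((((convex_ball x0 ε).inter (convex_ball 0 1)).isPreconnected).image _ (H.hc.mono inter_subset_right)).image _ hLc.continuousOn
      have near : ∀ ζ, ‖ζ‖ = 1 → k ζ = x0 → ∀ N : Set ℂ, IsOpen N → ζ ∈ N → ∃ w ∈ N, w ∈ h0 '' (ball x0 ε ∩ DD) := by
        intro ζ hζ hkζ N hN hζN
        have hζc : ζ ∈ cD := by simp [hζ]
        have := cD_nebot hζc
        have h1 := (hkt ζ hζc).eventually (isOpen_ball.mem_nhds (show k ζ ∈ ball x0 ε by rw [hkζ]; exact mem_ball_self hε))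
        obtain ⟨w, hw1, hw2, hw3⟩ := (h1.and ((eventually_mem_nhdsWithin).and (mem_nhdsWithin_of_mem_nhds (hN.mem_nhds hζN)))).exists
        exact ⟨w, hw3, k0 w, ⟨hw1, H.kD hw2⟩, H.hk w hw2⟩
      obtain ⟨w1, hw1, hw1'⟩ := near ζ1 g1 rfl {w | sideL ξ1 ξ2 w < 0} (isOpen_lt hLc continuous_const) s1
      obtain ⟨w2, hw2, hw2'⟩ := near ζ2 g2 h12.symm {w | 0 < sideL ξ1 ξ2 w} (isOpen_lt continuous_const hLc) s2
      have h3 : (0:ℝ) ∈ _ := hT.Icc_subset ⟨w1, hw1', rfl⟩ ⟨w2, hw2', rfl⟩ ⟨le_of_lt hw1, le_of_lt hw2⟩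
      obtain ⟨_, ⟨x, hx, rfl⟩, hx0⟩ := h3
      refine hb hx.1 ⟨h0 x, ⟨DD_sub (H.hD hx.2), hx0⟩, ?_⟩
      rw [hkk (H.hD hx.2), H.kh x hx.2]
    have hd : ζ2 - ζ1 ≠ 0 := sub_ne_zero.2 (Ne.symm hne)
    have hdn : (‖ζ2 - ζ1‖:ℂ) ≠ 0 := by simpa using hd
    set u : ℂ := 𝕚 * (ζ2 - ζ1) / ‖ζ2 - ζ1‖ with hu
    have hun : ‖u‖ = 1 := by simp [u, hd]
    have hu0 : u ≠ 0 := by intro h; simp [h] at hun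
    have hk0 : (J ∘ k) 0 ≠ J x0 := by
      intro h
      have h2 := hJ.inj (hkm (by simp)) (by simp [hx0n]) h
      have := hkD zero_DD
      rw [h2, mem_ball_zero_iff, hx0n] at this
      exact lt_irrefl _ this
    have dense : ∀ v, ‖v‖ = 1 → ∀ N : Set ℂ, IsOpen N → v ∈ N → ∃ ξ ∈ N, ‖ξ‖ = 1 ∧ k ξ ≠ x0 := by
      intro v hv N hN hvN
      by_contra hcon
      push Not at hcon
      exact hk0 (const_of_arc hholo hcont hv hN hvN fun z hz hz1 => by simp [hcon z hz hz1])
    have hO : IsOpen {p : ℂ × ℂ | sideL p.1 p.2 ζ1 < 0 ∧ 0 < sideL p.1 p.2 ζ2 ∧ p.1 ≠ p.2} := by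
      have c1 : Continuous fun p : ℂ × ℂ => sideL p.1 p.2 ζ1 := by unfold sideL; fun_prop
      have c2 : Continuous fun p : ℂ × ℂ => sideL p.1 p.2 ζ2 := by unfold sideL; fun_prop
      exact (isOpen_lt c1 continuous_const).inter ((isOpen_lt continuous_const c2).inter (isOpen_ne_fun continuous_fst continuous_snd))
    have hn : ∀ x : ℂ, ‖x‖ = 1 → x.re * x.re + x.im * x.im = 1 := by
      intro x hx; rw [← normSq_apply, normSq_eq_norm_sq, hx]; norm_num
    have hpos : 0 < 1 - (ζ1.re * ζ2.re + ζ1.im * ζ2.im) := by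
      have hS : 0 < normSq (ζ2 - ζ1) := Complex.normSq_pos.2 hd
      rw [normSq_apply] at hS; simp at hS
      nlinarith [hn _ g1, hn _ g2]
    have hdp : 0 < ‖ζ2 - ζ1‖ := norm_pos_iff.2 hd
    have hside : ∀ w : ℂ, sideL u (-u) w = 2 / ‖ζ2 - ζ1‖ * (w.re * (ζ2.re - ζ1.re) + w.im * (ζ2.im - ζ1.im)) := by
      intro w
      have hur : u.re = -(ζ2.im - ζ1.im) / ‖ζ2 - ζ1‖ := by rw [hu, Complex.div_ofReal_re]; simp
      have hui : u.im = (ζ2.re - ζ1.re) / ‖ζ2 - ζ1‖ := by rw [hu, div_ofReal_im]; simp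
      simp only [sideL, mul_im, conj_re, conj_im, sub_re, sub_im, neg_re, Complex.neg_im, hur, hui]
      field_simp; ring
    have hmem : (u, -u) ∈ {p : ℂ × ℂ | sideL p.1 p.2 ζ1 < 0 ∧ 0 < sideL p.1 p.2 ζ2 ∧ p.1 ≠ p.2} := by
      have c : 0 < 2 / ‖ζ2 - ζ1‖ := by positivity
      refine ⟨?_, ?_, ?_⟩
      · simp only [hside]
        have : ζ1.re * (ζ2.re - ζ1.re) + ζ1.im * (ζ2.im - ζ1.im) < 0 := by nlinarith [hn _ g1]
        exact mul_neg_of_pos_of_neg c this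
      · simp only [hside]
        have : 0 < ζ2.re * (ζ2.re - ζ1.re) + ζ2.im * (ζ2.im - ζ1.im) := by nlinarith [hn _ g2]
        positivity
      · intro h
        exact hu0 (self_eq_neg.1 h)
    obtain ⟨U, V, hU, hV, huU, huV, hUV⟩ := isOpen_prod_iff.1 hO _ _ hmem
    obtain ⟨ξ1, m1, n1, k1⟩ := dense u hun U hU huU
    obtain ⟨ξ2, m2, n2, k2⟩ := dense (-u) (by simp [hun]) V hV huV
    have := hUV (mk_mem_prod m1 m2)
    exact nosep ξ1 ξ2 n1 n2 this.2.2 k1 k2 this.1 this.2.1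
  have hsurj : k '' cD = cD := by
    apply Subset.antisymm (mapsTo_iff_image_subset.1 hkm)
    have hcl : IsClosed (k '' cD) := ((isCompact_closedBall (0:ℂ) 1).image_of_continuousOn hkc).isClosed
    rw [← closure_DD]
    refine closure_minimal ?_ (by rw [closure_DD]; exact hcl)
    intro x hx
    exact ⟨h0 x, by rw [closure_DD]; exact DD_sub (H.hD hx), by rw [hkk (H.hD hx), H.kh x hx]⟩
  set h := invFunOn k cD
  have hhk : ∀ z ∈ cD, h (k z) = z := fun z hz => hinj.leftInvOn_invFunOn hz
  have hhc := cont_inv_of_compact (isCompact_closedBall (0:ℂ) 1) hkc hhk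
  rw [hsurj] at hhc
  have hkh : ∀ x ∈ cD, k (h x) = x := fun x hx => invFunOn_eq (by rw [← hsurj] at hx; exact hx)
  have hhm : MapsTo h cD cD := fun x hx => invFunOn_mem (by rw [← hsurj] at hx; exact hx)
  have hhD : MapsTo h DD DD := by
    intro x hx
    rcases cD_split (hhm (DD_sub hx)) with g | g
    · exact g
    · exfalso
      have := hkb _ g
      rw [hkh x (DD_sub hx)] at this
      rw [mem_ball_zero_iff, this] at hx
      exact lt_irrefl _ hx
  refine ⟨k, h, ⟨hholo, hkD, hhD, hkc.mono DD_sub, hhc.mono DD_sub, fun x hx => hkh x (DD_sub hx), fun z hz => hhk z (DD_sub hz), ?_, ?_⟩, hkc, hhc, hkm, hhm, hkh, hhk⟩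
  · have h1 : k 0 = 0 := by rw [hkk zero_DD, H.k0]
    have := hhk 0 (by simp)
    rwa [h1] at this
  · obtain ⟨c, hc, hc'⟩ := H.pos
    refine ⟨c, hc, ?_⟩
    rw [← hc']
    apply EventuallyEq.deriv_eq
    filter_upwards [isOpen_ball.mem_nhds zero_DD] with z hz
    simp [hkk hz]

lemma Unif.bdry {J k h : ℂ → ℂ} (H : Unif J k h) (hz : ‖z‖ = 1) : ‖k z‖ = 1 := by
  have hzc : z ∈ cD := by simp [hz]
  rcases cD_split (H.km hzc) with g | g
  · have := H.hD g
    rw [H.hkc z hzc, mem_ball_zero_iff, hz] at this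
    exact absurd this (lt_irrefl _)
  · exact g
lemma Unif.bdry' {J k h : ℂ → ℂ} (H : Unif J k h) (hz : ‖z‖ = 1) : ‖h z‖ = 1 := by
  have hzc : z ∈ cD := by simp [hz]
  rcases cD_split (H.hm hzc) with g | g
  · have := H.kD g
    rw [H.khc z hzc, mem_ball_zero_iff, hz] at this
    exact absurd this (lt_irrefl _)
  · exact g
lemma auto_id {T S : ℂ → ℂ} (hT : DifferentiableOn ℂ T DD) (hTm : MapsTo T DD DD) (hS : MapsTo S DD DD)
    (hTS : ∀ z ∈ DD, T (S z) = z) (hST : ∀ z ∈ DD, S (T z) = z) (hT0 : T 0 = 0)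
    {c : ℝ} (hc : 0 ≤ c) (hd : deriv T 0 = c) : EqOn T id DD := by
  have hinj : InjOn T DD := fun x hx y hy h => by rw [← hST x hx, h, hST y hy]
  have hSd : DifferentiableOn ℂ S DD := inj_inv_holo isOpen_ball hT hinj isOpen_ball hS hTS differentiableOn_id
  have hS0 : S 0 = 0 := by have := hST 0 zero_DD; rwa [hT0] at this
  have hTd := (hT.differentiableAt (isOpen_ball.mem_nhds zero_DD)).hasDerivAt
  have hSd0 := (hSd.differentiableAt (isOpen_ball.mem_nhds zero_DD)).hasDerivAt
  have h1 : ‖deriv S 0‖ ≤ 1 := by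
    have := norm_deriv_le_div_of_mapsTo_ball (f := S) (c := 0) (R₁ := 1) (R₂ := 1) hSd (by rw [hS0]; exact hS.mono_right DD_sub) one_pos
    simpa using this
  have h2 : deriv S 0 * deriv T 0 = 1 := by
    have h3 : HasDerivAt (S ∘ T) (deriv S 0 * deriv T 0) 0 := by
      apply HasDerivAt.comp
      · rw [hT0]; exact hSd0
      · exact hTd
    have h4 : HasDerivAt (S ∘ T) 1 0 := by
      refine (hasDerivAt_id (0:ℂ)).congr_of_eventuallyEq ?_
      filter_upwards [isOpen_ball.mem_nhds zero_DD] with z hz using hST z hz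
    exact h3.unique h4
  have h3 : ‖deriv T 0‖ ≤ 1 := by
    have := norm_deriv_le_div_of_mapsTo_ball (f := T) (c := 0) (R₁ := 1) (R₂ := 1) hT (by rw [hT0]; exact hTm.mono_right DD_sub) one_pos
    simpa using this
  have h4 : ‖deriv T 0‖ = 1 := by
    apply le_antisymm h3
    have := congrArg norm h2
    rw [norm_mul, norm_one] at this
    nlinarith [norm_nonneg (deriv T 0)]
  have hc1 : c = 1 := by
    rw [hd, norm_real, norm_of_nonneg hc] at h4; exact h4
  have := Complex.affine_of_mapsTo_ball_of_exists_norm_dslope_eq_div' (f := T) (c := 0) (R₁ := 1) (R₂ := 1) hT (by rw [hT0]; exact hTm.mono_right DD_sub)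
    ⟨0, zero_DD, by rw [dslope_same, h4]; simp⟩
  obtain ⟨C, hC, hC2⟩ := this
  have hC3 : deriv T 0 = C := by
    have : HasDerivAt T C 0 := by
      have h5 : HasDerivAt (fun z : ℂ => T 0 + (z - 0) • C) C 0 := by
        simpa using ((hasDerivAt_id (0:ℂ)).mul_const C).const_add (T 0)
      refine h5.congr_of_eventuallyEq ?_
      filter_upwards [isOpen_ball.mem_nhds zero_DD] with z hz using hC2 hz
    exact this.deriv
  intro z hz
  rw [hC2 hz, ← hC3, hd, hc1, hT0]; simp
lemma const_of_local {f : ℂ → ℂ} (hf : DifferentiableOn ℂ f DD) {z y : ℂ} (hz : z ∈ DD) (h : ∀ᶠ w in 𝓝 z, f w - y = 0) :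
    ∀ w ∈ DD, f w = y := by
  have h1 : AnalyticOnNhd ℂ f DD := hf.analyticOnNhd isOpen_ball
  have := h1.eqOn_of_preconnected_of_eventuallyEq (g := fun _ => y) analyticOnNhd_const (convex_ball (0:ℂ) 1).isPreconnected hz
    (by filter_upwards [h] with w hw using sub_eq_zero.1 hw)
  exact this
lemma Unif.stable_k {J k h : ℂ → ℂ} (hJ : Adm J) (H : Unif J k h) {ε : ℝ} (hε : 0 < ε) : ∃ δ > 0, ∀ J', Adm J' →
    (∀ x ∈ cD, ‖J' x - J x‖ ≤ δ) → ∀ k' h', Unif J' k' h' → ∀ z ∈ cD, ‖k' z - k z‖ < ε := by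
  by_contra hcon
  push Not at hcon
  choose Jn hJn hclose kn hn Un zn hzn hbad using fun n : ℕ => hcon (1 / ((n:ℝ) + 1)) (by positivity)
  set l : Filter ℕ := (hyperfilter ℕ : Filter ℕ)
  have hl : l ≤ atTop := Nat.hyperfilter_le_atTop
  have hJt : ∀ e > 0, ∀ᶠ n in l, ∀ x ∈ cD, ‖Jn n x - J x‖ ≤ e := by
    intro e he
    have h1 : ∀ᶠ n : ℕ in l, 1 / ((n:ℝ) + 1) < e := hl ((tendsto_one_div_add_atTop_nhds_zero_nat (𝕜 := ℝ)).eventually_lt_const he)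
    filter_upwards [h1] with n hn x hx
    exact (hclose n x hx).trans hn.le
  have hE : ∀ e > 0, ∃ δ > 0, ∀ᶠ n in l, ∀ z1 ∈ cD, ∀ z2 ∈ cD, ‖z1 - z2‖ ≤ δ → ‖kn n z1 - kn n z2‖ ≤ e := by
    intro e he
    obtain ⟨δ, hδ, δ0, hδ0, hE⟩ := hJ.equi he
    refine ⟨δ/2, by positivity, ?_⟩
    filter_upwards [hJt δ0 hδ0] with n hn z1 hz1 z2 hz2 h12
    have i1 := cD_nebot hz1
    have i2 := cD_nebot hz2
    have t : Tendsto (fun p : ℂ × ℂ => ‖kn n p.1 - kn n p.2‖) (𝓝[DD] z1 ×ˢ 𝓝[DD] z2) (𝓝 ‖kn n z1 - kn n z2‖) := by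
      have a1 := ((Un n).kcc z1 hz1).mono DD_sub
      have a2 := ((Un n).kcc z2 hz2).mono DD_sub
      exact ((a1.tendsto.comp tendsto_fst).sub (a2.tendsto.comp tendsto_snd)).norm
    have t2 : Tendsto (fun p : ℂ × ℂ => ‖p.1 - p.2‖) (𝓝[DD] z1 ×ˢ 𝓝[DD] z2) (𝓝 ‖z1 - z2‖) :=
      (((tendsto_id.mono_left nhdsWithin_le_nhds).comp tendsto_fst).sub ((tendsto_id.mono_left nhdsWithin_le_nhds).comp tendsto_snd)).norm
    refine le_of_tendsto t ?_
    filter_upwards [prod_mem_prod self_mem_nhdsWithin self_mem_nhdsWithin, t2.eventually_lt_const (show ‖z1 - z2‖ < δ by linarith)] with p hp hp2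
    exact hE _ (hJn n) hn _ _ (Un n).toPU _ hp.1 _ hp.2 hp2.le
  have hL : ∀ z, ∃ w, z ∈ cD → w ∈ cD ∧ Tendsto (fun n => kn n z) l (𝓝 w) := by
    intro z
    by_cases hz : z ∈ cD
    · obtain ⟨w, hw, hw2⟩ := (isCompact_closedBall (0:ℂ) 1).ultrafilter_le_nhds ((hyperfilter ℕ).map fun n => kn n z)
        (by rw [le_principal_iff]; exact mem_map.2 (univ_mem' fun n => (Un n).km hz))
      exact ⟨w, fun _ => ⟨hw, hw2⟩⟩
    · exact ⟨0, fun h => absurd h hz⟩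
  choose K hK using hL
  have hKE : ∀ e > 0, ∃ δ > 0, ∀ z1 ∈ cD, ∀ z2 ∈ cD, ‖z1 - z2‖ ≤ δ → ‖K z1 - K z2‖ ≤ e := by
    intro e he
    obtain ⟨δ, hδ, h1⟩ := hE e he
    refine ⟨δ, hδ, fun z1 h1' z2 h2' h12 => ?_⟩
    refine le_of_tendsto ((hK z1 h1').2.sub (hK z2 h2').2).norm ?_
    filter_upwards [h1] with n hn using hn z1 h1' z2 h2' h12
  have hU : ∀ e > 0, ∀ᶠ n in l, ∀ z ∈ cD, ‖kn n z - K z‖ ≤ e := by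
    intro e he
    obtain ⟨δ, hδ, h1⟩ := hE (e/3) (by positivity)
    obtain ⟨δ', hδ', h1'⟩ := hKE (e/3) (by positivity)
    obtain ⟨t, ht, htf, htc⟩ := (isCompact_closedBall (0:ℂ) 1).finite_cover_balls (lt_min hδ hδ')
    have h2 : ∀ᶠ n in l, ∀ c ∈ t, ‖kn n c - K c‖ < e/3 := by
      rw [eventually_all_finite htf]
      intro c hc
      have := (hK c (ht hc)).2
      rw [Metric.tendsto_nhds] at this
      simpa [dist_eq_norm] using this (e/3) (by positivity)
    filter_upwards [h1, h2] with n n1 n2 z hz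
    have := htc hz
    simp only [mem_iUnion] at this
    obtain ⟨c, hc, hzc⟩ := this
    rw [mem_ball, dist_eq_norm, lt_min_iff] at hzc
    have a := n1 z hz c (ht hc) hzc.1.le
    have b := n2 c hc
    have d := h1' z hz c (ht hc) hzc.2.le
    calc ‖kn n z - K z‖ = ‖(kn n z - kn n c) + (kn n c - K c) - (K z - K c)‖ := by congr 1; ring
      _ ≤ ‖kn n z - kn n c‖ + ‖kn n c - K c‖ + ‖K z - K c‖ := (norm_sub_le _ _).trans (by gcongr; exact norm_add_le _ _)
      _ ≤ e := by linarith
  have hKc : ContinuousOn K cD := by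
    rw [Metric.continuousOn_iff]
    intro z hz e he
    obtain ⟨δ, hδ, h1⟩ := hKE (e/2) (by positivity)
    refine ⟨δ, hδ, fun w hw hwz => ?_⟩
    rw [dist_eq_norm] at hwz ⊢
    have := h1 w hw z hz hwz.le
    linarith
  have hKm : MapsTo K cD cD := fun z hz => (hK z hz).1
  have hKb : ∀ z, ‖z‖ = 1 → ‖K z‖ = 1 := by
    intro z hz
    have := (hK z (by simp [hz])).2.norm
    refine tendsto_nhds_unique this ?_
    refine tendsto_const_nhds.congr fun n => ((Un n).bdry hz).symm
  have hK0 : K 0 = 0 := by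
    refine tendsto_nhds_unique (hK 0 (by simp)).2 ?_
    refine tendsto_const_nhds.congr fun n => ((Un n).k0).symm
  have hJu := (isCompact_closedBall (0:ℂ) 1).uniformContinuousOn_of_continuous hJ.cont
  have hφu : TendstoUniformlyOn (fun n => Jn n ∘ kn n) (J ∘ K) l DD := by
    rw [tendstoUniformlyOn_iff]
    intro e he
    obtain ⟨δ, hδ, h1⟩ := uniformContinuousOn_iff.1 hJu (e/2) (by positivity)
    filter_upwards [hU (δ/2) (by positivity), hJt (e/4) (by positivity)] with n n1 n2 z hz
    have hz' := DD_sub hz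
    have a := h1 (K z) (hKm hz') (kn n z) ((Un n).km hz') (by rw [dist_comm, dist_eq_norm]; linarith [n1 z hz'])
    have b := n2 _ ((Un n).km hz')
    have c := dist_triangle (J (K z)) (J (kn n z)) (Jn n (kn n z))
    rw [dist_comm (J (kn n z)), dist_eq_norm (Jn n (kn n z))] at c
    simp only [Function.comp]
    linarith
  have hφt := hφu.tendstoLocallyUniformlyOn
  have hφd : ∀ᶠ n in l, DifferentiableOn ℂ (Jn n ∘ kn n) DD := Eventually.of_forall fun n => (Un n).holo
  have hφ : DifferentiableOn ℂ (J ∘ K) DD := hφt.differentiableOn hφd isOpen_ball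
  have hJKinj : ∀ z ∈ cD, ∀ w ∈ cD, J (K z) = J w → K z = w := fun z hz w hw h => hJ.inj (hKm hz) hw h
  have hKD : MapsTo K DD DD := by
    intro z hz
    rcases cD_split (hKm (DD_sub hz)) with g | g
    · exact g
    exfalso
    have gc : K z ∈ cD := by simp [g]
    have ht : TendstoLocallyUniformlyOn (fun n w => (Jn n ∘ kn n) w - Jn n (K z)) (fun w => (J ∘ K) w - J (K z)) l DD := by
      have hc : TendstoUniformlyOn (fun n (_ : ℂ) => Jn n (K z)) (fun _ => J (K z)) l DD := by
        rw [tendstoUniformlyOn_iff]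
        intro e he
        filter_upwards [hJt (e/2) (by positivity)] with n hn x _
        rw [dist_comm, dist_eq_norm]; linarith [hn _ gc]
      exact (hφu.sub hc).tendstoLocallyUniformlyOn
    have := hurwitz isOpen_ball (by filter_upwards [hφd] with n hn using hn.sub_const _) ?_ ht hz (by simp)
    · have h1 := const_of_local hφ hz this 0 zero_DD
      have h2 := hJKinj 0 (by simp) _ gc h1
      rw [hK0] at h2; rw [← h2] at g; simp at g
    · refine Eventually.of_forall fun n w hw h => ?_
      have h1 := (hJn n).inj ((Un n).km (DD_sub hw)) gc (sub_eq_zero.1 h)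
      have := (Un n).kD hw
      rw [h1, mem_ball_zero_iff, g] at this
      exact lt_irrefl _ this
  have hKs : ∀ x ∈ DD, ∃ z ∈ DD, K z = x := by
    intro x hx
    have hxc := DD_sub hx
    obtain ⟨z, hz, hz2⟩ := (isCompact_closedBall (0:ℂ) 1).ultrafilter_le_nhds ((hyperfilter ℕ).map fun n => hn n x)
        (by rw [le_principal_iff]; exact mem_map.2 (univ_mem' fun n => (Un n).hm hxc))
    have hz2 : Tendsto (fun n => hn n x) l (𝓝 z) := hz2
    have hKz : K z = x := by
      have h1 : Tendsto (fun n => K (hn n x)) l (𝓝 (K z)) :=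
        (hKc z hz).tendsto.comp (tendsto_nhdsWithin_iff.2 ⟨hz2, Eventually.of_forall fun n => (Un n).hm hxc⟩)
      have h2 : Tendsto (fun n => K (hn n x)) l (𝓝 x) := by
        rw [Metric.tendsto_nhds]
        intro e he
        filter_upwards [hU (e/2) (by positivity)] with n hnn
        have := hnn _ ((Un n).hm hxc)
        rw [(Un n).khc x hxc] at this
        rw [dist_comm, dist_eq_norm]; linarith
      exact tendsto_nhds_unique h1 h2
    rcases cD_split hz with g | g
    · exact ⟨z, g, hKz⟩
    · have := hKb z g
      rw [hKz] at this
      rw [mem_ball_zero_iff, this] at hx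
      exact absurd hx (lt_irrefl _)
  have hKi : InjOn K DD := by
    intro w hw z hz hwz
    by_contra hne
    have hVo : IsOpen (DD \ {w}) := isOpen_ball.sdiff isClosed_singleton
    have hVD : DD \ {w} ⊆ DD := sdiff_subset
    have ht : TendstoLocallyUniformlyOn (fun n v => (Jn n ∘ kn n) v - (Jn n ∘ kn n) w) (fun v => (J ∘ K) v - (J ∘ K) w) l (DD \ {w}) := by
      have hc : TendstoUniformlyOn (fun n (_ : ℂ) => (Jn n ∘ kn n) w) (fun _ => (J ∘ K) w) l (DD \ {w}) := by
        rw [tendstoUniformlyOn_iff]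
        intro e he
        filter_upwards [tendstoUniformlyOn_iff.1 hφu e he] with n hn x _ using hn w hw
      exact ((hφu.mono hVD).sub hc).tendstoLocallyUniformlyOn
    have hzV : z ∈ DD \ {w} := ⟨hz, fun h => hne h.symm⟩
    have := hurwitz hVo (by filter_upwards [hφd] with n hn using (hn.mono hVD).sub_const _) ?_ ht hzV (by simp [hwz])
    · have h1 := const_of_local hφ hz this
      obtain ⟨z', hz', e1⟩ := hKs (1/2) (by rw [mem_ball_zero_iff]; norm_num)
      have h2 := h1 z' hz'
      have h3 := h1 0 zero_DD
      rw [← h3] at h2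
      have h4 := hJKinj z' (DD_sub hz') (K 0) (hKm (by simp)) h2
      rw [e1, hK0] at h4; norm_num at h4
    · refine Eventually.of_forall fun n v hv h => ?_
      exact hv.2 (((Un n).inj (hJn n)) (hVD hv) hw (sub_eq_zero.1 h))
  have hTd : DifferentiableOn ℂ (fun z => h (K z)) DD := by
    refine inj_inv_holo (p := J ∘ K) isOpen_ball H.holo (H.inj hJ) isOpen_ball (fun z hz => H.hD (hKD hz)) ?_ hφ
    intro z hz
    simp [H.kh _ (hKD hz)]
  set S := fun z => invFunOn K DD (k z)
  have hSm : MapsTo S DD DD := fun z hz => invFunOn_mem (by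
    obtain ⟨a, ha, e⟩ := hKs _ (H.kD hz); exact ⟨a, ha, e⟩)
  have hKS : ∀ z ∈ DD, K (S z) = k z := fun z hz => invFunOn_eq (by
    obtain ⟨a, ha, e⟩ := hKs _ (H.kD hz); exact ⟨a, ha, e⟩)
  have hT0 : h (K 0) = 0 := by rw [hK0, H.h0]
  obtain ⟨c, hc, hcd⟩ := H.pos
  have hder : ∃ c' : ℝ, 0 ≤ c' ∧ deriv (J ∘ K) 0 = c' := by
    have h1 := (hφt.deriv hφd isOpen_ball).tendsto_at zero_DD
    have h2 : deriv (J ∘ K) 0 ∈ {w : ℂ | 0 ≤ w.re ∧ w.im = 0} := by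
      refine IsClosed.mem_of_tendsto ?_ h1 (Eventually.of_forall fun n => ?_)
      · exact (isClosed_le continuous_const continuous_re).inter (isClosed_eq continuous_im continuous_const)
      · obtain ⟨c, hc, hcd⟩ := (Un n).pos
        simp only [Function.comp_apply]
        rw [hcd]; simp [hc.le]
    exact ⟨_, h2.1, by apply cxt <;> simp [h2.2]⟩
  obtain ⟨c', hc', hcd'⟩ := hder
  have hTc : deriv (fun z => h (K z)) 0 = ((c' / c : ℝ) : ℂ) := by
    have a1 : HasDerivAt (J ∘ k) c 0 := by
      rw [← hcd]; exact (H.holo.differentiableAt (isOpen_ball.mem_nhds zero_DD)).hasDerivAt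
    have a2 := (hTd.differentiableAt (isOpen_ball.mem_nhds zero_DD)).hasDerivAt
    have a3 : HasDerivAt ((J ∘ k) ∘ (fun z => h (K z))) (c * deriv (fun z => h (K z)) 0) 0 := by
      apply HasDerivAt.comp
      · simp only [hT0]; exact a1
      · exact a2
    have a4 : HasDerivAt ((J ∘ k) ∘ (fun z => h (K z))) c' 0 := by
      rw [← hcd']
      refine (hφ.differentiableAt (isOpen_ball.mem_nhds zero_DD)).hasDerivAt.congr_of_eventuallyEq ?_
      filter_upwards [isOpen_ball.mem_nhds zero_DD] with z hz
      simp [H.kh _ (hKD hz)]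
    have := a3.unique a4
    have hc0 : (c:ℂ) ≠ 0 := by exact_mod_cast hc.ne'
    push_cast; field_simp; rw [mul_comm]; exact this
  have hid := auto_id hTd (fun z hz => H.hD (hKD hz)) hSm (fun z hz => by
      show h (K (S z)) = z
      rw [hKS z hz, H.hk z hz]) (fun z hz => by
      apply hKi (hSm (H.hD (hKD hz))) hz
      rw [hKS _ (H.hD (hKD hz)), H.kh _ (hKD hz)]) hT0 (by positivity) hTc
  have hKk : EqOn K k DD := by
    intro z hz
    have := hid hz
    simp only [id] at this
    rw [← H.kh _ (hKD hz), this]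
  have hKk' : EqOn K k cD := by
    intro z hz
    have := cD_nebot hz
    refine tendsto_nhds_unique ((hKc z hz).mono DD_sub) ((((H.kcc z hz).mono DD_sub).tendsto).congr' ?_)
    filter_upwards [self_mem_nhdsWithin] with w hw using (hKk hw).symm
  obtain ⟨n, hn⟩ := (hU (ε/2) (by positivity)).exists
  have a := hn (zn n) (hzn n)
  rw [hKk' (hzn n)] at a
  linarith [hbad n]
lemma Unif.stable {J k h : ℂ → ℂ} (hJ : Adm J) (H : Unif J k h) {ε : ℝ} (hε : 0 < ε) : ∃ δ > 0, ∀ J', Adm J' →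
    (∀ x ∈ cD, ‖J' x - J x‖ ≤ δ) → ∀ k' h', Unif J' k' h' → (∀ z ∈ cD, ‖k' z - k z‖ < ε) ∧ ∀ x ∈ cD, ‖h' x - h x‖ < ε := by
  have hu := (isCompact_closedBall (0:ℂ) 1).uniformContinuousOn_of_continuous H.hcc
  obtain ⟨e, he, hu⟩ := uniformContinuousOn_iff.1 hu ε hε
  obtain ⟨δ, hδ, hs⟩ := H.stable_k hJ (lt_min he hε)
  refine ⟨δ, hδ, fun J' hJ' hc k' h' H' => ⟨fun z hz => (hs J' hJ' hc k' h' H' z hz).trans_le (min_le_right _ _), fun x hx => ?_⟩⟩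
  have h1 := (hs J' hJ' hc k' h' H' _ (H'.hm hx)).trans_le (min_le_left _ _)
  rw [H'.khc x hx] at h1
  have := hu _ (H.km (H'.hm hx)) x hx (by rw [dist_comm, dist_eq_norm]; exact h1)
  rwa [H.hkc _ (H'.hm hx), dist_eq_norm] at this
lemma Unif.unique {J k h k' h' : ℂ → ℂ} (hJ : Adm J) (H : Unif J k h) (H' : Unif J k' h') :
    EqOn k' k cD ∧ EqOn h' h cD := by
  constructor
  · intro z hz
    rw [← sub_eq_zero, ← norm_le_zero_iff]
    refine le_of_forall_pos_le_add fun ε hε => ?_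
    obtain ⟨δ, hδ, hs⟩ := H.stable hJ hε
    rw [zero_add]
    exact ((hs J hJ (fun x _ => by simp [hδ.le]) k' h' H').1 z hz).le
  · intro z hz
    rw [← sub_eq_zero, ← norm_le_zero_iff]
    refine le_of_forall_pos_le_add fun ε hε => ?_
    obtain ⟨δ, hδ, hs⟩ := H.stable hJ hε
    rw [zero_add]
    exact ((hs J hJ (fun x _ => by simp [hδ.le]) k' h' H').2 z hz).le

def pr (z : ℂ) : ℂ := z / ((max 1 ‖z‖ : ℝ) : ℂ)
lemma pr_cont : Continuous pr := by
  unfold pr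
  refine continuous_id.div (by fun_prop) fun z => ?_
  have : (0:ℝ) < max 1 ‖z‖ := lt_max_of_lt_left one_pos
  exact_mod_cast this.ne'
lemma pr_mem (z : ℂ) : pr z ∈ cD := by
  have h : (0:ℝ) < max 1 ‖z‖ := lt_max_of_lt_left one_pos
  rw [mem_closedBall_zero_iff, pr, norm_div, norm_real, norm_of_nonneg h.le, div_le_one h]
  exact le_max_right _ _
lemma pr_eq (hz : z ∈ cD) : pr z = z := by
  rw [mem_closedBall_zero_iff] at hz
  rw [pr, max_eq_left hz]; simp
def khJ (J : ℂ → ℂ) : (ℂ → ℂ) × (ℂ → ℂ) := Classical.epsilon fun p => Unif J p.1 p.2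
def kJ (J : ℂ → ℂ) : ℂ → ℂ := (khJ J).1
def hJ (J : ℂ → ℂ) : ℂ → ℂ := (khJ J).2
lemma Adm.unif (H : Adm J) : Unif J (kJ J) (hJ J) := by
  obtain ⟨k, h, hh⟩ := Unif.exists H
  exact Classical.epsilon_spec (p := fun p : (ℂ → ℂ) × (ℂ → ℂ) => Unif J p.1 p.2) ⟨(k, h), hh⟩
lemma unif_near {Y : Type*} [TopologicalSpace Y] {f : X → Y → ℂ} {K : Set Y} (hK : IsCompact K)
    (hf : Continuous fun p : X × Y => f p.1 p.2) (x0 : X) {δ : ℝ} (hδ : 0 < δ) :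
    ∀ᶠ x in 𝓝 x0, ∀ y ∈ K, ‖f x y - f x0 y‖ < δ := by
  apply hK.eventually_forall_of_forall_eventually
  intro y _
  have h : Continuous fun p : X × Y => ‖f p.1 p.2 - f x0 p.2‖ :=
    (hf.sub (hf.comp (continuous_const.prodMk continuous_snd))).norm
  have := h.tendsto (x0, y)
  simp only [sub_self, norm_zero] at this
  exact this.eventually_lt_const hδ
lemma joint_of_unif {f : X → ℂ → ℂ} (hc : ∀ x, ContinuousOn (f x) cD)
    (hu : ∀ x0 : X, ∀ ε > 0, ∀ᶠ x in 𝓝 x0, ∀ z ∈ cD, ‖f x z - f x0 z‖ < ε) :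
    Continuous fun p : X × ℂ => f p.1 (pr p.2) := by
  rw [continuous_iff_continuousAt]
  rintro ⟨x0, z0⟩
  rw [continuousAt_iff']
  intro ε hε
  have h1 : Continuous fun z => f x0 (pr z) :=
    continuousOn_univ.1 ((hc x0).comp pr_cont.continuousOn fun z _ => pr_mem z)
  have h2 := (continuousAt_iff'.1 (h1.continuousAt (x := z0))) (ε / 2) (half_pos hε)
  filter_upwards [(hu x0 (ε / 2) (half_pos hε)).prod_nhds h2] with ⟨x, z⟩ ⟨ha, hb⟩
  calc dist (f x (pr z)) (f x0 (pr z0)) ≤ dist (f x (pr z)) (f x0 (pr z)) + dist (f x0 (pr z)) (f x0 (pr z0)) := dist_triangle _ _ _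
    _ < ε / 2 + ε / 2 := add_lt_add (by rw [dist_eq_norm]; exact ha _ (pr_mem z)) hb
    _ = ε := by ring
lemma cD_compact : IsCompact cD := isCompact_closedBall _ _
structure AdmFam (J : X → ℂ → ℂ) : Prop where
  adm : ∀ x, Adm (J x)
  cont : Continuous fun p : X × ℂ => J p.1 (pr p.2)
lemma AdmFam.near {J : X → ℂ → ℂ} (H : AdmFam J) (x0 : X) {ε : ℝ} (hε : 0 < ε) : ∀ᶠ x in 𝓝 x0,
    (∀ z ∈ cD, ‖kJ (J x) z - kJ (J x0) z‖ < ε) ∧ ∀ z ∈ cD, ‖hJ (J x) z - hJ (J x0) z‖ < ε := by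
  obtain ⟨δ, hδ, h⟩ := Unif.stable (H.adm x0) (H.adm x0).unif hε
  filter_upwards [unif_near (f := fun x z => J x (pr z)) cD_compact H.cont x0 hδ] with x hx
  refine h (J x) (H.adm x) (fun z hz => ?_) _ _ (H.adm x).unif
  have := hx z hz
  simp only [pr_eq hz] at this
  exact this.le
theorem AdmFam.kcont {J : X → ℂ → ℂ} (H : AdmFam J) : Continuous fun p : X × ℂ => kJ (J p.1) (pr p.2) :=
  joint_of_unif (fun x => (H.adm x).unif.kcc) fun x0 _ hε => (H.near x0 hε).mono fun _ h => h.1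
theorem AdmFam.hcont {J : X → ℂ → ℂ} (H : AdmFam J) : Continuous fun p : X × ℂ => hJ (J p.1) (pr p.2) :=
  joint_of_unif (fun x => (H.adm x).unif.hcc) fun x0 _ hε => (H.near x0 hε).mono fun _ h => h.2

lemma re_cosh_ge {κ H : ℝ} (hκ : 0 < κ) (hκH : κ * H ≤ 1) (hw : |w.im| ≤ H) :
    κ * |w.re| / 4 ≤ (cosh (κ * w)).re := by
  have h1 : (cosh (κ * w)).re = Real.cosh (κ * w.re) * cos (κ * w.im) := by
    have : (κ:ℂ) * w = ((κ * w.re : ℝ) : ℂ) + ((κ * w.im : ℝ) : ℂ) * 𝕚 := by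
      apply cxt <;> simp
    rw [this, Complex.cosh_add, Complex.cosh_mul_I, Complex.sinh_mul_I, ← Complex.ofReal_cosh, ← Complex.ofReal_sinh,
      ← Complex.ofReal_cos, ← Complex.ofReal_sin]
    simp only [add_re, mul_re, ofReal_re, ofReal_im, I_re, I_im, mul_im]
    ring
  have h2 : |κ * w.im| ≤ 1 := by
    rw [abs_mul, abs_of_pos hκ]; exact (mul_le_mul_of_nonneg_left hw hκ.le).trans hκH
  have h3 : (1:ℝ) / 2 ≤ cos (κ * w.im) := by
    have h4 := Real.one_sub_sq_div_two_le_cos (x := κ * w.im)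
    have h5 : (κ * w.im) ^ 2 ≤ 1 := by rw [← sq_abs]; nlinarith [abs_nonneg (κ * w.im)]
    linarith
  have h4 : κ * |w.re| / 2 ≤ Real.cosh (κ * w.re) := by
    rw [← Real.cosh_abs, abs_mul, abs_of_pos hκ, Real.cosh_eq]
    have := Real.add_one_le_exp (κ * |w.re|)
    have := exp_pos (-(κ * |w.re|))
    linarith
  have h5 : 0 ≤ κ * |w.re| := by positivity
  rw [h1]
  nlinarith
lemma PL {V : Set ℂ} (hV : IsOpen V) {H : ℝ} (hH : ∀ w ∈ V, |w.im| ≤ H) {f : ℂ → ℂ} (hf : DifferentiableOn ℂ f V)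
    (hc : ContinuousOn f (closure V)) {M : ℝ} (hb : ∀ w ∈ V, ‖f w‖ ≤ M) (hfr : ∀ w ∈ frontier V, ‖f w‖ ≤ 1) :
    ∀ w ∈ V, ‖f w‖ ≤ 1 := by
  intro w0 hw0
  have hH0 : 0 ≤ H := (abs_nonneg _).trans (hH w0 hw0)
  set κ : ℝ := 1 / (H + 1)
  have hκ : 0 < κ := by positivity
  have hκH : κ * H ≤ 1 := by
    rw [one_div_mul_eq_div, div_le_one (by positivity)]; linarith
  have hHc : ∀ w ∈ closure V, |w.im| ≤ H := fun w hw =>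
    closure_minimal (t := {w : ℂ | |w.im| ≤ H}) hH (isClosed_le (by fun_prop) continuous_const) hw
  have hbc : ∀ w ∈ closure V, ‖f w‖ ≤ M := fun w hw => by
    have h1 : MapsTo f V (closedBall 0 M) := fun w hw => by simpa using hb w hw
    have h2 := h1.closure_of_continuousOn (by assumption)
    rw [isClosed_closedBall.closure_eq] at h2
    simpa using h2 hw
  have key : ∀ δ : ℝ, 0 < δ → ‖f w0 * exp (-δ * cosh (κ * w0))‖ ≤ 1 := by
    intro δ hδ
    set T : ℝ := max (|w0.re| + 1) (4 * M / (δ * κ))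
    have hT0 : 0 < T := lt_max_of_lt_left (by positivity)
    set W : Set ℂ := V ∩ {w : ℂ | |w.re| < T}
    have hre : Continuous fun w : ℂ => |w.re| := by fun_prop
    have hbd : Bornology.IsBounded W := by
      refine (Metric.isBounded_closedBall (x := (0:ℂ)) (r := T + H)).subset fun w hw => ?_
      rw [mem_closedBall_zero_iff]
      exact (norm_le_abs_re_add_abs_im w).trans (add_le_add hw.2.le (hH w hw.1))
    have hcl : closure W ⊆ closure V := closure_mono inter_subset_left
    have hdc : DiffContOnCl ℂ (fun w => f w * exp (-δ * cosh (κ * w))) W := by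
      constructor
      · exact (hf.mono inter_subset_left).mul (by fun_prop)
      · exact (hc.mono hcl).mul (by fun_prop)
    have hexp : ∀ w : ℂ, ‖exp (-δ * cosh (κ * w))‖ = Real.exp (-(δ * (cosh (κ * w)).re)) := by
      intro w; rw [norm_exp]; congr 1; simp
    refine norm_le_of_forall_mem_frontier_norm_le hbd hdc ?_ (subset_closure ⟨hw0, ?_⟩)
    · intro w hw
      have hwV : w ∈ closure V := hcl (frontier_subset_closure hw)
      have hge := re_cosh_ge hκ hκH (hHc w hwV)
      rw [norm_mul, hexp]
      rcases frontier_inter_subset _ _ hw with h | h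
      · have : Real.exp (-(δ * (cosh (κ * w)).re)) ≤ 1 := by
          rw [exp_le_one_iff]
          have : 0 ≤ κ * |w.re| / 4 := by positivity
          nlinarith
        calc _ ≤ (1:ℝ) * 1 := by gcongr; exact hfr w h.1
          _ = 1 := one_mul 1
      · have hwT : |w.re| = T := frontier_lt_subset_eq hre continuous_const h.2
        rw [hwT] at hge
        have hM : ‖f w‖ ≤ M := hbc w hwV
        have h1 : M ≤ δ * (cosh (κ * w)).re := by
          have : 4 * M / (δ * κ) ≤ T := le_max_right _ _
          rw [div_le_iff₀ (by positivity)] at this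
          nlinarith
        have h2 := Real.add_one_le_exp (δ * (cosh (κ * w)).re)
        rw [exp_neg, ← div_eq_mul_inv, div_le_one (exp_pos _)]
        linarith
    · show |w0.re| < T
      exact (lt_add_one _).trans_le (le_max_left _ _)
  have hlim : Tendsto (fun δ : ℝ => ‖f w0 * exp (-δ * cosh (κ * w0))‖) (𝓝[>] 0) (𝓝 ‖f w0‖) := by
    have : Continuous (fun δ : ℝ => ‖f w0 * exp (-δ * cosh (κ * w0))‖) := by fun_prop
    have h2 := this.tendsto 0
    simp only [ofReal_zero, neg_zero, zero_mul, exp_zero, mul_one] at h2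
    exact h2.mono_left nhdsWithin_le_nhds
  exact le_of_tendsto hlim (by filter_upwards [self_mem_nhdsWithin] with δ hδ using key δ hδ)
abbrev St : Set ℂ := {w | |w.im| ≤ π / 4}
abbrev So : Set ℂ := {w | |w.im| < π / 4}
lemma So_open : IsOpen So := isOpen_lt (by fun_prop) continuous_const
lemma St_closed : IsClosed St := isClosed_le (by fun_prop) continuous_const
lemma So_sub : So ⊆ St := fun w h => by
  have h : |w.im| < π / 4 := h
  show |w.im| ≤ π / 4
  exact h.le
lemma cl_So : closure So ⊆ St := closure_minimal So_sub St_closed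
lemma fr_So (h : w ∈ frontier So) : |w.im| = π / 4 :=
  frontier_lt_subset_eq (f := fun w : ℂ => |w.im|) (by fun_prop) continuous_const h
lemma im_bound {χ : ℂ → ℂ} (hd : DifferentiableOn ℂ χ So) (hc : ContinuousOn χ St) {M : ℝ} (hM : ∀ w ∈ So, |(χ w).im| ≤ M)
    {ε : ℝ} (hε : ∀ w : ℂ, |w.im| = π / 4 → |(χ w).im| ≤ ε) : ∀ w ∈ So, |(χ w).im| ≤ ε := by
  have key : ∀ s : ℝ, |s| = 1 → ∀ w ∈ So, s * (χ w).im ≤ ε := by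
    intro s hs w hw
    have hn : ∀ w, ‖exp (-(s * 𝕚 * χ w) - ε)‖ = Real.exp (s * (χ w).im - ε) := by
      intro w; rw [norm_exp]; congr 1; simp
    have hs' : ∀ x : ℝ, s * x ≤ |x| := fun x => by
      calc s * x ≤ |s * x| := le_abs_self _
        _ = |x| := by rw [abs_mul, hs, one_mul]
    have := PL So_open (H := π / 4) (fun w hw => le_of_lt hw) (f := fun w => exp (-(s * 𝕚 * χ w) - ε))
      (by fun_prop) (by have := hc.mono cl_So; fun_prop) (M := Real.exp (M - ε))
      (fun w hw => by rw [hn, exp_le_exp]; linarith [hM w hw, hs' (χ w).im])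
      (fun w hw => by rw [hn, exp_le_one_iff]; linarith [hε w (fr_So hw), hs' (χ w).im]) w hw
    rw [hn, exp_le_one_iff] at this
    linarith
  intro w hw
  rw [abs_le]
  constructor
  · linarith [key (-1) (by simp) w hw]
  · linarith [key 1 (by simp) w hw]
lemma deriv_bound {χ : ℂ → ℂ} (hd : DifferentiableOn ℂ χ So) (hε : ∀ w ∈ So, |(χ w).im| ≤ 1 / 20) (x : ℝ) :
    ‖deriv χ x‖ < 1 := by
  have hpi := pi_gt_three
  have hsub : closedBall (x:ℂ) (1 / 2) ⊆ So := by
    intro w hw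
    rw [mem_closedBall, dist_eq_norm] at hw
    have := abs_im_le_norm (w - x)
    simp at this
    show |w.im| < π / 4
    linarith
  have hxS : (x:ℂ) ∈ So := hsub (mem_closedBall_self (by norm_num))
  set f : ℂ → ℂ := fun w => exp (20 * 𝕚 * χ w)
  have hfd : DifferentiableOn ℂ f So := by fun_prop
  have hn : ∀ w, ‖f w‖ = Real.exp (-20 * (χ w).im) := by
    intro w; rw [norm_exp]; congr 1; simp
  have hfx : HasDerivAt f (f x * (20 * 𝕚 * deriv χ x)) x := by
    have := (hd.differentiableAt (So_open.mem_nhds hxS)).hasDerivAt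
    exact (this.const_mul (20 * 𝕚)).cexp
  have h1 : ‖deriv f x‖ ≤ Real.exp 1 / (1 / 2) := by
    apply Complex.norm_deriv_le_of_forall_mem_sphere_norm_le (by norm_num)
    · exact ((hfd.mono hsub).diffContOnCl_ball (subset_refl _))
    · intro z hz
      rw [hn, exp_le_exp]
      linarith [(abs_le.1 (hε z (hsub (sphere_subset_closedBall hz)))).1]
  rw [hfx.deriv, norm_mul, hn] at h1
  have h2 : Real.exp (-1) ≤ Real.exp (-20 * (χ x).im) := by
    rw [exp_le_exp]; linarith [(abs_le.1 (hε x hxS)).2]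
  simp only [norm_mul, Complex.norm_I, mul_one, Complex.norm_ofNat] at h1
  have h3 : Real.exp (-1) * (20 * ‖deriv χ x‖) ≤ Real.exp 1 / (1 / 2) :=
    (mul_le_mul_of_nonneg_right h2 (by positivity)).trans h1
  have h4 : Real.exp (-1) = (Real.exp 1)⁻¹ := exp_neg 1
  have he := Real.exp_one_lt_d9
  have he0 := exp_pos 1
  rw [h4, inv_mul_le_iff₀ he0] at h3
  nlinarith

def th (w : ℂ) : ℂ := (exp (2 * w) - 1) / (exp (2 * w) + 1)
def ath (z : ℂ) : ℂ := Complex.log ((1 + z) / (1 - z)) / 2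
def TT (y : ℂ) : ℂ := (exp y - 1) / (exp y + 1)
def cS (w : ℂ) : ℂ := w.re + (max (-(π / 4)) (min (π / 4) w.im) : ℝ) * 𝕚
def JS (G : ℂ → ℂ) (z : ℂ) : ℂ := if z = 1 then 1 else if z = -1 then -1 else TT (G (ath z))
lemma cS_cont : Continuous cS := by unfold cS; fun_prop
lemma cS_mem (w : ℂ) : cS w ∈ St := by
  have := pi_pos
  simp only [cS, mem_ofPred_eq]
  simp only [add_im, ofReal_im, mul_im, ofReal_re, I_re, I_im]
  simp only [mul_one, mul_zero, zero_add, add_zero]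
  rw [abs_le]
  exact ⟨le_max_left _ _, max_le (by linarith) (min_le_left _ _)⟩
lemma cS_re (w : ℂ) : (cS w).re = w.re := by simp [cS]
lemma cS_eq (hw : w ∈ St) : cS w = w := by
  have h : |w.im| ≤ π / 4 := hw
  rw [abs_le] at h
  rw [cS, min_eq_right h.2, max_eq_right h.1, re_add_im]
lemma e2_re (hw : w ∈ St) : 0 ≤ (exp (2 * w)).re := by
  have h : |w.im| ≤ π / 4 := hw
  rw [abs_le] at h
  rw [exp_re]
  have : 0 ≤ cos (2 * w).im := Real.cos_nonneg_of_mem_Icc (by simp; constructor <;> linarith)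
  positivity
lemma log_e2 (hw : w ∈ St) : Complex.log (exp (2 * w)) = 2 * w := by
  have h : |w.im| ≤ π / 4 := hw
  have := pi_pos
  rw [abs_le] at h
  apply Complex.log_exp <;> simp <;> linarith
lemma slit_of_re (h : 0 ≤ z.re) (h0 : z ≠ 0) : z ∈ Complex.slitPlane := by
  rw [Complex.mem_slitPlane_iff]
  by_contra hc
  push Not at hc
  exact h0 (cxt (le_antisymm hc.1 h) hc.2)
lemma ne_of_re (h : 0 ≤ z.re) : z + 1 ≠ 0 := fun hc => by
  have := congrArg Complex.re hc
  simp at this; linarith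
lemma norm_cayley (h : 0 ≤ z.re) : ‖(z - 1) / (z + 1)‖ ≤ 1 := by
  rw [norm_div, div_le_one (norm_pos_iff.2 (ne_of_re h))]
  rw [← sq_le_sq₀ (norm_nonneg _) (norm_nonneg _), ← normSq_eq_norm_sq, ← normSq_eq_norm_sq, normSq_apply, normSq_apply]
  simp; nlinarith
lemma norm_cayley' (h : 0 < z.re) : ‖(z - 1) / (z + 1)‖ < 1 := by
  rw [norm_div, div_lt_one (norm_pos_iff.2 (ne_of_re h.le))]
  rw [← sq_lt_sq₀ (norm_nonneg _) (norm_nonneg _), ← normSq_eq_norm_sq, ← normSq_eq_norm_sq, normSq_apply, normSq_apply]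
  simp; nlinarith
lemma th_mem (hw : w ∈ St) : th w ∈ cD := by
  rw [mem_closedBall_zero_iff]; exact norm_cayley (e2_re hw)
lemma cay_inv {E : ℂ} (h : E + 1 ≠ 0) : (1 + (E - 1) / (E + 1)) / (1 - (E - 1) / (E + 1)) = E := by
  have h2 : (2:ℂ) ≠ 0 := two_ne_zero
  have h1 : 1 + (E - 1) / (E + 1) = 2 * E / (E + 1) := by field_simp; ring
  have h3 : 1 - (E - 1) / (E + 1) = 2 / (E + 1) := by field_simp; ring
  rw [h1, h3, div_div_div_cancel_right₀ h]; field_simp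
lemma cay_ne {E : ℂ} (h : E + 1 ≠ 0) : (E - 1) / (E + 1) ≠ 1 := fun hc => by
  rw [div_eq_one_iff_eq h] at hc
  have : (2:ℂ) = 0 := by linear_combination -hc
  exact two_ne_zero this
lemma cay_ne' {E : ℂ} (h : E + 1 ≠ 0) (h0 : E ≠ 0) : (E - 1) / (E + 1) ≠ -1 := fun hc => by
  rw [div_eq_iff h] at hc
  have : (2:ℂ) * E = 0 := by linear_combination hc
  simp [h0] at this
lemma th_ne (hw : w ∈ St) : th w ≠ 1 := cay_ne (ne_of_re (e2_re hw))
lemma th_ne' (hw : w ∈ St) : th w ≠ -1 := cay_ne' (ne_of_re (e2_re hw)) (exp_ne_zero _)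
lemma ath_th (hw : w ∈ St) : ath (th w) = w := by
  rw [ath, th, cay_inv (ne_of_re (e2_re hw)), log_e2 hw]; ring
lemma cay_re : ((1 + z) / (1 - z)).re = (1 - ‖z‖ ^ 2) / ‖1 - z‖ ^ 2 := by
  rw [Complex.div_re, ← normSq_eq_norm_sq, ← normSq_eq_norm_sq, ← add_div, normSq_apply z]
  congr 1; simp; ring
lemma cay_re_nn (hz : z ∈ cD) : 0 ≤ ((1 + z) / (1 - z)).re := by
  rw [mem_closedBall_zero_iff] at hz
  rw [cay_re]
  have : ‖z‖ ^ 2 ≤ 1 := by nlinarith [norm_nonneg z]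
  apply div_nonneg <;> [linarith; positivity]
lemma cay_ne0 (h1 : z ≠ 1) (h2 : z ≠ -1) : (1 + z) / (1 - z) ≠ 0 :=
  div_ne_zero (fun h => h2 (by linear_combination h)) (fun h => h1 (by linear_combination -h))
lemma ath_mem (hz : z ∈ cD) : ath z ∈ St := by
  have h := Complex.abs_arg_le_pi_div_two_iff.2 (cay_re_nn hz)
  show |(ath z).im| ≤ _
  rw [ath, show (Complex.log ((1 + z) / (1 - z)) / 2).im = ((1 + z) / (1 - z)).arg / 2 by
    rw [← log_im]; simp, abs_div]
  norm_num; linarith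
lemma exp_ath (h1 : z ≠ 1) (h2 : z ≠ -1) : exp (2 * ath z) = (1 + z) / (1 - z) := by
  rw [ath, mul_div_cancel₀ _ two_ne_zero, exp_log (cay_ne0 h1 h2)]
lemma th_ath (h1 : z ≠ 1) (h2 : z ≠ -1) : th (ath z) = z := by
  rw [th, exp_ath h1 h2]
  have : 1 - z ≠ 0 := fun h => h1 (by linear_combination -h)
  have h2 : (2:ℂ) ≠ 0 := two_ne_zero
  have h3 : (1 + z) / (1 - z) + 1 = 2 / (1 - z) := by field_simp; ring
  have h4 : (1 + z) / (1 - z) - 1 = 2 * z / (1 - z) := by field_simp; ring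
  rw [h3, h4, div_div_div_cancel_right₀ this]; field_simp
lemma bdry_th (hw : w ∈ St) : |w.im| < π / 4 ↔ ‖th w‖ < 1 := by
  have h : |w.im| ≤ π / 4 := hw
  have hpi := pi_pos
  constructor
  · intro h
    apply norm_cayley'
    rw [abs_lt] at h
    rw [exp_re]
    have : 0 < cos (2 * w).im := Real.cos_pos_of_mem_Ioo (by simp; constructor <;> linarith)
    positivity
  · intro h1
    apply lt_of_le_of_ne h
    intro h2
    have h3 : (exp (2 * w)).re = 0 := by
      rw [exp_re]
      have : cos (2 * w).im = 0 := by
        rw [← Real.cos_abs]; simp [abs_mul, h2]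
        rw [show 2 * (π / 4) = π / 2 by ring, Real.cos_pi_div_two]
      rw [this, mul_zero]
    have h4 := cay_re (z := th w)
    rw [th, cay_inv (ne_of_re (e2_re hw)), h3] at h4
    have h5 : ‖1 - th w‖ ≠ 0 := norm_ne_zero_iff.2 fun h => th_ne hw (by linear_combination -h)
    rw [← th, eq_div_iff (by positivity)] at h4
    nlinarith [norm_nonneg (th w)]
structure GFam (G : X → ℂ → ℂ) : Prop where
  cont : Continuous fun p : X × ℂ => G p.1 p.2
  homeo : ∀ x, IsHomeomorph (G x)
  disp : ∀ x w, ‖G x w - w‖ ≤ 1 / 20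
lemma TT_im {y : ℂ} (h : |y.im| < π) : Complex.log (exp y) = y ∧ exp y + 1 ≠ 0 := by
  rw [abs_lt] at h
  have h1 := Complex.log_exp h.1 h.2.le
  refine ⟨h1, fun hc => ?_⟩
  have : exp y = -1 := by linear_combination hc
  rw [this, Complex.log_neg_one] at h1
  rw [← h1] at h; simp at h
lemma GFam.im_lt (H : GFam G) (x : X) (hw : w ∈ St) : |(G x w).im| < π := by
  have h : |w.im| ≤ π / 4 := hw
  have h1 := abs_im_le_norm (G x w - w)
  rw [sub_im] at h1
  have := H.disp x w
  have h2 := pi_gt_three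
  have h3 := abs_sub_abs_le_abs_sub (G x w).im w.im
  linarith
lemma TT_inj : InjOn TT {y | |y.im| < π} := by
  intro y hy y' hy' h
  obtain ⟨h1, h2⟩ := TT_im hy
  obtain ⟨h3, h4⟩ := TT_im hy'
  have h5 := cay_inv h2
  have h6 : (exp y - 1) / (exp y + 1) = (exp y' - 1) / (exp y' + 1) := h
  rw [h6, cay_inv h4] at h5
  rw [← h1, ← h5, h3]
lemma JS_one (G : ℂ → ℂ) : JS G 1 = 1 := by simp [JS]
lemma JS_neg_one (G : ℂ → ℂ) : JS G (-1) = -1 := by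
  have : (-1:ℂ) ≠ 1 := by norm_num
  simp [JS, this]
lemma JS_eq (G : ℂ → ℂ) (h1 : z ≠ 1) (h2 : z ≠ -1) : JS G z = TT (G (ath z)) := by simp [JS, h1, h2]
lemma TT_top : Tendsto TT (comap Complex.re atTop) (𝓝 1) := by
  have h1 : Tendsto (fun y : ℂ => exp (-y)) (comap Complex.re atTop) (𝓝 0) := by
    rw [tendsto_zero_iff_norm_tendsto_zero]
    simp only [norm_exp, neg_re]
    exact Real.tendsto_exp_neg_atTop_nhds_zero.comp tendsto_comap
  have h2 : Tendsto (fun y : ℂ => (1 - exp (-y)) / (1 + exp (-y))) (comap Complex.re atTop) (𝓝 ((1 - 0) / (1 + 0))) :=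
    (tendsto_const_nhds.sub h1).div (tendsto_const_nhds.add h1) (by norm_num)
  have h3 : TT = fun y : ℂ => (1 - exp (-y)) / (1 + exp (-y)) := by
    ext y
    have := exp_ne_zero y
    rw [TT, Complex.exp_neg, ← mul_div_mul_left (1 - _) _ this, mul_sub, mul_add, mul_inv_cancel₀ this, mul_one]
  rw [h3]
  simpa using h2
lemma TT_neg (y : ℂ) : TT (-y) = - TT y := by
  have := exp_ne_zero y
  rw [TT, TT, Complex.exp_neg, ← mul_div_mul_left _ _ this, mul_sub, mul_add, mul_inv_cancel₀ this, mul_one, ← neg_div, neg_sub, add_comm]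
lemma TT_bot : Tendsto TT (comap Complex.re atBot) (𝓝 (-1)) := by
  have h : Tendsto (fun y : ℂ => -y) (comap Complex.re atBot) (comap Complex.re atTop) := by
    rw [tendsto_comap_iff]
    exact tendsto_neg_atBot_atTop.comp tendsto_comap
  have := (TT_top.comp h).neg
  refine this.congr fun y => ?_
  simp [TT_neg]
lemma ath_re (z : ℂ) : (ath z).re = log ‖(1 + z) / (1 - z)‖ / 2 := by
  rw [ath, ← log_re]; simp
lemma ath_top : Tendsto (fun z => (ath z).re) (𝓝[≠] 1) atTop := by
  simp only [ath_re]
  refine Tendsto.atTop_div_const two_pos (Real.tendsto_log_atTop.comp ?_)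
  have h1 : Tendsto (fun z : ℂ => ‖1 - z‖⁻¹) (𝓝[≠] 1) atTop := by
    apply tendsto_inv_nhdsGT_zero.comp
    rw [tendsto_nhdsWithin_iff]
    constructor
    · have : Continuous fun z : ℂ => ‖1 - z‖ := by fun_prop
      have := this.tendsto 1
      simp at this
      exact this.mono_left nhdsWithin_le_nhds
    · filter_upwards [self_mem_nhdsWithin] with z hz
      exact norm_pos_iff.2 (sub_ne_zero.2 (Ne.symm hz))
  have h2 : Tendsto (fun z : ℂ => ‖1 + z‖) (𝓝[≠] 1) (𝓝 ‖(1:ℂ) + 1‖) :=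
    Tendsto.mono_left (Continuous.tendsto (by fun_prop) 1) nhdsWithin_le_nhds
  have := h2.pos_mul_atTop (by norm_num) h1
  simpa [div_eq_mul_inv] using this
lemma ath_re_neg (z : ℂ) : (ath (-z)).re = -(ath z).re := by
  rw [ath_re, ath_re, sub_neg_eq_add, ← sub_eq_add_neg, ← inv_div (1 + z) (1 - z), norm_inv, Real.log_inv]; ring
lemma ath_bot : Tendsto (fun z => (ath z).re) (𝓝[≠] (-1)) atBot := by
  have h : Tendsto (fun z : ℂ => -z) (𝓝[≠] (-1)) (𝓝[≠] 1) := by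
    rw [tendsto_nhdsWithin_iff]
    constructor
    · have : Continuous fun z : ℂ => -z := by fun_prop
      have := this.tendsto (-1)
      simp at this
      exact this.mono_left nhdsWithin_le_nhds
    · filter_upwards [self_mem_nhdsWithin] with z hz h1
      exact hz (by rw [mem_singleton_iff] at *; rw [← h1]; ring)
  have := tendsto_neg_atTop_atBot.comp (ath_top.comp h)
  refine this.congr fun z => ?_
  simp [ath_re_neg]
lemma GFam.re (H : GFam G) (x : X) (w : ℂ) : |(G x w).re - w.re| ≤ 1 / 20 := by
  rw [← sub_re]; exact (abs_re_le_norm _).trans (H.disp x w)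
lemma GFam.adm (H : GFam G) : AdmFam fun x => JS (G x) := by
  have hslit : ∀ z ∈ cD, z ≠ 1 → z ≠ -1 → (1 + z) / (1 - z) ∈ Complex.slitPlane := fun z hz h1 h2 =>
    slit_of_re (cay_re_nn hz) (cay_ne0 h1 h2)
  have hcont : Continuous fun p : X × ℂ => JS (G p.1) (pr p.2) := by
    rw [continuous_iff_continuousAt]
    rintro ⟨x0, z0⟩
    by_cases h1 : pr z0 = 1
    · rw [continuousAt_iff']
      intro ε hε
      have hT : ∀ᶠ y in comap Complex.re atTop, ‖TT y - 1‖ < ε := by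
        have := (Metric.tendsto_nhds.1 TT_top) ε hε
        simpa [dist_eq_norm] using this
      rw [eventually_comap] at hT
      obtain ⟨T, hT⟩ := eventually_atTop.1 hT
      have h2 := (ath_top.eventually_ge_atTop (T + 1))
      rw [eventually_nhdsWithin_iff] at h2
      have h3 : ∀ᶠ z in 𝓝 (1:ℂ), z ≠ -1 := isOpen_ne.mem_nhds (by norm_num)
      have h4 : Tendsto (fun p : X × ℂ => pr p.2) (𝓝 (x0, z0)) (𝓝 1) := by
        have := (pr_cont.comp continuous_snd).tendsto (x0, z0)
        simpa [h1, comp_def] using this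
      filter_upwards [h4.eventually h2, h4.eventually h3] with p hp hp'
      simp only [h1, JS_one]
      by_cases h5 : pr p.2 = 1
      · rw [h5, JS_one]; simpa using hε
      · rw [JS_eq _ h5 hp', dist_eq_norm]
        refine hT _ ?_ _ rfl
        have := hp h5
        have := (abs_le.1 (H.re p.1 (ath (pr p.2)))).1
        linarith
    by_cases h1' : pr z0 = -1
    · rw [continuousAt_iff']
      intro ε hε
      have hT : ∀ᶠ y in comap Complex.re atBot, ‖TT y - (-1)‖ < ε := by
        have := (Metric.tendsto_nhds.1 TT_bot) ε hε
        simpa only [dist_eq_norm] using this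
      rw [eventually_comap] at hT
      obtain ⟨T, hT⟩ := eventually_atBot.1 hT
      have h2 := (ath_bot.eventually_le_atBot (T - 1))
      rw [eventually_nhdsWithin_iff] at h2
      have h3 : ∀ᶠ z in 𝓝 (-1:ℂ), z ≠ 1 := isOpen_ne.mem_nhds (by norm_num)
      have h4 : Tendsto (fun p : X × ℂ => pr p.2) (𝓝 (x0, z0)) (𝓝 (-1)) := by
        have := (pr_cont.comp continuous_snd).tendsto (x0, z0)
        simpa [h1', comp_def] using this
      filter_upwards [h4.eventually h2, h4.eventually h3] with p hp hp'
      simp only [h1', JS_neg_one]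
      by_cases h5 : pr p.2 = -1
      · rw [h5, JS_neg_one]; simpa using hε
      · rw [JS_eq _ hp' h5, dist_eq_norm]
        refine hT _ ?_ _ rfl
        have := hp h5
        have := (abs_le.1 (H.re p.1 (ath (pr p.2)))).2
        linarith
    · have hp : ContinuousAt (fun p : X × ℂ => pr p.2) (x0, z0) := (pr_cont.comp continuous_snd).continuousAt
      have ha : ContinuousAt (fun p : X × ℂ => ath (pr p.2)) (x0, z0) := by
        have h5 : ContinuousAt (fun p : X × ℂ => (1 + pr p.2) / (1 - pr p.2)) (x0, z0) :=
          (continuousAt_const.add hp).div (continuousAt_const.sub hp) (sub_ne_zero.2 (Ne.symm h1))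
        exact (h5.clog (hslit _ (pr_mem _) h1 h1')).div_const 2
      have hg : ContinuousAt (fun p : X × ℂ => G p.1 (ath (pr p.2))) (x0, z0) :=
        ContinuousAt.comp (g := fun p : X × ℂ => G p.1 p.2) (f := fun p : X × ℂ => (p.1, ath (pr p.2))) H.cont.continuousAt
          (continuousAt_fst.prodMk ha)
      have ht : ContinuousAt (fun p : X × ℂ => TT (G p.1 (ath (pr p.2)))) (x0, z0) :=
        (hg.cexp.sub continuousAt_const).div (hg.cexp.add continuousAt_const) (TT_im (H.im_lt x0 (ath_mem (pr_mem z0)))).2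
      refine ht.congr ?_
      filter_upwards [hp.eventually_ne h1, hp.eventually_ne h1'] with p a b using (JS_eq _ a b).symm
  refine ⟨fun x => ⟨?_, ?_, ?_⟩, hcont⟩
  · have : Continuous fun z => JS (G x) (pr z) := hcont.comp (Continuous.prodMk_right x)
    exact this.continuousOn.congr fun z hz => by simp only [pr_eq hz]
  · have hne1 : ∀ z ∈ cD, z ≠ 1 → z ≠ -1 → JS (G x) z ≠ 1 ∧ JS (G x) z ≠ -1 := by
      intro z hz h1 h2
      rw [JS_eq _ h1 h2]
      have := (TT_im (H.im_lt x (ath_mem hz))).2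
      exact ⟨cay_ne this, cay_ne' this (exp_ne_zero _)⟩
    have h11 : (1:ℂ) ≠ -1 := by norm_num
    have e1 := JS_one (G x)
    have e2 := JS_neg_one (G x)
    intro z hz z' hz' h
    by_cases a1 : z = 1 <;> by_cases a2 : z = -1 <;> by_cases b1 : z' = 1 <;> by_cases b2 : z' = -1 <;>
      try grind
    rw [JS_eq _ a1 a2, JS_eq _ b1 b2] at h
    have h1 := TT_inj (H.im_lt x (ath_mem hz)) (H.im_lt x (ath_mem hz')) h
    have h2 := (H.homeo x).injective h1
    rw [← th_ath a1 a2, h2, th_ath b1 b2]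
  · have hne : ∀ z ∈ DD, z ≠ 1 ∧ z ≠ -1 := by
      intro z hz
      rw [mem_ball_zero_iff] at hz
      constructor <;> rintro rfl <;> simp at hz
    have : JS (G x) '' DD = TT '' (G x '' So) := by
      ext y
      constructor
      · rintro ⟨z, hz, rfl⟩
        rw [JS_eq _ (hne z hz).1 (hne z hz).2]
        refine ⟨_, ⟨ath z, ?_, rfl⟩, rfl⟩
        show |(ath z).im| < _
        rw [bdry_th (ath_mem (DD_sub hz)), th_ath (hne z hz).1 (hne z hz).2]
        simpa using hz
      · rintro ⟨_, ⟨w, hw, rfl⟩, rfl⟩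
        have hw' : |w.im| < π / 4 := hw
        refine ⟨th w, by simpa using (bdry_th (So_sub hw)).1 hw', ?_⟩
        rw [JS_eq _ (th_ne (So_sub hw)) (th_ne' (So_sub hw)), ath_th (So_sub hw)]
    rw [this]
    have hU : IsOpen {y : ℂ | |y.im| < π} := isOpen_lt (by fun_prop) continuous_const
    refine inj_isOpen_image hU ?_ TT_inj ((H.homeo x).isOpenMap _ So_open) ?_
    · unfold TT
      refine DifferentiableOn.div (by fun_prop) (by fun_prop) fun y hy => (TT_im hy).2
    · rintro _ ⟨w, hw, rfl⟩
      exact H.im_lt x (So_sub hw)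

def BB (a b z : ℂ) : ℂ := a * (z - b) / ((a - b) * (a - z))
def Bi (a b Y : ℂ) : ℂ := a * ((2 * Y + (a + b) / (a - b) - 1) / (2 * Y + (a + b) / (a - b) + 1))
lemma cay_inv' {y : ℂ} (h1 : y ≠ 1) : ((1 + y) / (1 - y) - 1) / ((1 + y) / (1 - y) + 1) = y := by
  have : 1 - y ≠ 0 := fun h => h1 (by linear_combination -h)
  have h2 : (2:ℂ) ≠ 0 := two_ne_zero
  have h3 : (1 + y) / (1 - y) + 1 = 2 / (1 - y) := by field_simp; ring
  have h4 : (1 + y) / (1 - y) - 1 = 2 * y / (1 - y) := by field_simp; ring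
  rw [h3, h4, div_div_div_cancel_right₀ this]; field_simp
section
variable {a b z Y : ℂ} (ha : ‖a‖ = 1) (hb : ‖b‖ = 1) (hab : a ≠ b)
lemma ne0_of_norm (ha : ‖a‖ = 1) : a ≠ 0 := fun h => by simp [h] at ha
include ha
lemma cay_div : (a + z) / (a - z) = (1 + z / a) / (1 - z / a) := by
  have := ne0_of_norm ha
  rw [← mul_div_mul_left (1 + z / a) _ this, mul_add, mul_sub, mul_div_cancel₀ _ this, mul_one]
lemma re_a (z : ℂ) : ((a + z) / (a - z)).re = (1 - ‖z‖ ^ 2) / ‖a - z‖ ^ 2 := by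
  have h0 := ne0_of_norm ha
  rw [cay_div ha, cay_re, norm_div, ha, div_one]
  congr 2
  rw [show a - z = a * (1 - z / a) by field_simp, norm_mul, ha, one_mul]
include hb in
lemma re_kap : ((a + b) / (a - b)).re = 0 := by rw [re_a ha, hb]; simp
include hab
lemma BB_eq (hz : z ≠ a) : BB a b z = ((a + z) / (a - z) - (a + b) / (a - b)) / 2 := by
  have h1 := sub_ne_zero.2 hab
  have h2 := sub_ne_zero.2 hz.symm
  unfold BB
  field_simp
  ring
include hb
lemma BB_re (hz : z ≠ a) : (BB a b z).re = (1 - ‖z‖ ^ 2) / ‖a - z‖ ^ 2 / 2 := by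
  rw [BB_eq ha hab hz, ← re_a ha z]
  have := re_kap ha hb
  simp [this]
omit ha in
lemma BB_ne (ha : ‖a‖ = 1) (hz : z ≠ a) (hz' : z ≠ b) : BB a b z ≠ 0 :=
  div_ne_zero (mul_ne_zero (ne0_of_norm ha) (sub_ne_zero.2 hz')) (mul_ne_zero (sub_ne_zero.2 hab) (sub_ne_zero.2 hz.symm))
lemma BB_nn (hz : z ≠ a) (hc : z ∈ cD) : 0 ≤ (BB a b z).re := by
  rw [mem_closedBall_zero_iff] at hc
  rw [BB_re ha hb hab hz]
  have : ‖z‖ ^ 2 ≤ 1 := by nlinarith [norm_nonneg z]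
  exact div_nonneg (div_nonneg (by linarith) (by positivity)) two_pos.le
lemma BB_pos (hz : z ≠ a) (hc : z ∈ cD) : 0 < (BB a b z).re ↔ ‖z‖ < 1 := by
  have h2 : 0 < ‖a - z‖ := norm_pos_iff.2 (sub_ne_zero.2 hz.symm)
  rw [BB_re ha hb hab hz]
  constructor
  · intro h
    by_contra hcon
    push Not at hcon
    have : (1 - ‖z‖ ^ 2) / ‖a - z‖ ^ 2 / 2 ≤ 0 :=
      div_nonpos_of_nonpos_of_nonneg (div_nonpos_of_nonpos_of_nonneg (by nlinarith) (by positivity)) (by norm_num)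
    linarith
  · intro h
    have : ‖z‖ ^ 2 < 1 := by nlinarith [norm_nonneg z]
    exact div_pos (div_pos (by linarith) (by positivity)) two_pos
lemma Bi_BB (hz : z ≠ a) : Bi a b (BB a b z) = z := by
  have h0 := ne0_of_norm ha
  have : 2 * BB a b z + (a + b) / (a - b) = (1 + z / a) / (1 - z / a) := by
    rw [BB_eq ha hab hz, ← cay_div ha]; ring
  rw [Bi, this, cay_inv', mul_div_cancel₀ _ h0]
  rw [Ne, div_eq_one_iff_eq h0]; exact hz
lemma W_re (hY : 0 ≤ Y.re) : 0 ≤ (2 * Y + (a + b) / (a - b)).re := by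
  rw [add_re, re_kap ha hb]; simpa using hY
lemma Bi_ne (hY : 0 ≤ Y.re) : Bi a b Y ≠ a := by
  intro h
  have h0 := ne0_of_norm ha
  exact cay_ne (ne_of_re (W_re ha hb hab hY)) (mul_left_cancel₀ h0 (by rw [mul_one]; exact h))
lemma BB_Bi (hY : 0 ≤ Y.re) : BB a b (Bi a b Y) = Y := by
  have h0 := ne0_of_norm ha
  rw [BB_eq ha hab (Bi_ne ha hb hab hY), cay_div ha]
  have : Bi a b Y / a = (2 * Y + (a + b) / (a - b) - 1) / (2 * Y + (a + b) / (a - b) + 1) := by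
    rw [Bi, mul_div_cancel_left₀ _ h0]
  rw [this, cay_inv (ne_of_re (W_re ha hb hab hY))]; ring
lemma Bi_ne' (hY : 0 ≤ Y.re) (h0 : Y ≠ 0) : Bi a b Y ≠ b := by
  intro h
  have := BB_Bi ha hb hab hY
  rw [h] at this
  apply h0; rw [← this]; simp [BB]
lemma Bi_mem (hY : 0 ≤ Y.re) : Bi a b Y ∈ cD := by
  rw [mem_closedBall_zero_iff, Bi, norm_mul, ha, one_mul]
  exact norm_cayley (W_re ha hb hab hY)
lemma Bi_memD (hY : 0 < Y.re) : Bi a b Y ∈ DD := by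
  rw [mem_ball_zero_iff, ← BB_pos ha hb hab (Bi_ne ha hb hab hY.le) (Bi_mem ha hb hab hY.le), BB_Bi ha hb hab hY.le]
  exact hY
end
def aS (G : ℂ → ℂ) : ℂ := hJ (JS G) 1
def bS (G : ℂ → ℂ) : ℂ := hJ (JS G) (-1)
def Psi (G : ℂ → ℂ) (w : ℂ) : ℂ := Complex.log (BB (aS G) (bS G) (hJ (JS G) (pr (th (cS w))))) / 2
def Phi (G : ℂ → ℂ) (ζ : ℂ) : ℂ := ath (kJ (JS G) (pr (Bi (aS G) (bS G) (exp (2 * cS ζ)))))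
section
variable {G : ℂ → ℂ} (H : Adm (JS G))
lemma c1 : (1:ℂ) ∈ cD := by simp
lemma cm1 : (-1:ℂ) ∈ cD := by simp
include H
lemma naS : ‖aS G‖ = 1 := H.unif.bdry' (by simp)
lemma nbS : ‖bS G‖ = 1 := H.unif.bdry' (by simp)
lemma hinj {z z' : ℂ} (hz : z ∈ cD) (hz' : z' ∈ cD) (h : hJ (JS G) z = hJ (JS G) z') : z = z' := by
  rw [← H.unif.khc z hz, h, H.unif.khc z' hz']
lemma nab : aS G ≠ bS G := fun h => by
  have := hinj H c1 cm1 h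
  norm_num at this
lemma hth_mem (hw : w ∈ St) : hJ (JS G) (th w) ∈ cD := H.unif.hm (th_mem hw)
lemma hth_ne (hw : w ∈ St) : hJ (JS G) (th w) ≠ aS G := fun h => th_ne hw (hinj H (th_mem hw) c1 h)
lemma hth_ne' (hw : w ∈ St) : hJ (JS G) (th w) ≠ bS G := fun h => th_ne' hw (hinj H (th_mem hw) cm1 h)
omit H in
lemma Psi_eq (hw : w ∈ St) : Psi G w = Complex.log (BB (aS G) (bS G) (hJ (JS G) (th w))) / 2 := by
  rw [Psi, cS_eq hw, pr_eq (th_mem hw)]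
omit H in
lemma Psi_cS (w : ℂ) : Psi G (cS w) = Psi G w := by rw [Psi, Psi, cS_eq (cS_mem w)]
lemma BBnn (hw : w ∈ St) : 0 ≤ (BB (aS G) (bS G) (hJ (JS G) (th w))).re :=
  BB_nn (naS H) (nbS H) (nab H) (hth_ne H hw) (hth_mem H hw)
lemma BBne (hw : w ∈ St) : BB (aS G) (bS G) (hJ (JS G) (th w)) ≠ 0 :=
  BB_ne (nbS H) (nab H) (naS H) (hth_ne H hw) (hth_ne' H hw)
lemma exp_Psi (hw : w ∈ St) : exp (2 * Psi G w) = BB (aS G) (bS G) (hJ (JS G) (th w)) := by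
  rw [Psi_eq hw, mul_div_cancel₀ _ two_ne_zero, exp_log (BBne H hw)]
omit H in
lemma half_log_im (z : ℂ) : (Complex.log z / 2).im = z.arg / 2 := by rw [← log_im]; simp
lemma Psi_mem (w : ℂ) : Psi G w ∈ St := by
  rw [← Psi_cS, Psi_eq (cS_mem w)]
  have h := Complex.abs_arg_le_pi_div_two_iff.2 (BBnn H (cS_mem w))
  show |(_ : ℂ).im| ≤ _
  rw [half_log_im, abs_div]
  norm_num; linarith
lemma Psi_bd (hw : w ∈ St) : |(Psi G w).im| < π / 4 ↔ |w.im| < π / 4 := by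
  rw [bdry_th hw, Psi_eq hw, half_log_im, abs_div, abs_two, div_lt_iff₀ two_pos, show π / 4 * 2 = π / 2 by ring,
    Complex.abs_arg_lt_pi_div_two_iff, or_iff_left (BBne H hw), BB_pos (naS H) (nbS H) (nab H) (hth_ne H hw) (hth_mem H hw)]
  constructor
  · intro h
    have := H.unif.kD (by simpa using h)
    rw [H.unif.khc _ (th_mem hw)] at this
    simpa using this
  · intro h
    have := H.unif.hD (x := th w) (by simpa using h)
    simpa using this
lemma Phi_eq {ζ : ℂ} (hz : ζ ∈ St) : Phi G ζ = ath (kJ (JS G) (Bi (aS G) (bS G) (exp (2 * ζ)))) := by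
  rw [Phi, cS_eq hz, pr_eq (Bi_mem (naS H) (nbS H) (nab H) (e2_re hz))]
lemma kBi_ne {ζ : ℂ} (hz : ζ ∈ St) : kJ (JS G) (Bi (aS G) (bS G) (exp (2 * ζ))) ≠ 1 ∧
    kJ (JS G) (Bi (aS G) (bS G) (exp (2 * ζ))) ≠ -1 := by
  have hm := Bi_mem (naS H) (nbS H) (nab H) (e2_re hz)
  have := H.unif.hkc _ hm
  constructor
  · intro h
    rw [h] at this
    exact Bi_ne (naS H) (nbS H) (nab H) (e2_re hz) this.symm
  · intro h
    rw [h] at this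
    exact Bi_ne' (naS H) (nbS H) (nab H) (e2_re hz) (exp_ne_zero _) this.symm
lemma kBi_mem {ζ : ℂ} (hz : ζ ∈ St) : kJ (JS G) (Bi (aS G) (bS G) (exp (2 * ζ))) ∈ cD :=
  H.unif.km (Bi_mem (naS H) (nbS H) (nab H) (e2_re hz))
omit H in
lemma Phi_cS (w : ℂ) : Phi G (cS w) = Phi G w := by rw [Phi, Phi, cS_eq (cS_mem w)]
lemma Phi_mem (w : ℂ) : Phi G w ∈ St := by
  rw [← Phi_cS, Phi_eq H (cS_mem w)]
  exact ath_mem (kBi_mem H (cS_mem w))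
lemma Phi_Psi (hw : w ∈ St) : Phi G (Psi G w) = w := by
  rw [Phi_eq H (Psi_mem H w), exp_Psi H hw, Bi_BB (naS H) (nbS H) (nab H) (hth_ne H hw), H.unif.khc _ (th_mem hw), ath_th hw]
lemma Psi_Phi (hw : w ∈ St) : Psi G (Phi G w) = w := by
  rw [Psi_eq (Phi_mem H w), Phi_eq H hw, th_ath (kBi_ne H hw).1 (kBi_ne H hw).2,
    H.unif.hkc _ (Bi_mem (naS H) (nbS H) (nab H) (e2_re hw)), BB_Bi (naS H) (nbS H) (nab H) (e2_re hw), log_e2 hw]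
  ring
lemma psi_holo (hG : ∀ w ∈ St, |(G w).im| < π) : DifferentiableOn ℂ (fun ζ => G (Phi G ζ)) So := by
  have hpos : ∀ ζ ∈ So, 0 < (exp (2 * ζ)).re := by
    intro ζ hζ
    have h : |ζ.im| < π / 4 := hζ
    rw [abs_lt] at h
    rw [exp_re]
    have : 0 < cos (2 * ζ).im := Real.cos_pos_of_mem_Ioo (by simp; constructor <;> linarith)
    positivity
  set f : ℂ → ℂ := fun ζ => JS G (kJ (JS G) (Bi (aS G) (bS G) (exp (2 * ζ))))
  have hfd : DifferentiableOn ℂ f So := by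
    refine DifferentiableOn.comp (g := JS G ∘ kJ (JS G)) (f := fun ζ => Bi (aS G) (bS G) (exp (2 * ζ))) H.unif.holo ?_
      fun ζ hζ => Bi_memD (naS H) (nbS H) (nab H) (hpos ζ hζ)
    unfold Bi
    refine DifferentiableOn.const_mul (DifferentiableOn.div (by fun_prop) (by fun_prop) fun ζ hζ => ?_) _
    exact ne_of_re (W_re (naS H) (nbS H) (nab H) (hpos ζ hζ).le)
  have hf : ∀ ζ ∈ So, f ζ = TT (G (Phi G ζ)) := fun ζ hζ => by
    rw [Phi_eq H (So_sub hζ)]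
    exact JS_eq _ (kBi_ne H (So_sub hζ)).1 (kBi_ne H (So_sub hζ)).2
  have hE : ∀ ζ ∈ So, (1 + f ζ) / (1 - f ζ) = exp (G (Phi G ζ)) := fun ζ hζ => by
    rw [hf ζ hζ]; exact cay_inv (TT_im (hG _ (Phi_mem H ζ))).2
  have : DifferentiableOn ℂ (fun ζ => Complex.log ((1 + f ζ) / (1 - f ζ))) So := by
    refine DifferentiableOn.clog (DifferentiableOn.div (by fun_prop) (by fun_prop) fun ζ hζ h => ?_) fun ζ hζ => ?_
    · have := hf ζ hζ
      exact cay_ne (TT_im (hG _ (Phi_mem H ζ))).2 ((this.symm.trans (by linear_combination -h)))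
    · rw [hE ζ hζ, Complex.mem_slitPlane_iff_arg, ← log_im, (TT_im (hG _ (Phi_mem H ζ))).1]
      refine ⟨?_, exp_ne_zero _⟩
      have := abs_lt.1 (hG _ (Phi_mem H ζ))
      exact this.2.ne
  refine this.congr fun ζ hζ => ?_
  rw [hE ζ hζ, (TT_im (hG _ (Phi_mem H ζ))).1]
end

lemma ath_cont (hz : z ∈ cD) (h1 : z ≠ 1) (h2 : z ≠ -1) : ContinuousAt ath z := by
  have h5 : ContinuousAt (fun z : ℂ => (1 + z) / (1 - z)) z :=
    (continuousAt_const.add continuousAt_id).div (continuousAt_const.sub continuousAt_id) (sub_ne_zero.2 (Ne.symm h1))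
  exact (h5.clog (slit_of_re (cay_re_nn hz) (cay_ne0 h1 h2))).div_const 2
lemma th_TT (w : ℂ) : th w = TT (2 * w) := rfl
section
set_option linter.unusedSectionVars false
variable {G : X → ℂ → ℂ} (H : GFam G)
include H
lemma aS_cont : Continuous fun x => aS (G x) := by
  have := H.adm.hcont.comp (Continuous.prodMk_left (1:ℂ))
  simpa [comp_def, pr_eq c1, aS] using this
lemma bS_cont : Continuous fun x => bS (G x) := by
  have := H.adm.hcont.comp (Continuous.prodMk_left (-1:ℂ))
  simpa [comp_def, pr_eq cm1, bS] using this
lemma hth_cont : Continuous fun p : X × ℂ => hJ (JS (G p.1)) (pr (th (cS p.2))) := by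
  have h1 : Continuous fun w => th (cS w) := by
    have := cS_cont
    unfold th
    exact Continuous.div (by fun_prop) (by fun_prop) fun w => ne_of_re (e2_re (cS_mem w))
  exact H.adm.hcont.comp (continuous_fst.prodMk (h1.comp continuous_snd))
lemma Psi_cont : Continuous fun p : X × ℂ => Psi (G p.1) p.2 := by
  have h1 := hth_cont H
  have h2 := (aS_cont H).comp (continuous_fst : Continuous (Prod.fst : X × ℂ → X))
  have h3 := (bS_cont H).comp (continuous_fst : Continuous (Prod.fst : X × ℂ → X))
  simp only [comp_def] at h2 h3
  unfold Psi
  refine Continuous.div_const (Continuous.clog ?_ fun p => ?_) 2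
  · unfold BB
    refine (h2.mul (h1.sub h3)).div ((h2.sub h3).mul (h2.sub h1)) fun p => ?_
    rw [pr_eq (th_mem (cS_mem _))]
    exact mul_ne_zero (sub_ne_zero.2 (nab (H.adm.adm p.1))) (sub_ne_zero.2 (hth_ne (H.adm.adm p.1) (cS_mem _)).symm)
  · rw [pr_eq (th_mem (cS_mem _))]
    exact slit_of_re (BBnn (H.adm.adm p.1) (cS_mem _)) (BBne (H.adm.adm p.1) (cS_mem _))
lemma Phi_cont : Continuous fun p : X × ℂ => Phi (G p.1) p.2 := by
  have h2 := (aS_cont H).comp (continuous_fst : Continuous (Prod.fst : X × ℂ → X))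
  have h3 := (bS_cont H).comp (continuous_fst : Continuous (Prod.fst : X × ℂ → X))
  simp only [comp_def] at h2 h3
  have h4 : Continuous fun p : X × ℂ => exp (2 * cS p.2) := by have := cS_cont; fun_prop
  have h5 : Continuous fun p : X × ℂ => 2 * exp (2 * cS p.2) + (aS (G p.1) + bS (G p.1)) / (aS (G p.1) - bS (G p.1)) :=
    (h4.const_mul 2).add ((h2.add h3).div (h2.sub h3) fun p => sub_ne_zero.2 (nab (H.adm.adm p.1)))
  have h6 : Continuous fun p : X × ℂ => Bi (aS (G p.1)) (bS (G p.1)) (exp (2 * cS p.2)) :=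
    h2.mul ((h5.sub continuous_const).div (h5.add continuous_const) fun p =>
      ne_of_re (W_re (naS (H.adm.adm p.1)) (nbS (H.adm.adm p.1)) (nab (H.adm.adm p.1)) (e2_re (cS_mem p.2))))
  have h7 := H.adm.kcont.comp (continuous_fst.prodMk h6)
  rw [continuous_iff_continuousAt]
  intro p
  have hA := H.adm.adm p.1
  refine ContinuousAt.comp (g := ath) (f := fun p : X × ℂ => kJ (JS (G p.1)) (pr (Bi (aS (G p.1)) (bS (G p.1)) (exp (2 * cS p.2)))))
    ?_ h7.continuousAt
  rw [pr_eq (Bi_mem (naS hA) (nbS hA) (nab hA) (e2_re (cS_mem _)))]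
  exact ath_cont (kBi_mem hA (cS_mem _)) (kBi_ne hA (cS_mem _)).1 (kBi_ne hA (cS_mem _)).2
lemma Psi_re {x : X} : (Psi (G x) w).re = log ‖BB (aS (G x)) (bS (G x)) (hJ (JS (G x)) (pr (th (cS w))))‖ / 2 := by
  rw [Psi, ← log_re]; simp
lemma BBth_ne (x : X) (w : ℂ) : 0 < ‖BB (aS (G x)) (bS (G x)) (hJ (JS (G x)) (pr (th (cS w))))‖ := by
  rw [pr_eq (th_mem (cS_mem _))]
  exact norm_pos_iff.2 (BBne (H.adm.adm x) (cS_mem _))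
lemma th_near (hU : U ∈ 𝓝 (1:ℂ)) : ∃ T : ℝ, ∀ w : ℂ, T ≤ w.re → th w ∈ U := by
  have := TT_top hU
  rw [mem_map, mem_comap] at this
  obtain ⟨t, ht, h2⟩ := this
  obtain ⟨T, hT⟩ := mem_atTop_sets.1 ht
  refine ⟨|T|, fun w hw => h2 (hT _ ?_)⟩
  simp
  linarith [le_abs_self T, abs_nonneg T]
lemma th_near' (hU : U ∈ 𝓝 (-1:ℂ)) : ∃ T : ℝ, ∀ w : ℂ, w.re ≤ T → th w ∈ U := by
  have := TT_bot hU
  rw [mem_map, mem_comap] at this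
  obtain ⟨t, ht, h2⟩ := this
  obtain ⟨T, hT⟩ := mem_atBot_sets.1 ht
  refine ⟨-|T|, fun w hw => h2 (hT _ ?_)⟩
  simp
  linarith [neg_abs_le T, abs_nonneg T]
lemma Psi_top (x0 : X) (M : ℝ) : ∃ T : ℝ, ∀ᶠ x in 𝓝 x0, ∀ w, T ≤ w.re → M ≤ (Psi (G x) w).re := by
  have hA := H.adm.adm x0
  have h1 : ContinuousAt (fun p : X × ℂ => ‖(BB (aS (G p.1)) (bS (G p.1)) (hJ (JS (G p.1)) (pr p.2)))⁻¹‖) (x0, 1) := by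
    have h1 := H.adm.hcont.continuousAt (x := ((x0, 1) : X × ℂ))
    have h2 := ((aS_cont H).comp (continuous_fst : Continuous (Prod.fst : X × ℂ → X))).continuousAt (x := ((x0, 1) : X × ℂ))
    have h3 := ((bS_cont H).comp (continuous_fst : Continuous (Prod.fst : X × ℂ → X))).continuousAt (x := ((x0, 1) : X × ℂ))
    simp only [comp_def] at h2 h3
    simp only [BB, inv_div]
    refine (((h2.sub h3).mul (h2.sub h1)).div (h2.mul (h1.sub h3)) ?_).norm
    simp only [Pi.mul_apply, Pi.sub_apply, pr_eq c1]
    exact mul_ne_zero (ne0_of_norm (naS hA)) (sub_ne_zero.2 (nab hA))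
  have h2 : (fun p : X × ℂ => ‖(BB (aS (G p.1)) (bS (G p.1)) (hJ (JS (G p.1)) (pr p.2)))⁻¹‖) (x0, 1) = 0 := by
    simp only [pr_eq c1]
    rw [show hJ (JS (G x0)) 1 = aS (G x0) from rfl]
    simp [BB]
  have h3 := h1.tendsto
  simp only at h2 h3
  rw [h2] at h3
  have h4 := h3.eventually_lt_const (exp_pos (-(2 * M)))
  rw [nhds_prod_eq] at h4
  obtain ⟨pa, hpa, pb, hpb, hab⟩ := eventually_prod_iff.1 h4
  obtain ⟨T, hT⟩ := th_near H hpb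
  refine ⟨T, hpa.mono fun x hx w hw => ?_⟩
  have h5 := hab hx (hT (cS w) (by rw [cS_re]; exact hw))
  have h6 := BBth_ne H x w
  simp only [norm_inv] at h5
  rw [exp_neg, inv_lt_inv₀ h6 (exp_pos _)] at h5
  rw [Psi_re H, le_div_iff₀ two_pos, mul_comm, Real.le_log_iff_exp_le h6]
  exact h5.le
lemma Psi_bot (x0 : X) (M : ℝ) : ∃ T : ℝ, ∀ᶠ x in 𝓝 x0, ∀ w, w.re ≤ T → (Psi (G x) w).re ≤ M := by
  have hA := H.adm.adm x0
  have h1 : ContinuousAt (fun p : X × ℂ => ‖(BB (aS (G p.1)) (bS (G p.1)) (hJ (JS (G p.1)) (pr p.2)))‖) (x0, -1) := by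
    have h1 := H.adm.hcont.continuousAt (x := ((x0, -1) : X × ℂ))
    have h2 := ((aS_cont H).comp (continuous_fst : Continuous (Prod.fst : X × ℂ → X))).continuousAt (x := ((x0, -1) : X × ℂ))
    have h3 := ((bS_cont H).comp (continuous_fst : Continuous (Prod.fst : X × ℂ → X))).continuousAt (x := ((x0, -1) : X × ℂ))
    simp only [comp_def] at h2 h3
    simp only [BB]
    refine ((h2.mul (h1.sub h3)).div ((h2.sub h3).mul (h2.sub h1)) ?_).norm
    simp only [Pi.mul_apply, Pi.sub_apply, pr_eq cm1]
    exact mul_ne_zero (sub_ne_zero.2 (nab hA)) (sub_ne_zero.2 (nab hA))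
  have h2 : (fun p : X × ℂ => ‖(BB (aS (G p.1)) (bS (G p.1)) (hJ (JS (G p.1)) (pr p.2)))‖) (x0, -1) = 0 := by
    simp only [pr_eq cm1]
    rw [show hJ (JS (G x0)) (-1) = bS (G x0) from rfl]
    simp [BB]
  have h3 := h1.tendsto
  simp only at h2 h3
  rw [h2] at h3
  have h4 := h3.eventually_lt_const (exp_pos (2 * M))
  rw [nhds_prod_eq] at h4
  obtain ⟨pa, hpa, pb, hpb, hab⟩ := eventually_prod_iff.1 h4
  obtain ⟨T, hT⟩ := th_near' H hpb
  refine ⟨T, hpa.mono fun x hx w hw => ?_⟩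
  have h5 := hab hx (hT (cS w) (by rw [cS_re]; exact hw))
  have h6 := BBth_ne H x w
  rw [Psi_re H, div_le_iff₀ two_pos, mul_comm, Real.log_le_iff_le_exp h6]
  exact h5.le
end
lemma St_box (T0 M : ℝ) : ∃ K : Set ℂ, IsCompact K ∧ ∀ w ∈ St, T0 ≤ w.re → w.re ≤ M → w ∈ K := by
  refine ⟨closedBall 0 (|T0| + |M| + π / 4), isCompact_closedBall _ _, fun w hw h1 h2 => ?_⟩
  rw [mem_closedBall_zero_iff]
  have hw : |w.im| ≤ π / 4 := hw
  refine (norm_le_abs_re_add_abs_im w).trans (add_le_add ?_ hw)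
  rw [abs_le]
  constructor <;> linarith [neg_abs_le T0, le_abs_self M, abs_nonneg T0, abs_nonneg M]
lemma top_of_inv {P Q : X → ℂ → ℂ} (hP : Continuous fun p : X × ℂ => P p.1 p.2) (hQ : ∀ x w, Q x w ∈ St)
    (hPQ : ∀ x w, (P x (Q x w)).re = w.re) (x0 : X) (M T0 : ℝ)
    (hT0 : ∀ᶠ x in 𝓝 x0, ∀ w : ℂ, w.re ≤ T0 → (P x w).re ≤ 0) :
    ∃ T : ℝ, ∀ᶠ x in 𝓝 x0, ∀ w : ℂ, T ≤ w.re → M ≤ (Q x w).re := by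
  obtain ⟨K, hK, hK2⟩ := St_box T0 M
  have hcx : Continuous (P x0) := hP.comp (Continuous.prodMk_right x0)
  obtain ⟨C, hC⟩ := hK.exists_bound_of_continuousOn hcx.continuousOn
  refine ⟨max (C + 1) 0 + 1, ?_⟩
  filter_upwards [hT0, unif_near (f := P) hK hP x0 one_pos] with x h1 h2 w hw
  have hw1 := le_max_left (C + 1) 0
  have hw2 := le_max_right (C + 1) 0
  by_contra! hcon
  have hre := hPQ x w
  rcases le_total (Q x w).re T0 with h | h
  · have := h1 _ h; linarith
  · have hvK := hK2 _ (hQ x w) h hcon.le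
    have h3 := h2 _ hvK
    have h4 := hC _ hvK
    have h5 := re_le_norm (P x (Q x w))
    have h6 := norm_sub_norm_le (P x (Q x w)) (P x0 (Q x w))
    linarith
lemma Phi_top (H : GFam G) (x0 : X) (M : ℝ) :
    ∃ T : ℝ, ∀ᶠ x in 𝓝 x0, ∀ w, T ≤ w.re → M ≤ (Phi (G x) w).re := by
  obtain ⟨T0, hT0⟩ := Psi_bot H x0 0
  refine top_of_inv (P := fun x => Psi (G x)) (Psi_cont H) (fun x w => Phi_mem (H.adm.adm x) w) (fun x w => ?_) x0 M T0 hT0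
  have := Psi_Phi (H.adm.adm x) (cS_mem w)
  rw [Phi_cS] at this
  rw [this, cS_re]

lemma zero_So : (0:ℂ) ∈ So := by
  show |(0:ℂ).im| < _
  simp [pi_pos]
lemma real_So (x : ℝ) : (x:ℂ) ∈ So := by
  show |(x:ℂ).im| < _
  simp [pi_pos]
lemma conv_So : Convex ℝ So := by
  have h1 : So = Complex.imCLM ⁻¹' (Ioo (-(π/4)) (π/4)) := by
    ext w; show |w.im| < _ ↔ _
    rw [abs_lt]; rfl
  rw [h1]
  exact (convex_Ioo _ _).is_linear_preimage Complex.imCLM.isLinear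
lemma dense_So {A B : ℂ → ℂ} (hA : ContinuousOn A St) (hB : ContinuousOn B St) (h : EqOn A B So) : EqOn A B St := by
  intro w hw
  have h : |w.im| ≤ π / 4 := hw
  have hcl : w ∈ closure So := by
    rw [show So = Complex.im ⁻¹' (Ioo (-(π/4)) (π/4)) by
      ext w; show |w.im| < _ ↔ _
      rw [abs_lt]; rfl, Complex.closure_preimage_im, closure_Ioo (by linarith [pi_pos])]
    exact abs_le.1 h
  have := mem_closure_iff_nhdsWithin_neBot.1 hcl
  have h1 := (hA w hw).mono_left (nhdsWithin_mono w So_sub)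
  have h2 := (hB w hw).mono_left (nhdsWithin_mono w So_sub)
  exact tendsto_nhds_unique (h1.congr' (by filter_upwards [self_mem_nhdsWithin] with z hz using (by assumption : EqOn A B So) hz)) h2
lemma const_of_im {χ : ℂ → ℂ} (hd : DifferentiableOn ℂ χ So) (h : ∀ w ∈ So, (χ w).im = 0) : ∃ r : ℝ, ∀ w ∈ So, χ w = r := by
  rcases (hd.analyticOnNhd So_open).is_constant_or_isOpen conv_So.isPreconnected with ⟨c, hc⟩ | h1
  · refine ⟨c.re, fun w hw => ?_⟩
    have := h w hw
    rw [hc w hw] at this ⊢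
    exact cxt (by simp) (by simp [this])
  · exfalso
    obtain ⟨ε, hε, hb⟩ := Metric.isOpen_iff.1 (h1 So subset_rfl So_open) (χ 0) (mem_image_of_mem _ zero_So)
    obtain ⟨w, hw, hwe⟩ := hb (show χ 0 + (ε/2 : ℝ) * 𝕚 ∈ ball (χ 0) ε by
      rw [mem_ball, dist_eq_norm, add_sub_cancel_left, norm_mul, Complex.norm_I, norm_real, norm_of_nonneg (by linarith)]
      linarith)
    have := h w hw
    rw [hwe] at this
    have h0 := h 0 zero_So
    simp [h0] at this
    linarith
lemma slice {P : X → ℂ → ℂ} (h : Continuous fun p : X × ℂ => P p.1 p.2) (x : X) : Continuous (P x) :=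
  h.comp (Continuous.prodMk_right x)
section
set_option linter.unusedSectionVars false
variable {G : X → ℂ → ℂ} (H : GFam G) (x : X)
include H
lemma GFam.im (w : ℂ) : |(G x w).im - w.im| ≤ 1 / 20 := by
  rw [← sub_im]; exact (abs_im_le_norm _).trans (H.disp x w)
lemma psi_diff : DifferentiableOn ℂ (fun ζ => G x (Phi (G x) ζ)) So := psi_holo (H.adm.adm x) fun w hw => H.im_lt x hw
lemma Psi_c1 : Continuous (Psi (G x)) := slice (P := fun x => Psi (G x)) (Psi_cont H) x
lemma Phi_c1 : Continuous (Phi (G x)) := slice (P := fun x => Phi (G x)) (Phi_cont H) x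
lemma psi_c1 : Continuous fun ζ => G x (Phi (G x) ζ) := (slice H.cont x).comp (Phi_c1 H x)
lemma psi_aux (e : ℝ) (he : |e| = 1) (hb : ∀ ζ : ℂ, |ζ.im| = π / 4 → (Phi (G x) ζ).im = e * ζ.im) :
    (∀ ζ ∈ So, |(G x (Phi (G x) ζ)).im - e * ζ.im| ≤ 1 / 20) ∧
      ∀ a b : ℝ, a < b → e * (G x (Phi (G x) a)).re < e * (G x (Phi (G x) b)).re := by
  have hpi := pi_gt_three
  have hpi' := Real.pi_lt_four
  have hee : e * e = 1 := by rw [← abs_mul_abs_self, he, one_mul]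
  have hd : DifferentiableOn ℂ (fun ζ => G x (Phi (G x) ζ) - e * ζ) So := (psi_diff H x).sub (by fun_prop)
  have hi : ∀ ζ : ℂ, (G x (Phi (G x) ζ) - e * ζ).im = (G x (Phi (G x) ζ)).im - e * ζ.im := by intro ζ; simp
  have h1 : ∀ ζ ∈ So, |(G x (Phi (G x) ζ) - e * ζ).im| ≤ 1 / 20 := by
    refine im_bound hd ((psi_c1 H x).sub (by fun_prop)).continuousOn (M := 10) (fun w hw => ?_) (fun w hw => ?_)
    · rw [hi]
      have h2 := H.im_lt x (Phi_mem (H.adm.adm x) w)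
      have h3 : |w.im| < π / 4 := hw
      have h4 := abs_sub (G x (Phi (G x) w)).im (e * w.im)
      rw [abs_mul, he, one_mul] at h4
      linarith
    · rw [hi, ← hb w hw]; exact H.im x _
  refine ⟨fun ζ hζ => by rw [← hi]; exact h1 ζ hζ, fun a b hab => ?_⟩
  have h2 := deriv_bound hd h1
  have hm : StrictMono fun t : ℝ => e * (G x (Phi (G x) t)).re := by
    apply strictMono_of_deriv_pos
    intro t
    have h3 := (hd.differentiableAt (So_open.mem_nhds (real_So t))).hasDerivAt
    have h4 : HasDerivAt (fun t : ℝ => e * (G x (Phi (G x) t) - e * t).re + t) (e * (deriv (fun ζ => G x (Phi (G x) ζ) - e * ζ) t).re + 1) t :=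
      ((h3.real_of_complex).const_mul e).add (hasDerivAt_id t)
    have h5 : (fun t : ℝ => e * (G x (Phi (G x) t) - e * t).re + t) = fun t : ℝ => e * (G x (Phi (G x) t)).re := by
      ext t; simp only [sub_re, Complex.re_ofReal_mul, ofReal_re]
      linear_combination (-t) * hee
    rw [h5] at h4
    rw [h4.deriv]
    have h6 := (abs_re_le_norm _).trans_lt (h2 t)
    have h7 : |e * (deriv (fun ζ => G x (Phi (G x) ζ) - e * ζ) t).re| < 1 := by rw [abs_mul, he, one_mul]; exact h6
    linarith [(abs_lt.1 h7).1]
  exact hm hab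
lemma Psi_abs (hw : |w.im| = π / 4) : |(Psi (G x) w).im| = π / 4 := by
  have h1 : |(Psi (G x) w).im| ≤ _ := Psi_mem (H.adm.adm x) w
  refine le_antisymm h1 (not_lt.1 fun h => ?_)
  have := (Psi_bd (H.adm.adm x) (w := w) hw.le).1 h
  linarith
lemma Phi_abs (hw : |w.im| = π / 4) : |(Phi (G x) w).im| = π / 4 := by
  have h1 : |(Phi (G x) w).im| ≤ _ := Phi_mem (H.adm.adm x) w
  refine le_antisymm h1 (not_lt.1 fun h => ?_)
  have := (Psi_bd (H.adm.adm x) (Phi_mem (H.adm.adm x) w)).2 h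
  rw [Psi_Phi (H.adm.adm x) hw.le] at this
  linarith
omit H in
lemma line_sign {P : ℂ → ℂ} (hP : Continuous P) (y : ℝ) (h : ∀ w : ℂ, w.im = y → |(P w).im| = π / 4) :
    ∃ e : ℝ, |e| = 1 ∧ ∀ w : ℂ, w.im = y → (P w).im = e * (π / 4) := by
  have hpi := pi_pos
  have hc : Continuous fun t : ℝ => (P (t + y * 𝕚)).im := by fun_prop
  have h0 : ∀ t : ℝ, |(P (t + y * 𝕚)).im| = π / 4 := fun t => h _ (by simp)
  have hw : ∀ w : ℂ, w.im = y → w = (w.re:ℂ) + y * 𝕚 := fun w hw => by rw [← hw, re_add_im]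
  have hne : ∀ t : ℝ, (P (t + y * 𝕚)).im ≠ 0 := fun t ht => by
    have := h0 t; rw [ht, abs_zero] at this; linarith
  have key : ∀ s t : ℝ, 0 < (P (s + y * 𝕚)).im → (P (t + y * 𝕚)).im < 0 → False := by
    intro s t hs ht
    obtain ⟨u, hu⟩ := mem_range_of_exists_le_of_exists_ge hc ⟨t, ht.le⟩ ⟨s, hs.le⟩
    exact hne u hu
  rcases lt_or_gt_of_ne (hne 0) with h1 | h1
  · refine ⟨-1, by simp, fun w hwy => ?_⟩
    have h2 := h w hwy
    rw [hw w hwy] at h2 ⊢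
    rcases lt_or_gt_of_ne (hne w.re) with h3 | h3
    · rw [abs_of_neg h3] at h2; linarith
    · exact (key _ _ h3 h1).elim
  · refine ⟨1, by simp, fun w hwy => ?_⟩
    have h2 := h w hwy
    rw [hw w hwy] at h2 ⊢
    rcases lt_or_gt_of_ne (hne w.re) with h3 | h3
    · exact (key _ _ h1 h3).elim
    · rw [abs_of_pos h3] at h2; linarith
lemma Phi_orient (hw : |w.im| = π / 4) : (Phi (G x) w).im = w.im := by
  have hpi := pi_pos
  have hA := H.adm.adm x
  have habs : ∀ {y : ℝ}, |y| = π / 4 → y = π / 4 ∨ y = -(π/4) := fun h => (abs_eq (by linarith)).1 h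
  have habs' : ∀ {y : ℝ}, |y| = 1 → y = 1 ∨ y = -1 := fun h => (abs_eq (by linarith)).1 h
  obtain ⟨e, he, h1⟩ := line_sign (Phi_c1 H x) (π/4) fun w hw => Phi_abs H x (by rw [hw, abs_of_pos (by linarith)])
  obtain ⟨e', he', h2⟩ := line_sign (Phi_c1 H x) (-(π/4)) fun w hw => Phi_abs H x (by rw [hw, abs_neg, abs_of_pos (by linarith)])
  have hee : e' = -e := by
    by_contra hne
    have : e' = e := by
      rcases habs' he with h | h <;> rcases habs' he' with h' | h' <;> rw [h, h'] at hne ⊢ <;> norm_num at hne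
    subst this
    have h3 : ∀ w : ℂ, |w.im| = π/4 → (Phi (G x) w).im = e' * (π/4) := fun w hw => (habs hw).elim (h1 w) (h2 w)
    have hmm : |(-(e' * (π/4) : ℝ) * 𝕚 : ℂ).im| = π/4 := by
      simp [abs_mul, he', hpi.le]; try positivity
    have h4 := Phi_Psi hA (w := (-(e' * (π/4) : ℝ) * 𝕚 : ℂ)) hmm.le
    have h5 := h3 _ (Psi_abs H x hmm)
    rw [h4] at h5
    simp at h5
    rcases habs' he with h | h <;> rw [h] at h5 <;> linarith
  have hb : ∀ ζ : ℂ, |ζ.im| = π / 4 → (Phi (G x) ζ).im = e * ζ.im := by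
    intro ζ hζ
    rcases habs hζ with h | h
    · rw [h1 ζ h, h]
    · rw [h2 ζ h, h, hee]; ring
  have h3 := (psi_aux H x e he hb).2
  rcases habs' he with h | h
  · rw [hb w hw, h, one_mul]
  · exfalso
    obtain ⟨T, hT⟩ := Phi_top H x ((G x (Phi (G x) (0:ℝ))).re + 1)
    have h4 := hT.self_of_nhds (max T 1 : ℝ) (by simp)
    have h5 := h3 0 (max T 1) (by simp)
    rw [h] at h5
    have h6 := H.re x (Phi (G x) (max T 1 : ℝ))
    rw [abs_le] at h6
    linarith [h6.1]
lemma Psi_orient (hw : |w.im| = π / 4) : (Psi (G x) w).im = w.im := by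
  have := Phi_orient H x (Psi_abs H x hw)
  rw [Phi_Psi (H.adm.adm x) hw.le] at this
  exact this.symm
lemma psi_im {ζ : ℂ} (hζ : ζ ∈ So) : |(G x (Phi (G x) ζ)).im - ζ.im| ≤ 1 / 20 := by
  have := (psi_aux H x 1 (by simp) fun ζ h => by rw [one_mul]; exact Phi_orient H x h).1 ζ hζ
  simpa using this
lemma psi_mono : StrictMono fun t : ℝ => (G x (Phi (G x) t)).re := fun a b h => by
  have := (psi_aux H x 1 (by simp) fun ζ h => by rw [one_mul]; exact Phi_orient H x h).2 a b h
  simpa using this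
lemma Psi_So (hw : w ∈ So) : Psi (G x) w ∈ So := (Psi_bd (H.adm.adm x) (So_sub hw)).2 hw
lemma Phi_So (hw : w ∈ So) : Phi (G x) w ∈ So := by
  refine (Psi_bd (H.adm.adm x) (Phi_mem (H.adm.adm x) w)).1 ?_
  rw [Psi_Phi (H.adm.adm x) (So_sub hw)]
  exact hw
lemma psi_inj : InjOn (fun ζ => G x (Phi (G x) ζ)) St := by
  intro a ha b hb h
  have := (H.homeo x).injective h
  rw [← Psi_Phi (H.adm.adm x) ha, this, Psi_Phi (H.adm.adm x) hb]
lemma strip_unique {A : ℂ → ℂ} (hA : Continuous A) (hAo : MapsTo A So So)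
    (hAb : ∀ w : ℂ, |w.im| = π / 4 → (A w).im = w.im) (hd : DifferentiableOn ℂ (fun ζ => G x (A ζ)) So) :
    ∃ r : ℝ, ∀ ζ ∈ St, Psi (G x) (A ζ) = ζ + r := by
  have hT : DifferentiableOn ℂ (fun ζ => Psi (G x) (A ζ)) So := by
    refine inj_inv_holo So_open (psi_diff H x) ((psi_inj H x).mono So_sub) So_open (fun ζ hζ => Psi_So H x (hAo hζ)) (fun ζ hζ => ?_) hd
    rw [Phi_Psi (H.adm.adm x) (So_sub (hAo hζ))]
  have hc : Continuous fun ζ => Psi (G x) (A ζ) := (Psi_c1 H x).comp hA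
  have h1 : ∀ ζ ∈ So, |(Psi (G x) (A ζ) - ζ).im| ≤ 0 := by
    refine im_bound (M := π) (hT.sub differentiableOn_id) (hc.sub continuous_id).continuousOn (fun w hw => ?_) (fun w hw => ?_)
    · have h2 : |(Psi (G x) (A w)).im| ≤ π / 4 := Psi_mem (H.adm.adm x) _
      have h3 : |w.im| < π / 4 := hw
      have := abs_sub (Psi (G x) (A w)).im w.im
      rw [Pi.sub_apply, sub_im, id]; linarith [pi_pos]
    · rw [Pi.sub_apply, sub_im, id, Psi_orient H x (by rw [hAb w hw, hw]), hAb w hw, sub_self, abs_zero]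
  obtain ⟨r, hr⟩ := const_of_im (hT.sub differentiableOn_id) fun w hw => abs_nonpos_iff.1 (h1 w hw)
  refine ⟨r, dense_So hc.continuousOn (by fun_prop) fun ζ hζ => ?_⟩
  have := hr ζ hζ
  simp only [Pi.sub_apply, id] at this
  rw [← this]; ring
end

def nn (z : ℂ) : ℂ := -conj z
lemma nn_re (z : ℂ) : (nn z).re = -z.re := by simp [nn]
lemma nn_im (z : ℂ) : (nn z).im = z.im := by simp [nn]
lemma nn_nn (z : ℂ) : nn (nn z) = z := by simp [nn]
lemma nn_cont : Continuous nn := by unfold nn; exact Complex.continuous_conj.neg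
lemma nn_St : nn z ∈ St ↔ z ∈ St := by show |(nn z).im| ≤ _ ↔ |z.im| ≤ _; rw [nn_im]
lemma nn_So : nn z ∈ So ↔ z ∈ So := by show |(nn z).im| < _ ↔ |z.im| < _; rw [nn_im]
lemma nn_add (z : ℂ) (c : ℝ) : nn (z + c * 𝕚) = nn z + c * 𝕚 := by simp [nn]; ring
lemma nn_holo {ψ : ℂ → ℂ} (h : DifferentiableOn ℂ ψ So) : DifferentiableOn ℂ (fun z => nn (ψ (nn z))) So := by
  intro z hz
  have h1 := h.differentiableAt (So_open.mem_nhds (nn_So.2 hz))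
  have h2 : DifferentiableAt ℂ (fun u => ψ (-u)) (conj z) := by
    refine DifferentiableAt.comp (conj z) (f := fun u : ℂ => -u) ?_ (by fun_prop)
    exact h1
  have h3 := h2.conj_conj
  rw [Complex.conj_conj] at h3
  exact h3.neg.differentiableWithinAt
lemma strip_nsym (H : GFam G) {x y : X} (hn : ∀ w, G y (nn w) = nn (G x w)) {w : ℂ} (hw : w ∈ St) {c : ℝ}
    (hc : Psi (G x) w + c * 𝕚 ∈ St) :
    Phi (G y) (Psi (G y) (nn w) + c * 𝕚) = nn (Phi (G x) (Psi (G x) w + c * 𝕚)) := by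
  have hA := H.adm.adm x
  obtain ⟨r, hr⟩ := strip_unique H y (A := fun ζ => nn (Phi (G x) (nn ζ))) (nn_cont.comp ((Phi_c1 H x).comp nn_cont))
    (fun ζ hζ => nn_So.2 (Phi_So H x (nn_So.2 hζ))) (fun ζ h => by rw [nn_im, Phi_orient H x (by rwa [nn_im]), nn_im])
    (by simp only [hn]; exact nn_holo (psi_diff H x))
  have h1 := hr (nn (Psi (G x) w)) (nn_St.2 (Psi_mem hA w))
  simp only [nn_nn] at h1
  rw [Phi_Psi hA hw] at h1
  have h2 := hr (nn (Psi (G x) w + c * 𝕚)) (nn_St.2 hc)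
  simp only [nn_nn] at h2
  rw [h1, show nn (Psi (G x) w) + r + c * 𝕚 = nn (Psi (G x) w + c * 𝕚) + r by rw [nn_add]; ring, ← h2,
    Phi_Psi (H.adm.adm y) (nn_St.2 (Phi_mem hA _))]
lemma strip_id (H : GFam G) {x : X} (hn : ∀ w, G x w = w) {w : ℂ} (hw : w ∈ St) {c : ℝ} (hc : w + c * 𝕚 ∈ St) :
    Phi (G x) (Psi (G x) w + c * 𝕚) = w + c * 𝕚 := by
  obtain ⟨r, hr⟩ := strip_unique H x (A := fun ζ => ζ) continuous_id (fun ζ hζ => hζ) (fun ζ h => rfl)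
    (by simp only [hn]; exact differentiableOn_id)
  rw [hr w hw, show w + r + c * 𝕚 = w + c * 𝕚 + r by ring, ← hr _ hc, Phi_Psi (H.adm.adm x) hc]
/-! families -/
def Gam (w : ℂ) : ℂ := nn w + π * 𝕚
lemma Gam_re (w : ℂ) : (Gam w).re = -w.re := by simp [Gam, nn_re]
lemma Gam_im (w : ℂ) : (Gam w).im = w.im + π := by simp [Gam, nn_im]
lemma Gam_Gam (w : ℂ) : Gam (Gam w) = w + 2 * π * 𝕚 := by
  apply cxt <;> simp [Gam_re, Gam_im] <;> ring
lemma Gam_cont : Continuous Gam := by unfold Gam; exact nn_cont.add continuous_const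
def Gai (w : ℂ) : ℂ := nn w - π * 𝕚
lemma Gai_re (w : ℂ) : (Gai w).re = -w.re := by simp [Gai, nn_re]
lemma Gai_im (w : ℂ) : (Gai w).im = w.im - π := by simp [Gai, nn_im]
lemma Gam_Gai (w : ℂ) : Gam (Gai w) = w := by
  apply cxt <;> simp [Gam_re, Gam_im, Gai_re, Gai_im]
lemma Gai_Gam (w : ℂ) : Gai (Gam w) = w := by
  apply cxt <;> simp [Gam_re, Gam_im, Gai_re, Gai_im]
lemma Gai_cont : Continuous Gai := by unfold Gai; exact nn_cont.sub continuous_const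
structure Fam (F : X → ℂ → ℂ) : Prop where
  cont : Continuous fun p : X × ℂ => F p.1 p.2
  gam : ∀ x w, F x (Gam w) = Gam (F x w)
  bij : ∀ x, Bijective (F x)
  ends : ∀ x0 M, ∃ T : ℝ, ∀ᶠ x in 𝓝 x0, ∀ w : ℂ, T ≤ w.re → M ≤ (F x w).re
lemma per_of_gam {F : ℂ → ℂ} (h : ∀ w, F (Gam w) = Gam (F w)) (w : ℂ) (n : ℤ) :
    F (w + n * (2 * π * 𝕚)) = F w + n * (2 * π * 𝕚) := by
  have h1 : ∀ w, F (w + 2 * π * 𝕚) = F w + 2 * π * 𝕚 := fun w => by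
    rw [← Gam_Gam, h, h, Gam_Gam]
  induction n using Int.induction_on with
  | zero => simp
  | succ n ih =>
    push_cast at ih ⊢
    rw [add_mul, ← add_assoc, one_mul, h1, ih]; ring
  | pred n ih =>
    push_cast at ih ⊢
    have := h1 (w + (-n - 1) * (2 * π * 𝕚))
    rw [show w + (-(n:ℂ) - 1) * (2 * π * 𝕚) + 2 * π * 𝕚 = w + -n * (2 * π * 𝕚) by ring, ih] at this
    linear_combination -this
lemma Fam.ends' (H : Fam F) (x0 : X) (M : ℝ) : ∃ T : ℝ, ∀ᶠ x in 𝓝 x0, ∀ w : ℂ, w.re ≤ T → (F x w).re ≤ M := by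
  obtain ⟨T, hT⟩ := H.ends x0 (-M)
  refine ⟨-T, hT.mono fun x hx w hw => ?_⟩
  have := hx (Gam w) (by rw [Gam_re]; linarith)
  rw [H.gam, Gam_re] at this
  linarith
lemma red_im (w : ℂ) : ∃ n : ℤ, ∃ v : ℂ, v.re = w.re ∧ v.im ∈ Icc 0 (2 * π) ∧ w = v + n * (2 * π * 𝕚) := by
  have h := Int.fract_nonneg (w.im / (2 * π))
  have h' := (Int.fract_lt_one (w.im / (2 * π))).le
  have hp := Real.two_pi_pos
  refine ⟨⌊w.im / (2 * π)⌋, w - ⌊w.im / (2 * π)⌋ * (2 * π * 𝕚), by simp, ?_, by ring⟩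
  have : (w - ⌊w.im / (2 * π)⌋ * (2 * π * 𝕚)).im = Int.fract (w.im / (2 * π)) * (2 * π) := by
    rw [Int.fract, sub_mul, div_mul_cancel₀ _ hp.ne']; simp
  rw [this]
  exact ⟨by positivity, by nlinarith⟩
lemma ends_of_slices (hg : ∀ x w, F x (Gam w) = Gam (F x w))
    (h : ∀ x0 s0 M, ∃ T : ℝ, ∀ᶠ p : X × ℝ in 𝓝 (x0, s0), ∀ w : ℂ, w.im = p.2 → T ≤ w.re → M ≤ (F p.1 w).re) :
    ∀ x0 M, ∃ T : ℝ, ∀ᶠ x in 𝓝 x0, ∀ w : ℂ, T ≤ w.re → M ≤ (F x w).re := by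
  intro x0 M
  have key : ∃ T : ℝ, ∀ᶠ x in 𝓝 x0, ∀ s ∈ Icc (0:ℝ) (2 * π), ∀ w : ℂ, w.im = s → T ≤ w.re → M ≤ (F x w).re := by
    refine isCompact_Icc.induction_on (p := fun S => ∃ T : ℝ, ∀ᶠ x in 𝓝 x0, ∀ s ∈ S, ∀ w : ℂ, w.im = s → T ≤ w.re → M ≤ (F x w).re)
      ⟨0, by simp⟩ ?_ ?_ ?_
    · rintro s t hst ⟨T, hT⟩
      exact ⟨T, hT.mono fun x hx y hy => hx y (hst hy)⟩
    · rintro s t ⟨T, hT⟩ ⟨T', hT'⟩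
      refine ⟨max T T', ?_⟩
      filter_upwards [hT, hT'] with x h1 h2 y hy w hw hm
      rcases hy with hy | hy
      · exact h1 y hy w hw ((le_max_left _ _).trans hm)
      · exact h2 y hy w hw ((le_max_right _ _).trans hm)
    · intro s _
      obtain ⟨T, hT⟩ := h x0 s M
      rw [nhds_prod_eq] at hT
      obtain ⟨pa, hpa, pb, hpb, hab⟩ := eventually_prod_iff.1 hT
      exact ⟨{y | pb y}, mem_nhdsWithin_of_mem_nhds hpb, T, hpa.mono fun x hx y hy => hab hx hy⟩
  obtain ⟨T, hT⟩ := key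
  refine ⟨T, hT.mono fun x hx w hw => ?_⟩
  obtain ⟨n, v, h1, h2, h3⟩ := red_im w
  have := hx v.im h2 v rfl (h1 ▸ hw)
  rw [h3, per_of_gam (hg x)]
  simpa using this
lemma Fam.homeo (H : Fam F) (x : X) : IsHomeomorph (F x) := by
  have hc := slice H.cont x
  have hp : IsProperMap (F x) := by
    rw [isProperMap_iff_tendsto_cocompact]
    refine ⟨hc, ?_⟩
    have hn : Tendsto (fun w => ‖F x w‖) (cocompact ℂ) atTop := by
      rw [Filter.tendsto_atTop]
      intro b
      obtain ⟨T, hT⟩ := H.ends x b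
      obtain ⟨T', hT'⟩ := H.ends' x (-b)
      have hT := hT.self_of_nhds
      have hT' := hT'.self_of_nhds
      obtain ⟨C, hC⟩ := (isCompact_closedBall (0:ℂ) (|T| + |T'| + 2 * π)).exists_bound_of_continuousOn hc.continuousOn
      have key : ∀ w : ℂ, |w.im| ≥ |b| + C + 2 * π → b ≤ ‖F x w‖ := by
        intro w hw
        rcases le_total T w.re with h | h
        · exact (hT w h).trans (re_le_norm _)
        rcases le_total w.re T' with h' | h'
        · have h1 := hT' w h'
          have := abs_re_le_norm (F x w)
          linarith [neg_abs_le (F x w).re]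
        obtain ⟨n, v, h1, h2, h3⟩ := red_im w
        have h4 := hC v (by
          rw [mem_closedBall_zero_iff]
          refine (norm_le_abs_re_add_abs_im v).trans (add_le_add ?_ (abs_le.2 ⟨by linarith [h2.1, pi_pos], h2.2⟩))
          rw [h1, abs_le]
          constructor <;> linarith [neg_abs_le T', le_abs_self T, abs_nonneg T, abs_nonneg T'])
        have h5 : (F x w).im = (F x v).im + (w.im - v.im) := by
          rw [h3, per_of_gam (H.gam x)]; simp
        have h6 := abs_im_le_norm (F x w)
        have h7 := abs_im_le_norm (F x v)
        rw [h5] at h6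
        have h8 : |w.im| ≤ |(F x v).im + (w.im - v.im)| + |(F x v).im| + |v.im| := by
          have e : w.im = ((F x v).im + (w.im - v.im)) - (F x v).im + v.im := by ring
          calc |w.im| = |((F x v).im + (w.im - v.im)) - (F x v).im + v.im| := by rw [← e]
            _ ≤ |((F x v).im + (w.im - v.im)) - (F x v).im| + |v.im| := abs_add_le _ _
            _ ≤ _ := by gcongr; exact abs_sub _ _
        rw [abs_of_nonneg h2.1] at h8
        linarith [h2.2, le_abs_self b]
      have : ∀ᶠ r in atTop, |T| + |T'| + (|b| + C + 2 * π) ≤ r := eventually_ge_atTop _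
      filter_upwards [(tendsto_norm_cocompact_atTop (E := ℂ)).eventually this] with w hw
      rcases le_or_gt (|b| + C + 2 * π) |w.im| with h | h
      · exact key w h
      · have := norm_le_abs_re_add_abs_im w
        have h3 : |T| + |T'| ≤ |w.re| := by linarith
        rcases abs_cases w.re with ⟨h4, _⟩ | ⟨h4, _⟩
        · exact (hT w (by linarith [le_abs_self T, abs_nonneg T'])).trans (re_le_norm _)
        · have h1 := hT' w (by linarith [neg_abs_le T', abs_nonneg T])
          have := abs_re_le_norm (F x w)
          linarith [neg_abs_le (F x w).re]
    rw [← Metric.cobounded_eq_cocompact] at hn ⊢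
    exact tendsto_norm_atTop_iff_cobounded.1 hn
  rw [isHomeomorph_iff_continuous_isClosedMap_bijective]
  exact ⟨hc, hp.isClosedMap, H.bij x⟩
lemma Fam.comp {Y : Type*} [TopologicalSpace Y] (H : Fam F) {u : Y → X} (hu : Continuous u) :
    Fam fun y => F (u y) where
  cont := H.cont.comp ((hu.comp continuous_fst).prodMk continuous_snd)
  gam y := H.gam _
  bij y := H.bij _
  ends y0 M := by
    obtain ⟨T, hT⟩ := H.ends (u y0) M
    exact ⟨T, hu.continuousAt.eventually hT⟩
lemma Fam.glue {A B : X × ℝ → ℂ → ℂ} (hA : Fam A) (hB : Fam B) (t0 : ℝ) (h : ∀ x, A (x, t0) = B (x, t0)) :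
    Fam fun p : X × ℝ => if p.2 ≤ t0 then A p else B p where
  cont := by
    have : (fun p : (X × ℝ) × ℂ => (if p.1.2 ≤ t0 then A p.1 else B p.1) p.2) = fun p => if p.1.2 ≤ t0 then A p.1 p.2 else B p.1 p.2 := by
      ext p; split_ifs <;> rfl
    rw [this]
    refine Continuous.if_le hA.cont hB.cont (by fun_prop) continuous_const ?_
    rintro ⟨⟨x, t⟩, w⟩ ht
    simp only at ht
    simp only [ht, h]
  gam p := by split_ifs; exacts [hA.gam p, hB.gam p]
  bij p := by split_ifs; exacts [hA.bij p, hB.bij p]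
  ends p M := by
    obtain ⟨T, hT⟩ := hA.ends p M
    obtain ⟨T', hT'⟩ := hB.ends p M
    refine ⟨max T T', ?_⟩
    filter_upwards [hT, hT'] with q h1 h2 w hw
    split_ifs
    · exact h1 w ((le_max_left _ _).trans hw)
    · exact h2 w ((le_max_right _ _).trans hw)

def J1 (F : ℂ → ℂ) (z : ℂ) : ℂ := if z = 0 then 0 else exp (-F (-Complex.log z))
lemma exp_neg_eq {a b : ℂ} : exp (-a) = exp (-b) ↔ ∃ n : ℤ, a = b + n * (2 * π * 𝕚) := by
  rw [Complex.exp_eq_exp_iff_exists_int]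
  constructor
  · rintro ⟨n, h⟩; exact ⟨-n, by push_cast; linear_combination -h⟩
  · rintro ⟨n, h⟩; exact ⟨-n, by push_cast; linear_combination -h⟩
lemma J1_exp {F : ℂ → ℂ} (h : ∀ w, F (Gam w) = Gam (F w)) (w : ℂ) : J1 F (exp (-w)) = exp (-F w) := by
  rw [J1, if_neg (exp_ne_zero _), exp_neg_eq]
  obtain ⟨n, hn⟩ := exp_neg_eq.1 (show exp (-(-Complex.log (exp (-w)))) = exp (-w) by
    rw [neg_neg, exp_log (exp_ne_zero _)])
  rw [hn]
  exact ⟨n, per_of_gam h w n⟩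
lemma exp_surj (hz : z ≠ 0) : ∃ w, exp (-w) = z ∧ w.re = -log ‖z‖ :=
  ⟨-Complex.log z, by rw [neg_neg, exp_log hz], by simp [log_re]⟩
lemma norm_exp_neg (w : ℂ) : ‖exp (-w)‖ = Real.exp (-w.re) := by rw [norm_exp, neg_re]
lemma exp_cD : exp (-w) ∈ cD ↔ 0 ≤ w.re := by
  rw [mem_closedBall_zero_iff, norm_exp_neg, exp_le_one_iff]; simp
lemma exp_DD : exp (-w) ∈ DD ↔ 0 < w.re := by
  rw [mem_ball_zero_iff, norm_exp_neg, Real.exp_lt_one_iff]; simp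
lemma J1_cont (H : Fam F) : Continuous fun p : X × ℂ => J1 (F p.1) p.2 := by
  rw [continuous_iff_continuousAt]
  rintro ⟨x0, z0⟩
  by_cases hz : z0 = 0
  · subst hz
    rw [continuousAt_iff']
    intro ε hε
    obtain ⟨T, hT⟩ := H.ends x0 (-log ε + 1)
    have h2 : ∀ᶠ z : ℂ in 𝓝 0, ‖z‖ < Real.exp (-T) := (continuous_norm.tendsto' 0 0 norm_zero).eventually_lt_const (exp_pos _)
    filter_upwards [hT.prod_nhds h2] with ⟨x, z⟩ ⟨h3, h4⟩
    simp only at h3 h4 ⊢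
    rw [show J1 (F x0) 0 = 0 by simp [J1], dist_zero_right]
    by_cases hz : z = 0
    · simp [hz, J1, hε]
    · obtain ⟨w, rfl, hw⟩ := exp_surj hz
      rw [J1_exp (H.gam x), norm_exp_neg, ← Real.lt_log_iff_exp_lt hε]
      rw [norm_exp_neg, Real.exp_lt_exp] at h4
      linarith [h3 w (by linarith)]
  · have h1 : (fun p : X × ℂ => J1 (F p.1) p.2) =ᶠ[𝓝 (x0, z0)] fun p => exp (-F p.1 (-Complex.log z0 - Complex.log (p.2 / z0))) := by
      have : ∀ᶠ p : X × ℂ in 𝓝 (x0, z0), p.2 ≠ 0 := continuousAt_snd.eventually_ne hz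
      filter_upwards [this] with p hp
      rw [← J1_exp (H.gam p.1)]
      congr 1
      rw [neg_sub, sub_neg_eq_add, exp_add, exp_log hz, exp_log (div_ne_zero hp hz), div_mul_cancel₀ _ hz]
    refine ContinuousAt.congr ?_ h1.symm
    have h2 : ContinuousAt (fun p : X × ℂ => -Complex.log z0 - Complex.log (p.2 / z0)) (x0, z0) := by
      refine continuousAt_const.sub (ContinuousAt.clog (by fun_prop) ?_)
      simp [div_self hz]
    exact ((H.cont.continuousAt.comp (f := fun p : X × ℂ => (p.1, -Complex.log z0 - Complex.log (p.2 / z0))) (continuousAt_fst.prodMk h2)).neg).cexp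
lemma bound_left (H : Fam F) (x : X) : ∃ B : ℝ, ∀ w : ℂ, w.re ≤ 0 → (F x w).re ≤ B := by
  obtain ⟨T, hT⟩ := H.ends' x 0
  have hT := hT.self_of_nhds
  obtain ⟨C, hC⟩ := (isCompact_closedBall (0:ℂ) (|T| + 2 * π)).exists_bound_of_continuousOn (slice H.cont x).continuousOn
  refine ⟨max 0 C, fun w hw => ?_⟩
  rcases le_total w.re T with h | h
  · exact (hT w h).trans (le_max_left _ _)
  obtain ⟨n, v, h1, h2, h3⟩ := red_im w
  have h4 := hC v (by
    rw [mem_closedBall_zero_iff]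
    refine (norm_le_abs_re_add_abs_im v).trans (add_le_add ?_ (abs_le.2 ⟨by linarith [h2.1, pi_pos], h2.2⟩))
    rw [h1, abs_le]
    constructor <;> linarith [neg_abs_le T, abs_nonneg T])
  rw [h3, per_of_gam (H.gam x)]
  simp only [add_re]
  have := re_le_norm (F x v)
  simp
  right; linarith
lemma J1_inj {F : ℂ → ℂ} (h : ∀ w, F (Gam w) = Gam (F w)) (hi : Injective F) : Injective (J1 F) := by
  intro a b hab
  by_cases ha : a = 0
  · by_contra hb
    rw [ha] at hb
    simp [ha, J1, Ne.symm hb] at hab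
    exact exp_ne_zero _ hab.symm
  by_cases hb : b = 0
  · simp [hb, J1, ha] at hab
  obtain ⟨w, rfl, -⟩ := exp_surj ha
  obtain ⟨v, rfl, -⟩ := exp_surj hb
  rw [J1_exp h, J1_exp h, exp_neg_eq] at hab
  obtain ⟨n, hn⟩ := hab
  rw [← per_of_gam h] at hn
  exact exp_neg_eq.2 ⟨n, hi hn⟩
lemma J1_adm (H : Fam F) : AdmFam fun x => J1 (F x) where
  adm x := by
    refine ⟨(slice (P := fun x => J1 (F x)) (J1_cont H) x).continuousOn, (J1_inj (H.gam x) (H.bij x).injective).injOn, ?_⟩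
    obtain ⟨B, hB⟩ := bound_left H x
    have h1 : IsOpen ((fun w => exp (-w)) '' (F x '' {w | 0 < w.re})) := by
      have h2 : IsOpen (F x '' {w : ℂ | 0 < w.re}) := (H.homeo x).isOpenMap _ (isOpen_lt (f := fun _ => (0:ℝ)) continuous_const continuous_re)
      exact (Complex.isOpenMap_exp.comp (Homeomorph.neg ℂ).isOpenMap) _ h2
    have h2 : J1 (F x) '' DD = (fun w => exp (-w)) '' (F x '' {w | 0 < w.re}) ∪ ball 0 (Real.exp (-B)) := by
      ext y
      constructor
      · rintro ⟨z, hz, rfl⟩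
        by_cases h0 : z = 0
        · right; simp [h0, J1, exp_pos]
        · obtain ⟨w, rfl, -⟩ := exp_surj h0
          left
          exact ⟨_, ⟨w, exp_DD.1 hz, rfl⟩, (J1_exp (H.gam x) w).symm⟩
      · rintro (⟨_, ⟨w, hw, rfl⟩, rfl⟩ | hy)
        · exact ⟨_, exp_DD.2 hw, J1_exp (H.gam x) w⟩
        · by_cases h0 : y = 0
          · exact ⟨0, zero_DD, by simp [J1, h0]⟩
          · obtain ⟨v, rfl, -⟩ := exp_surj h0
            obtain ⟨w, rfl⟩ := (H.bij x).surjective v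
            refine ⟨_, exp_DD.2 (not_le.1 fun h => ?_), J1_exp (H.gam x) w⟩
            rw [mem_ball_zero_iff, norm_exp_neg, Real.exp_lt_exp] at hy
            linarith [hB w h]
    rw [h2]
    exact h1.union isOpen_ball
  cont := (J1_cont H).comp (continuous_fst.prodMk (pr_cont.comp continuous_snd))

structure IsL (Q L : ℂ → ℂ) : Prop where
  cont : Continuous L
  exp : ∀ z, exp (L z) = Q z
  im : (L 0).im = 0
lemma log_exists {Q : X → ℂ → ℂ} (hQ : Continuous fun p : X × ℂ => Q p.1 p.2) (h0 : ∀ x z, Q x z ≠ 0)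
    (hp : ∀ x, ∃ c : ℝ, 0 < c ∧ Q x 0 = c) :
    ∃ L : X → ℂ → ℂ, Continuous (fun p : X × ℂ => L p.1 p.2) ∧ ∀ x, IsL (Q x) (L x) := by
  have cov := Complex.isCoveringMap_exp
  let Hh : C(I × (X × ℂ), {z : ℂ // z ≠ 0}) := ⟨fun p => ⟨Q p.2.1 ((p.1 : ℝ) * p.2.2), h0 _ _⟩, by
    refine Continuous.subtype_mk ?_ _
    exact hQ.comp (f := fun p : I × (X × ℂ) => (p.2.1, ((p.1 : ℝ) : ℂ) * p.2.2)) (by fun_prop)⟩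
  let f : C(X × ℂ, ℂ) := ⟨fun p => (log (Q p.1 0).re : ℝ), by
    have h1 : Continuous fun x => (Q x 0).re := continuous_re.comp (hQ.comp (Continuous.prodMk_left 0))
    have h2 : Continuous fun x => log (Q x 0).re := h1.log fun x => by
      obtain ⟨c, hc, he⟩ := hp x; rw [he]; exact hc.ne'
    exact continuous_ofReal.comp (h2.comp continuous_fst)⟩
  have hf : ∀ a : X × ℂ, exp (f a) = Q a.1 0 := fun a => by
    obtain ⟨c, hc, he⟩ := hp a.1
    show exp ((log (Q a.1 0).re : ℝ) : ℂ) = _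
    rw [he, ← ofReal_exp, ofReal_re, Real.exp_log hc]
  have H0 : ∀ a, Hh (0, a) = (⟨_, (f a).exp_ne_zero⟩ : {z : ℂ // z ≠ 0}) := by
    intro a
    apply Subtype.ext
    show Q a.1 (((0:I):ℝ) * a.2) = exp (f a)
    rw [hf]; simp
  let K := cov.liftHomotopy Hh f H0
  have hK : ∀ t a, exp (K (t, a)) = Q a.1 ((t:ℝ) * a.2) := fun t a =>
    congrArg Subtype.val (congrFun (cov.liftHomotopy_lifts Hh f H0) (t, a))
  have hK0 : ∀ a, K (0, a) = f a := cov.liftHomotopy_zero Hh f H0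
  refine ⟨fun x z => K (1, (x, z)), K.continuous.comp (by fun_prop), fun x => ⟨K.continuous.comp (by fun_prop), fun z => ?_, ?_⟩⟩
  · rw [hK]; simp
  · have := cov.const_of_comp (A := I) (g := fun t => K (t, (x, 0))) (K.continuous.comp (by fun_prop)) (fun a b => by
      apply Subtype.ext
      show exp _ = exp _
      rw [hK, hK]; simp) 1 0
    show (K (1, x, 0)).im = 0
    rw [this, hK0]
    exact ofReal_im _
lemma IsL.unique {Q L L' : ℂ → ℂ} (H : IsL Q L) (H' : IsL Q L') : L = L' := by
  refine Complex.isCoveringMap_exp.eq_of_comp_eq H.cont H'.cont ?_ 0 ?_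
  · funext z
    exact Subtype.ext ((H.exp z).trans (H'.exp z).symm)
  · have h := (H.exp 0).trans (H'.exp 0).symm
    rw [← re_add_im (L 0), ← re_add_im (L' 0), H.im, H'.im] at h ⊢
    simp only [ofReal_zero, zero_mul, add_zero] at h ⊢
    rw [← ofReal_exp, ← ofReal_exp, Complex.ofReal_inj] at h
    rw [exp_injective h]
def LL (Q : ℂ → ℂ) : ℂ → ℂ := Classical.epsilon fun L => IsL Q L
lemma log_fam {Q : X → ℂ → ℂ} (hQ : Continuous fun p : X × ℂ => Q p.1 p.2) (h0 : ∀ x z, Q x z ≠ 0)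
    (hp : ∀ x, ∃ c : ℝ, 0 < c ∧ Q x 0 = c) :
    (Continuous fun p : X × ℂ => LL (Q p.1) p.2) ∧ ∀ x, IsL (Q x) (LL (Q x)) := by
  obtain ⟨L, h1, h2⟩ := log_exists hQ h0 hp
  have h3 : ∀ x, IsL (Q x) (LL (Q x)) := fun x => Classical.epsilon_spec (p := fun L => IsL (Q x) L) ⟨L x, h2 x⟩
  refine ⟨?_, h3⟩
  have : (fun p : X × ℂ => LL (Q p.1) p.2) = fun p => L p.1 p.2 := funext fun p => by rw [(h3 p.1).unique (h2 p.1)]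
  rw [this]; exact h1
def qq (J : ℂ → ℂ) (z : ℂ) : ℂ := dslope (J ∘ kJ J) 0 z
section
variable {J : ℂ → ℂ} (H : Adm J) (hJ0 : J 0 = 0)
include H hJ0
lemma phi_zero : (J ∘ kJ J) 0 = 0 := by rw [Function.comp, H.unif.k0, hJ0]
lemma phi_eq (z : ℂ) : J (kJ J z) = z * qq J z := by
  have := sub_smul_dslope (J ∘ kJ J) 0 z
  rw [phi_zero H hJ0] at this
  simpa [qq] using this.symm
omit hJ0 in
lemma phi_cc : ContinuousOn (J ∘ kJ J) cD := H.cont.comp H.unif.kcc H.unif.km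
omit hJ0 in
lemma qq_holo : DifferentiableOn ℂ (qq J) DD :=
  (Complex.differentiableOn_dslope (isOpen_ball.mem_nhds zero_DD)).2 H.unif.holo
omit hJ0 in
lemma qq_cc : ContinuousOn (qq J) cD := by
  intro z hz
  by_cases h : z = 0
  · subst h
    exact ((qq_holo H).differentiableAt (isOpen_ball.mem_nhds zero_DD)).continuousAt.continuousWithinAt
  · exact (continuousWithinAt_dslope_of_ne h).2 (phi_cc H z hz)
lemma qq_zero : ∃ c : ℝ, 0 < c ∧ qq J 0 = c := by
  obtain ⟨c, hc, h⟩ := H.unif.pos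
  exact ⟨c, hc, by rw [qq, dslope_same, h]⟩
lemma qq_ne (hz : z ∈ cD) : qq J z ≠ 0 := by
  intro h
  by_cases h0 : z = 0
  · obtain ⟨c, hc, he⟩ := qq_zero H hJ0
    rw [← h0, h] at he
    exact hc.ne (by exact_mod_cast he)
  · have h1 := phi_eq H hJ0 z
    rw [h, mul_zero, ← hJ0] at h1
    have h2 := H.inj (H.unif.km hz) (DD_sub zero_DD) h1
    have h3 := H.unif.hkc z hz
    rw [h2, H.unif.h0] at h3
    exact h0 h3.symm
end
lemma qq_fam {J : X → ℂ → ℂ} (H : AdmFam J) (h0 : ∀ x, J x 0 = 0) : Continuous fun p : X × ℂ => qq (J p.1) (pr p.2) := by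
  refine joint_of_unif (fun x => qq_cc (H.adm x)) fun x0 ε hε => ?_
  have hphi : Continuous fun p : X × ℂ => J p.1 (kJ (J p.1) (pr p.2)) := by
    have h1 := H.cont.comp (continuous_fst.prodMk H.kcont : Continuous fun p : X × ℂ => (p.1, kJ (J p.1) (pr p.2)))
    refine h1.congr fun p => ?_
    show J p.1 (pr _) = _
    rw [pr_eq ((H.adm p.1).unif.km (pr_mem _))]
  filter_upwards [unif_near (f := fun x z => J x (kJ (J x) (pr z))) cD_compact hphi x0 (half_pos hε)] with x hx z hz
  have h1 : ∀ z ∈ frontier DD, ‖qq (J x) z - qq (J x0) z‖ ≤ ε / 2 := by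
    intro z hz
    have hz1 : ‖z‖ = 1 := by
      have := frontier_ball_subset_sphere hz
      simpa using this
    have h2 := hx z (by rw [mem_closedBall_zero_iff, hz1])
    have hzc : z ∈ cD := by rw [mem_closedBall_zero_iff, hz1]
    simp only [pr_eq hzc] at h2
    rw [phi_eq (H.adm x) (h0 x), phi_eq (H.adm x0) (h0 x0), ← mul_sub, norm_mul, hz1, one_mul] at h2
    exact h2.le
  have h2 := norm_le_of_forall_mem_frontier_norm_le (f := fun z => qq (J x) z - qq (J x0) z) (U := DD) isBounded_ball
    ⟨(qq_holo (H.adm x)).sub (qq_holo (H.adm x0)), by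
      rw [closure_DD]; exact (qq_cc (H.adm x)).sub (qq_cc (H.adm x0))⟩ h1 (z := z) (by rw [closure_DD]; exact hz)
  linarith

def Lq (F : ℂ → ℂ) : ℂ → ℂ := LL fun z => qq (J1 F) (pr z)
def eta (F : ℂ → ℂ) (w : ℂ) : ℂ := F w + Lq F (hJ (J1 F) (pr (exp (-w))))
def Lam (F : ℂ → ℂ) (ζ : ℂ) : ℂ := ζ - Lq F (pr (exp (-ζ)))
def aa (t r : ℝ) : ℝ := -log (max (max 0 (min 1 t)) (Real.exp (-r)))
def f1 (F : ℂ → ℂ) (t : ℝ) (w : ℂ) : ℂ := Lam F (eta F (w - aa t w.re) + aa t w.re)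
def F1 (F : ℂ → ℂ) (t : ℝ) (w : ℂ) : ℂ := if 0 ≤ w.re then f1 F t w else Gam (f1 F t (Gai w))
lemma J1_zero (F : ℂ → ℂ) : J1 F 0 = 0 := by simp [J1]
lemma Lq_fam (H : Fam F) : (Continuous fun p : X × ℂ => Lq (F p.1) p.2) ∧
    ∀ x, IsL (fun z => qq (J1 (F x)) (pr z)) (Lq (F x)) :=
  log_fam (Q := fun x z => qq (J1 (F x)) (pr z)) (qq_fam (J1_adm H) fun x => J1_zero _)
    (fun x z => qq_ne ((J1_adm H).adm x) (J1_zero _) (pr_mem z)) fun x => by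
      simp only [pr_eq (DD_sub zero_DD)]; exact qq_zero ((J1_adm H).adm x) (J1_zero _)
lemma eta_cont (H : Fam F) : Continuous fun p : X × ℂ => eta (F p.1) p.2 := by
  have h := (J1_adm H).hcont.comp (f := fun p : X × ℂ => (p.1, exp (-p.2))) (by fun_prop)
  exact H.cont.add ((Lq_fam H).1.comp (f := fun p : X × ℂ => (p.1, hJ (J1 (F p.1)) (pr (exp (-p.2))))) (continuous_fst.prodMk h))
lemma Lam_cont (H : Fam F) : Continuous fun p : X × ℂ => Lam (F p.1) p.2 := by
  have h : Continuous fun p : X × ℂ => pr (exp (-p.2)) := pr_cont.comp (by fun_prop)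
  exact continuous_snd.sub ((Lq_fam H).1.comp (f := fun p : X × ℂ => (p.1, pr (exp (-p.2)))) (continuous_fst.prodMk h))
lemma aa_cont : Continuous fun p : ℝ × ℝ => aa p.1 p.2 := by
  unfold aa
  refine (Continuous.log (by fun_prop) fun p => ?_).neg
  exact ((exp_pos _).trans_le (le_max_right _ _)).ne'
lemma aa_exp (t r : ℝ) : Real.exp (-aa t r) = max (max 0 (min 1 t)) (Real.exp (-r)) := by
  rw [aa, neg_neg, Real.exp_log ((exp_pos _).trans_le (le_max_right _ _))]
lemma aa_le (t r : ℝ) : aa t r ≤ r := by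
  have := aa_exp t r ▸ le_max_right (max 0 (min 1 t)) (Real.exp (-r))
  rw [exp_le_exp] at this; linarith
lemma aa_nonneg (t : ℝ) {r : ℝ} (hr : 0 ≤ r) : 0 ≤ aa t r := by
  have : Real.exp (-aa t r) ≤ 1 := by
    rw [aa_exp]; exact max_le (max_le zero_le_one (min_le_left _ _)) (exp_le_one_iff.2 (by linarith))
  rw [exp_le_one_iff] at this; linarith
lemma aa_zero (t : ℝ) : aa t 0 = 0 := le_antisymm (aa_le t 0) (aa_nonneg t le_rfl)
lemma aa_eq {t a b : ℝ} (h : Real.exp (-aa t a) = Real.exp (-aa t b)) : aa t a = aa t b := by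
  have := exp_injective h; linarith
lemma aa_idem (t r : ℝ) : aa t (aa t r) = aa t r := by
  apply aa_eq; rw [aa_exp, aa_exp, ← max_assoc, max_self]
lemma aa_const {t r r' : ℝ} (h : aa t r < r) (h' : aa t r ≤ r') : aa t r' = aa t r := by
  have h1 := aa_exp t r
  have h2 : Real.exp (-aa t r) = max 0 (min 1 t) := by
    rcases max_choice (max 0 (min 1 t)) (Real.exp (-r)) with h3 | h3
    · rw [h1, h3]
    · rw [h3] at h1; have := exp_injective h1; linarith
  apply aa_eq
  rw [aa_exp, h2, max_eq_left]
  rw [← h2, exp_le_exp]; linarith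
lemma aa_t0 (r : ℝ) : aa 0 r = r := by simp [aa, (exp_pos _).le]
lemma aa_t1 {r : ℝ} (hr : 0 ≤ r) : aa 1 r = 0 := by
  rw [aa, max_eq_left]
  · simp
  · simpa using hr
section
variable {F : X → ℂ → ℂ} (H : Fam F) (x : X)
include H
lemma eta_exp (hw : 0 ≤ w.re) : exp (-eta (F x) w) = hJ (J1 (F x)) (exp (-w)) := by
  have hA := (J1_adm H).adm x
  have hm := exp_cD.2 hw
  have h1 := hA.unif.hm hm
  have h2 := phi_eq hA (J1_zero _) (hJ (J1 (F x)) (exp (-w)))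
  rw [hA.unif.khc _ hm, J1_exp (H.gam x)] at h2
  have h3 := ((Lq_fam H).2 x).exp (hJ (J1 (F x)) (exp (-w)))
  simp only [pr_eq h1] at h3
  rw [eta, pr_eq hm, neg_add, exp_add, h2, ← h3, mul_assoc, ← exp_add, add_neg_cancel, exp_zero, mul_one]
lemma eta_re (hw : 0 ≤ w.re) : 0 ≤ (eta (F x) w).re := by
  rw [← exp_cD, eta_exp H x hw]
  exact ((J1_adm H).adm x).unif.hm (exp_cD.2 hw)
lemma eta_per (w : ℂ) (n : ℤ) : eta (F x) (w + n * (2 * π * 𝕚)) = eta (F x) w + n * (2 * π * 𝕚) := by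
  rw [eta, eta, per_of_gam (H.gam x), exp_neg_eq.2 ⟨n, rfl⟩]; ring
lemma eta_inj {w v : ℂ} (hw : 0 ≤ w.re) (hv : 0 ≤ v.re) (h : eta (F x) w = eta (F x) v) : w = v := by
  have hA := (J1_adm H).adm x
  have h1 := eta_exp H x hw
  rw [h, eta_exp H x hv] at h1
  have h2 := hA.unif.khc _ (exp_cD.2 hv)
  rw [h1, hA.unif.khc _ (exp_cD.2 hw)] at h2
  obtain ⟨n, hn⟩ := exp_neg_eq.1 h2
  rw [hn, eta_per H] at h
  have : (n:ℂ) * (2 * π * 𝕚) = 0 := by simpa using h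
  rw [hn, this, add_zero]
lemma eta_surj {ζ : ℂ} (hζ : 0 ≤ ζ.re) : ∃ w : ℂ, 0 ≤ w.re ∧ eta (F x) w = ζ := by
  have hA := (J1_adm H).adm x
  have hm := exp_cD.2 hζ
  have h1 := hA.unif.km hm
  have h2 := hA.unif.hkc _ hm
  have h0 : kJ (J1 (F x)) (exp (-ζ)) ≠ 0 := fun h => by
    rw [h, hA.unif.h0] at h2; exact exp_ne_zero _ h2.symm
  obtain ⟨w, hw, -⟩ := exp_surj h0
  rw [← hw] at h1 h2
  have h3 := exp_cD.1 h1
  rw [← eta_exp H x h3] at h2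
  obtain ⟨n, hn⟩ := exp_neg_eq.1 h2.symm
  exact ⟨w + n * (2 * π * 𝕚), by simpa using h3, by rw [eta_per H, hn]⟩
lemma Lam_eta (hw : 0 ≤ w.re) : Lam (F x) (eta (F x) w) = F x w := by
  have hA := (J1_adm H).adm x
  rw [Lam, eta_exp H x hw, pr_eq (hA.unif.hm (exp_cD.2 hw)), eta, pr_eq (exp_cD.2 hw)]; ring
lemma Lam_inj {w v : ℂ} (hw : 0 ≤ w.re) (hv : 0 ≤ v.re) (h : Lam (F x) w = Lam (F x) v) : w = v := by
  obtain ⟨w, hw', rfl⟩ := eta_surj H x hw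
  obtain ⟨v, hv', rfl⟩ := eta_surj H x hv
  rw [Lam_eta H x hw', Lam_eta H x hv'] at h
  rw [(H.bij x).injective h]
lemma eta_bd (hw : w.re = 0) : (eta (F x) w).re = 0 := by
  have hA := (J1_adm H).adm x
  by_contra h
  have h1 := lt_of_le_of_ne (eta_re H x hw.ge) (Ne.symm h)
  rw [← exp_DD, eta_exp H x hw.ge] at h1
  have h2 := hA.unif.kD h1
  rw [hA.unif.khc _ (exp_cD.2 hw.ge), exp_DD] at h2
  linarith
lemma eta_bd' (hw : 0 ≤ w.re) (h : (eta (F x) w).re = 0) : w.re = 0 := by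
  have hA := (J1_adm H).adm x
  by_contra h'
  have h1 := hA.unif.hD (exp_DD.2 (lt_of_le_of_ne hw (Ne.symm h')))
  rw [← eta_exp H x hw, exp_DD] at h1
  linarith
omit H in
lemma sub_aa_re (t : ℝ) (w : ℂ) : 0 ≤ (w - aa t w.re).re := by simpa using aa_le t w.re
lemma et_re (t : ℝ) : aa t w.re ≤ (eta (F x) (w - aa t w.re) + aa t w.re).re := by
  simpa using eta_re H x (sub_aa_re t w)
lemma et_aa (t : ℝ) (w : ℂ) : aa t (eta (F x) (w - aa t w.re) + aa t w.re).re = aa t w.re := by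
  rcases (aa_le t w.re).lt_or_eq with h | h
  · exact aa_const h (et_re H x t)
  · have : (eta (F x) (w - aa t w.re)).re = 0 := eta_bd H x (by simp [h])
    rw [add_re, this, zero_add, ofReal_re, aa_idem]
lemma f1_F {t : ℝ} (hw : 0 ≤ w.re) : ∃ v : ℂ, 0 ≤ v.re ∧ (v.re = 0 → w.re = 0) ∧ f1 (F x) t w = F x v := by
  have h1 := et_re H x t (w := w)
  obtain ⟨v, hv, h2⟩ := eta_surj H x ((aa_nonneg t hw).trans h1)
  refine ⟨v, hv, fun h => ?_, by rw [f1, ← h2, Lam_eta H x hv]⟩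
  have h3 := eta_bd H x h
  rw [h2, add_re, ofReal_re] at h3
  have h4 := eta_re H x (sub_aa_re t w)
  have h5 := aa_nonneg t hw
  have h6 := eta_bd' H x (sub_aa_re t w) (by linarith)
  rw [sub_re, ofReal_re] at h6
  linarith
lemma f1_inj {t : ℝ} {w v : ℂ} (hw : 0 ≤ w.re) (hv : 0 ≤ v.re) (h : f1 (F x) t w = f1 (F x) t v) : w = v := by
  have h1 := Lam_inj H x ((aa_nonneg t hw).trans (et_re H x t)) ((aa_nonneg t hv).trans (et_re H x t)) h
  have h2 := et_aa H x t w
  rw [h1, et_aa H] at h2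
  rw [h2] at h1
  have h3 := eta_inj H x (sub_aa_re t w) (h2 ▸ sub_aa_re t v) (add_right_cancel h1)
  simpa using h3
lemma f1_surj {t : ℝ} {v : ℂ} (hv : 0 ≤ v.re) : ∃ w : ℂ, 0 ≤ w.re ∧ f1 (F x) t w = F x v := by
  set ζ := eta (F x) v with hζ
  have h0 : 0 ≤ ζ.re := eta_re H x hv
  obtain ⟨u, hu, h1⟩ := eta_surj H x (sub_aa_re t ζ)
  set a := aa t ζ.re with ha
  have h2 : aa t (u + a).re = a := by
    rw [add_re, ofReal_re]
    rcases (aa_le t ζ.re).lt_or_eq with h | h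
    · exact aa_const h (by rw [← ha]; linarith)
    · rw [eta_bd' H x hu (by rw [h1, ha, h]; simp), zero_add, ha, aa_idem]
  refine ⟨u + a, by simpa using add_nonneg hu (aa_nonneg t h0), ?_⟩
  rw [f1, h2, add_sub_cancel_right, h1, sub_add_cancel, Lam_eta H x hv]
lemma f1_bd {t : ℝ} (hw : w.re = 0) : f1 (F x) t w = F x w := by
  rw [f1, hw, aa_zero, ofReal_zero, sub_zero, add_zero, Lam_eta H x hw.ge]
lemma f1_per (t : ℝ) (w : ℂ) (n : ℤ) : f1 (F x) t (w + n * (2 * π * 𝕚)) = f1 (F x) t w + n * (2 * π * 𝕚) := by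
  have e : (w + n * (2 * π * 𝕚)).re = w.re := by simp
  rw [f1, f1, e, add_sub_right_comm, eta_per H, add_right_comm, Lam, Lam, exp_neg_eq.2 ⟨n, rfl⟩]; ring
lemma F1_gam (t : ℝ) (w : ℂ) : F1 (F x) t (Gam w) = Gam (F1 (F x) t w) := by
  rcases lt_trichotomy w.re 0 with h | h | h
  · rw [F1, if_pos (by rw [Gam_re]; linarith), F1, if_neg (by linarith), Gam_Gam]
    have : Gam w = Gai w + (1:ℤ) * (2 * π * 𝕚) := by
      push_cast; rw [one_mul, ← Gam_Gam, Gam_Gai]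
    rw [this, f1_per H]; push_cast; ring
  · rw [F1, if_pos (by rw [Gam_re]; linarith), F1, if_pos h.ge, f1_bd H x h, f1_bd H x (by rw [Gam_re, h, neg_zero]), H.gam]
  · rw [F1, if_neg (by rw [Gam_re]; linarith), F1, if_pos h.le, Gai_Gam]
lemma F1_bij (t : ℝ) : Bijective (F1 (F x) t) := by
  have key : ∀ a b : ℂ, 0 ≤ a.re → b.re < 0 → F1 (F x) t a ≠ F1 (F x) t b := by
    intro a b ha hb h
    rw [F1, if_pos ha, F1, if_neg hb.not_ge] at h
    obtain ⟨v, hv, -, h1⟩ := f1_F H x (t := t) ha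
    obtain ⟨u, hu, h3, h2⟩ := f1_F H x (t := t) (w := Gai b) (by rw [Gai_re]; linarith)
    rw [h1, h2, ← H.gam] at h
    have h4 := congrArg Complex.re ((H.bij x).injective h)
    rw [Gam_re] at h4
    have := h3 (by linarith)
    rw [Gai_re] at this
    linarith
  constructor
  · intro a b h
    rcases le_or_gt 0 a.re with ha | ha <;> rcases le_or_gt 0 b.re with hb | hb
    · rw [F1, if_pos ha, F1, if_pos hb] at h
      exact f1_inj H x ha hb h
    · exact (key a b ha hb h).elim
    · exact (key b a hb ha h.symm).elim
    · rw [F1, if_neg ha.not_ge, F1, if_neg hb.not_ge] at h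
      have h1 := f1_inj H x (t := t) (w := Gai a) (v := Gai b) (by rw [Gai_re]; linarith) (by rw [Gai_re]; linarith)
        (by rw [← Gai_Gam (f1 (F x) t (Gai a)), h, Gai_Gam])
      rw [← Gam_Gai a, h1, Gam_Gai]
  · intro y
    obtain ⟨u, rfl⟩ := (H.bij x).surjective y
    rcases le_or_gt 0 u.re with h | h
    · obtain ⟨w, hw, h1⟩ := f1_surj H x (t := t) h
      exact ⟨w, by rw [F1, if_pos hw, h1]⟩
    · obtain ⟨w, hw, h1⟩ := f1_surj H x (t := t) (v := Gai u) (by rw [Gai_re]; linarith)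
      have h2 : F1 (F x) t w = F x (Gai u) := by rw [F1, if_pos hw, h1]
      exact ⟨Gam w, by rw [F1_gam H, h2, ← H.gam, Gam_Gai]⟩
end

def CL (F : ℂ → ℂ) : ℝ := sSup ((fun z => ‖Lq F z‖) '' cD)
def CE (F : ℂ → ℂ) : ℝ := sSup ((fun v : ℝ => ‖eta F (v * 𝕚) - v * 𝕚‖) '' Icc 0 (2 * π))
section
variable {F : X → ℂ → ℂ} (H : Fam F)
include H
lemma CL_cont : Continuous fun x => CL (F x) :=
  cD_compact.continuous_sSup (f := fun x z => ‖Lq (F x) z‖) (Lq_fam H).1.norm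
lemma CE_cont : Continuous fun x => CE (F x) :=
  isCompact_Icc.continuous_sSup (f := fun x (v : ℝ) => ‖eta (F x) (v * 𝕚) - v * 𝕚‖)
    (((eta_cont H).comp (f := fun p : X × ℝ => (p.1, (p.2 : ℂ) * 𝕚)) (by fun_prop)).sub (by fun_prop)).norm
lemma CL_le (x : X) (hz : z ∈ cD) : ‖Lq (F x) z‖ ≤ CL (F x) :=
  le_csSup (cD_compact.image ((Lq_fam H).2 x).cont.norm).bddAbove ⟨z, hz, rfl⟩
lemma CE_le (x : X) (hw : w.re = 0) : ‖eta (F x) w - w‖ ≤ CE (F x) := by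
  obtain ⟨n, v, h1, h2, rfl⟩ := red_im w
  rw [eta_per H, add_sub_add_right_eq_sub]
  have h3 : v = (v.im : ℂ) * 𝕚 := by
    apply cxt <;> simp [h1, hw]
  refine le_csSup (isCompact_Icc.image ?_).bddAbove ⟨v.im, h2, by simp only [← h3]⟩
  exact (((slice (P := fun x w => eta (F x) w) (eta_cont H) x).comp (by fun_prop)).sub (by fun_prop)).norm
lemma F1_near {x : X} {t B : ℝ} (h : ∀ w : ℂ, 0 ≤ w.re → ‖f1 (F x) t w - w‖ ≤ B) (w : ℂ) : ‖F1 (F x) t w - w‖ ≤ B := by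
  rw [F1]; split_ifs with h1
  · exact h w h1
  · have h2 := h (Gai w) (by rw [Gai_re]; linarith)
    rw [show Gam (f1 (F x) t (Gai w)) - w = nn (f1 (F x) t (Gai w) - Gai w) by
      nth_rw 2 [← Gam_Gai w]; simp [Gam, nn]; ring]
    rw [nn, norm_neg, RCLike.norm_conj]; exact h2
lemma F1_zero (x : X) (w : ℂ) : ‖F1 (F x) 0 w - w‖ ≤ CL (F x) + CE (F x) := by
  refine F1_near H (fun w hw => ?_) w
  rw [f1, aa_t0, Lam]
  have h1 := CL_le H x (pr_mem (exp (-(eta (F x) (w - w.re) + w.re))))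
  have h2 := CE_le H x (w := w - w.re) (by simp)
  rw [show eta (F x) (w - w.re) + w.re - Lq (F x) (pr (exp (-(eta (F x) (w - w.re) + w.re)))) - w
    = (eta (F x) (w - w.re) - (w - w.re)) - Lq (F x) (pr (exp (-(eta (F x) (w - w.re) + w.re)))) by ring]
  exact (norm_sub_le _ _).trans (by linarith)
lemma F1_one (x : X) : F1 (F x) 1 = F x := by
  have h : ∀ w : ℂ, 0 ≤ w.re → f1 (F x) 1 w = F x w := fun w hw => by
    rw [f1, aa_t1 hw, ofReal_zero, sub_zero, add_zero, Lam_eta H x hw]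
  funext w
  rw [F1]; split_ifs with h1
  · exact h w h1
  · rw [h _ (by rw [Gai_re]; linarith), ← H.gam, Gam_Gai]
lemma F1_id {x : X} (h : ∀ w, F x w = w) (t : ℝ) (w : ℂ) : F1 (F x) t w = w := by
  have hA := (J1_adm H).adm x
  have hJ : ∀ z, J1 (F x) z = z := fun z => by
    rw [J1]; split_ifs with h0
    · exact h0.symm
    · rw [h, neg_neg, exp_log h0]
  have hU : Unif (J1 (F x)) id id := by
    have e : J1 (F x) ∘ id = id := funext hJ
    refine { holo := ?_, kD := mapsTo_id _, hD := mapsTo_id _, kc := continuousOn_id, hc := continuousOn_id, kh := fun _ _ => rfl, hk := fun _ _ => rfl, h0 := rfl, pos := ?_, kcc := continuousOn_id, hcc := continuousOn_id, km := mapsTo_id _, hm := mapsTo_id _, khc := fun _ _ => rfl, hkc := fun _ _ => rfl }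
    · rw [e]; exact differentiableOn_id
    · rw [e]; exact ⟨1, one_pos, by simp⟩
  have hk := (hA.unif.unique hA hU).1
  have hq : ∀ z ∈ cD, qq (J1 (F x)) z = 1 := by
    intro z hz
    by_cases h0 : z = 0
    · subst h0
      rw [qq, dslope_same]
      have : (J1 (F x) ∘ kJ (J1 (F x))) =ᶠ[𝓝 0] id := by
        filter_upwards [isOpen_ball.mem_nhds zero_DD] with z hz
        rw [Function.comp, hJ, ← hk (DD_sub hz)]
      rw [this.deriv_eq]; simp
    · have := phi_eq hA (J1_zero _) z
      rw [hJ, ← hk hz] at this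
      exact mul_left_cancel₀ h0 (by rw [← this]; simp)
  have hL : Lq (F x) = fun _ => 0 := ((Lq_fam H).2 x).unique
    ⟨continuous_const, fun z => by rw [exp_zero, hq _ (pr_mem z)], rfl⟩
  have h1 := F1_near H (x := x) (t := t) (B := 0) (fun w hw => by
    simp [f1, Lam, eta, hL, h]) w
  exact sub_eq_zero.1 (norm_le_zero_iff.1 h1)
lemma f1_cont : Continuous fun p : (X × ℝ) × ℂ => f1 (F p.1.1) p.1.2 p.2 := by
  have h1 : Continuous fun p : (X × ℝ) × ℂ => ((aa p.1.2 p.2.re : ℝ) : ℂ) :=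
    continuous_ofReal.comp (aa_cont.comp (f := fun p : (X × ℝ) × ℂ => (p.1.2, p.2.re)) (by fun_prop))
  have h2 := (eta_cont H).comp (f := fun p : (X × ℝ) × ℂ => (p.1.1, p.2 - aa p.1.2 p.2.re)) (by fun_prop)
  exact (Lam_cont H).comp (f := fun p : (X × ℝ) × ℂ => (p.1.1, eta (F p.1.1) (p.2 - aa p.1.2 p.2.re) + aa p.1.2 p.2.re)) ((by fun_prop : Continuous fun p : (X × ℝ) × ℂ => p.1.1).prodMk (h2.add h1))
lemma F1_fam : Fam fun p : X × ℝ => F1 (F p.1) p.2 where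
  cont := by
    unfold F1
    refine Continuous.if_le (f := fun _ => (0:ℝ)) (f1_cont H) (Gam_cont.comp ((f1_cont H).comp (f := fun p : (X × ℝ) × ℂ => (p.1, Gai p.2))
      (continuous_fst.prodMk (Gai_cont.comp continuous_snd)))) continuous_const (by fun_prop) ?_
    rintro ⟨⟨x, t⟩, w⟩ hw
    simp only at hw
    show f1 (F x) t w = Gam (f1 (F x) t (Gai w))
    rw [f1_bd H x hw.symm, f1_bd H x (by rw [Gai_re, ← hw, neg_zero]), ← H.gam, Gam_Gai]
  gam p := F1_gam H p.1 p.2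
  bij p := F1_bij H p.1 p.2
  ends := by
    rintro ⟨x0, t0⟩ M
    obtain ⟨T, hT⟩ := H.ends x0 (M + 2 * (CL (F x0) + 1))
    have hB : ∀ᶠ x in 𝓝 x0, CL (F x) < CL (F x0) + 1 := (CL_cont H).continuousAt.eventually_lt_const (by linarith)
    set M' := M + (CL (F x0) + 1) with hM
    refine ⟨|T| + |M'|, ?_⟩
    filter_upwards [continuousAt_fst.eventually (hT.and hB)] with ⟨x, t⟩ ⟨h1, h2⟩ w hw
    simp only at h1 h2
    show M ≤ (F1 (F x) t w).re
    have hw0 : 0 ≤ w.re := by linarith [abs_nonneg T, abs_nonneg M']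
    have hL : ∀ z ∈ cD, |(Lq (F x) z).re| ≤ CL (F x0) + 1 := fun z hz =>
      (abs_re_le_norm _).trans ((CL_le H x hz).trans h2.le)
    rw [F1, if_pos hw0, f1]
    suffices h : M' ≤ (eta (F x) (w - aa t w.re) + aa t w.re).re by
      rw [Lam, sub_re]
      linarith [(abs_le.1 (hL _ (pr_mem (exp (-(eta (F x) (w - aa t w.re) + aa t w.re)))))).2]
    rcases le_or_gt M' (aa t w.re) with h | h
    · exact h.trans (et_re H x t)
    · have h3 := h1 (w - aa t w.re) (by rw [sub_re, ofReal_re]; linarith [le_abs_self T, le_abs_self M'])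
      have h4 := (abs_le.1 (hL _ (((J1_adm H).adm x).unif.hm (pr_mem (exp (-(w - aa t w.re))))))).1
      rw [eta, add_re, add_re, ofReal_re]
      linarith [aa_nonneg t hw0]
end

def sh (l s : ℝ) : ℂ := ((s + l * (π / 4) : ℝ) : ℂ) * 𝕚
def Gs (F : ℂ → ℂ) (l s : ℝ) (w : ℂ) : ℂ := (F (l * w + sh l s) - sh l s) / l
def vS (l s : ℝ) (u : ℂ) : ℂ := (u - sh l s) / l
lemma sh_re (l s : ℝ) : (sh l s).re = 0 := by simp [sh]
lemma sh_im (l s : ℝ) : (sh l s).im = s + l * (π / 4) := by simp [sh]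
lemma vS_im {l : ℝ} (hl : 0 < l) (s : ℝ) (u : ℂ) : (vS l s u).im = (u.im - s) / l - π / 4 := by
  rw [vS, div_ofReal_im, sub_im, sh_im]; field_simp; ring
lemma Gs_vS {l : ℝ} (hl : 0 < l) (F : ℂ → ℂ) (s : ℝ) (u : ℂ) : Gs F l s (vS l s u) = vS l s (F u) := by
  have : (l:ℂ) ≠ 0 := by exact_mod_cast hl.ne'
  rw [Gs, vS, mul_div_cancel₀ _ this, sub_add_cancel, vS]
lemma Psi_gt (H : GFam G) (x : X) (hw : w ∈ St) (h : -(π / 4) < w.im) : -(π / 4) < (Psi (G x) w).im := by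
  rcases (show |w.im| ≤ π / 4 from hw).lt_or_eq with h1 | h1
  · exact (abs_lt.1 (Psi_So H x h1)).1
  · rw [Psi_orient H x h1]; exact h
lemma Psi_lt (H : GFam G) (x : X) (hw : w ∈ St) (h : w.im < π / 4) : (Psi (G x) w).im < π / 4 := by
  rcases (show |w.im| ≤ π / 4 from hw).lt_or_eq with h1 | h1
  · exact (abs_lt.1 (Psi_So H x h1)).2
  · rw [Psi_orient H x h1]; exact h
lemma vS_St {l : ℝ} (hl : 0 < l) {s : ℝ} {u : ℂ} (h1 : s ≤ u.im) (h2 : u.im ≤ s + l * (π / 2)) : vS l s u ∈ St := by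
  show |(vS l s u).im| ≤ _
  rw [vS_im hl, abs_le]
  have h3 : 0 ≤ (u.im - s) / l := div_nonneg (by linarith) hl.le
  have h4 : (u.im - s) / l ≤ π / 2 := by rw [div_le_iff₀ hl]; linarith
  constructor <;> linarith
lemma vS_gt {l : ℝ} (hl : 0 < l) {s : ℝ} {u : ℂ} (h1 : s < u.im) : -(π / 4) < (vS l s u).im := by
  rw [vS_im hl]
  have h3 : 0 < (u.im - s) / l := div_pos (by linarith) hl
  linarith
lemma vS_lt {l : ℝ} (hl : 0 < l) {s : ℝ} {u : ℂ} (h1 : u.im < s + l * (π / 2)) : (vS l s u).im < π / 4 := by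
  rw [vS_im hl]
  have h4 : (u.im - s) / l < π / 2 := by rw [div_lt_iff₀ hl]; linarith
  linarith
lemma vS_bot {l : ℝ} (hl : 0 < l) (u : ℂ) : (vS l u.im u).im = -(π / 4) := by
  rw [vS_im hl]; simp
lemma vS_top {l : ℝ} (hl : 0 < l) {s : ℝ} {u : ℂ} (h : u.im = s + l * (π / 2)) : (vS l s u).im = π / 4 := by
  rw [vS_im hl, h]; field_simp; ring
lemma vS_cont {l : ℝ} (s : ℝ) : Continuous (vS l s) := by unfold vS; fun_prop
structure Dat (F : X → ℂ → ℂ) (l : X → ℝ) : Prop where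
  fam : Fam F
  lc : Continuous l
  l1 : ∀ x, 1 ≤ l x
  disp : ∀ x w, ‖F x w - w‖ ≤ l x / 20
section
variable {F : X → ℂ → ℂ} {l : X → ℝ} (H : Dat F l)
include H
lemma Dat.pos (x : X) : 0 < l x := zero_lt_one.trans_le (H.l1 x)
lemma Dat.ne (x : X) : (l x : ℂ) ≠ 0 := by exact_mod_cast (H.pos x).ne'
lemma Dat.g : GFam fun y : X × ℝ => Gs (F y.1) (l y.1) y.2 where
  cont := by
    have h0 := H.lc
    have h1 : Continuous fun p : (X × ℝ) × ℂ => sh (l p.1.1) p.1.2 := by unfold sh; fun_prop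
    unfold Gs
    exact ((H.fam.cont.comp (f := fun p : (X × ℝ) × ℂ => (p.1.1, l p.1.1 * p.2 + sh (l p.1.1) p.1.2)) (by fun_prop)).sub h1).div
      (by fun_prop) fun p => H.ne _
  homeo := by
    rintro ⟨x, s⟩
    have h1 : IsHomeomorph fun w : ℂ => l x * w + sh (l x) s :=
      ((Homeomorph.mulLeft₀ (l x : ℂ) (H.ne x)).trans (Homeomorph.addRight (sh (l x) s))).isHomeomorph
    have h2 : IsHomeomorph fun w : ℂ => (w - sh (l x) s) / l x := by
      simp only [div_eq_mul_inv]
      exact ((Homeomorph.subRight (sh (l x) s)).trans (Homeomorph.mulRight₀ (l x : ℂ)⁻¹ (inv_ne_zero (H.ne x)))).isHomeomorph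
    exact h2.comp ((H.fam.homeo x).comp h1)
  disp := by
    rintro ⟨x, s⟩ w
    have h1 := H.disp x (l x * w + sh (l x) s)
    have h2 := H.pos x
    simp only [Gs]
    rw [show (F x (l x * w + sh (l x) s) - sh (l x) s) / l x - w = (F x (l x * w + sh (l x) s) - (l x * w + sh (l x) s)) / l x by
      field_simp [H.ne x]; ring, norm_div, norm_real, norm_of_nonneg h2.le, div_le_iff₀ h2]
    linarith
abbrev Om (F : ℂ → ℂ) (l s : ℝ) (u : ℂ) : ℝ := (Psi (Gs F l s) (vS l s u)).im
lemma Om_bot (x : X) (u : ℂ) : Om (F x) (l x) u.im u = -(π / 4) := by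
  have h := vS_bot (H.pos x) u
  exact (Psi_orient H.g (x, u.im) (by rw [h, abs_neg, abs_of_pos (by positivity)])).trans h
lemma Om_top (x : X) {u : ℂ} {s : ℝ} (hs : u.im = s + l x * (π / 2)) : Om (F x) (l x) s u = π / 4 := by
  have h := vS_top (H.pos x) hs
  exact (Psi_orient H.g (x, s) (by rw [h, abs_of_pos (by positivity)])).trans h
lemma Om_bd (x : X) {u : ℂ} {s s' : ℝ} (hs : s' < s) (h1 : s ≤ u.im) (h2 : u.im ≤ s' + l x * (π / 2))
    (h : u.im = s ∨ u.im = s' + l x * (π / 2)) : Om (F x) (l x) s u < Om (F x) (l x) s' u := by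
  have hl := H.pos x
  rcases h with h | h
  · subst h
    rw [Om_bot H]
    exact Psi_gt H.g (x, s') (vS_St hl hs.le h2) (vS_gt hl hs)
  · rw [Om_top H x h]
    exact Psi_lt H.g (x, s) (vS_St hl h1 (by linarith)) (vS_lt hl (by linarith))
lemma Om_lt (x : X) {u : ℂ} {s s' : ℝ} (hs : s' < s) (h1 : s ≤ u.im) (h2 : u.im ≤ s' + l x * (π / 2)) :
    Om (F x) (l x) s u < Om (F x) (l x) s' u := by
  have hl := H.pos x
  rcases h1.lt_or_eq with h1' | h1'
  swap; · exact Om_bd H x hs h1 h2 (Or.inl h1'.symm)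
  rcases h2.lt_or_eq with h2' | h2'
  swap; · exact Om_bd H x hs h1 h2 (Or.inr h2')
  set b := s' + l x * (π / 2) with hb
  let e := (H.fam.homeo x).homeomorph
  have heF : ∀ u, e u = F x u := fun u => rfl
  have hFe : ∀ W, F x (e.symm W) = W := fun W => e.apply_symm_apply W
  let O : Set ℂ := Complex.im ⁻¹' Ioo s b
  have hO : IsOpen O := isOpen_Ioo.preimage continuous_im
  let V : Set ℂ := F x '' O
  have hV : IsOpen V := (H.fam.homeo x).isOpenMap _ hO
  have hVe : ∀ W ∈ V, e.symm W ∈ O := by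
    rintro _ ⟨u, hu, rfl⟩
    rw [← heF, e.symm_apply_apply]; exact hu
  let g : ℝ → ℂ → ℂ := fun s W => Psi (Gs (F x) (l x) s) (vS (l x) s (e.symm W))
  have hgc : ∀ s, Continuous (g s) := fun s => (Psi_c1 H.g (x, s)).comp ((vS_cont s).comp e.symm.continuous)
  have hgF : ∀ s u, (g s (F x u)).im = Om (F x) (l x) s u := fun s u => by
    simp only [g]; rw [← heF, e.symm_apply_apply]
  have hgd : ∀ r, (∀ u ∈ O, r < u.im ∧ u.im < r + l x * (π / 2)) → DifferentiableOn ℂ (g r) V := by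
    intro r hr
    have hm : ∀ W ∈ V, vS (l x) r (e.symm W) ∈ So := fun W hW =>
      abs_lt.2 ⟨vS_gt hl (hr _ (hVe W hW)).1, vS_lt hl (hr _ (hVe W hW)).2⟩
    refine inj_inv_holo (p := vS (l x) r) So_open (psi_diff H.g (x, r)) ((psi_inj H.g (x, r)).mono So_sub) hV
      (fun W hW => Psi_So H.g (x, r) (hm W hW)) (fun W hW => ?_) (by unfold vS; fun_prop)
    simp only [g]
    rw [Phi_Psi (H.g.adm.adm (x, r)) (So_sub (hm W hW)), Gs_vS hl, hFe]
  let f : ℂ → ℂ := fun W => exp (-𝕚 * (g s W - g s' W))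
  have hfn : ∀ W, ‖f W‖ = Real.exp ((g s W).im - (g s' W).im) := fun W => by simp [f, norm_exp]
  have hfd : DifferentiableOn ℂ f V := by
    refine DifferentiableOn.cexp (DifferentiableOn.const_mul ((hgd s fun u hu => ⟨hu.1, ?_⟩).sub (hgd s' fun u hu => ⟨?_, ?_⟩)) _)
    · have := hu.2; linarith
    · have := hu.1; linarith
    · have := hu.2; linarith
  have hfc : Continuous f := by have := hgc s; have := hgc s'; fun_prop
  have hcl : ∀ W ∈ closure V, e.symm W ∈ Complex.im ⁻¹' Icc s b := fun W hW =>
    closure_minimal (t := e.symm ⁻¹' (Complex.im ⁻¹' Icc s b)) (fun W hW => ⟨(hVe W hW).1.le, (hVe W hW).2.le⟩)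
      ((isClosed_Icc.preimage continuous_im).preimage e.symm.continuous) hW
  have hle : ∀ W ∈ V, ‖f W‖ ≤ 1 := by
    refine PL hV (H := |s| + |b| + l x / 20) ?_ hfd hfc.continuousOn (M := Real.exp (π / 2)) ?_ ?_
    · rintro _ ⟨u, hu, rfl⟩
      have h3 := (abs_im_le_norm _).trans (H.disp x u)
      rw [sub_im, abs_le] at h3
      rw [abs_le]
      constructor <;> linarith [hu.1, hu.2, neg_abs_le s, le_abs_self b, abs_nonneg s, abs_nonneg b]
    · intro W hW
      rw [hfn, exp_le_exp]
      have h3 := (abs_le.1 (show |(g s W).im| ≤ π / 4 from Psi_mem (H.g.adm.adm (x, s)) _)).2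
      have h4 := (abs_le.1 (show |(g s' W).im| ≤ π / 4 from Psi_mem (H.g.adm.adm (x, s')) _)).1
      linarith
    · intro W hW
      rw [hV.frontier_eq] at hW
      have h3 := hcl W hW.1
      have h4 : e.symm W ∉ O := fun h => hW.2 ⟨_, h, hFe W⟩
      rw [hfn, exp_le_one_iff, sub_nonpos]
      refine (Om_bd H x hs h3.1 h3.2 ?_).le
      by_contra hc
      push Not at hc
      exact h4 ⟨lt_of_le_of_ne h3.1 (Ne.symm hc.1), lt_of_le_of_ne h3.2 hc.2⟩
  by_contra hcon
  push Not at hcon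
  have huO : u ∈ O := ⟨h1', h2'⟩
  have h5 : 1 ≤ ‖f (F x u)‖ := by rw [hfn, hgF, hgF]; exact Real.one_le_exp (by linarith)
  have h6 := Complex.norm_eqOn_closure_of_isPreconnected_of_isMaxOn (f := f) (c := F x u)
    (((convex_Ioo s b).linear_preimage Complex.imLm).isPreconnected.image (F x) (H.fam.homeo x).continuous.continuousOn) hV
    ⟨hfd, hfc.continuousOn⟩ ⟨u, huO, rfl⟩ (fun W hW => (hle W hW).trans h5)
  set u1 : ℂ := u.re + s * 𝕚 with hu1
  have hu1i : u1.im = s := by simp [hu1]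
  have h7 : u1 ∈ closure O := by
    rw [← Complex.isOpenMap_im.preimage_closure_eq_closure_preimage continuous_im, closure_Ioo (by linarith)]
    exact ⟨hu1i.ge, by rw [hu1i]; linarith⟩
  have h8 := h6 (image_closure_subset_closure_image (H.fam.homeo x).continuous ⟨u1, h7, rfl⟩)
  simp only [Function.comp, Function.const] at h8
  rw [← h8, hfn, hgF, hgF, Real.one_le_exp_iff] at h5
  linarith [Om_bd H x (u := u1) hs hu1i.ge (by rw [hu1i]; linarith) (Or.inl hu1i)]
end

def bt (l x : ℝ) : ℂ := ((x / l : ℝ) : ℂ) - ((π / 4 : ℝ) : ℂ) * 𝕚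
lemma bt_re (l x : ℝ) : (bt l x).re = x / l := by simp [bt]
lemma bt_im (l x : ℝ) : (bt l x).im = -(π / 4) := by simp [bt]
lemma bt_St (l x : ℝ) : bt l x ∈ St := by
  show |(bt l x).im| ≤ _
  rw [bt_im, abs_neg, abs_of_pos (by positivity)]
lemma bt_abs (l x : ℝ) : |(bt l x).im| = π / 4 := by rw [bt_im, abs_neg, abs_of_pos (by positivity)]
def qS (F : ℂ → ℂ) (l c : ℝ) (w : ℂ) : ℂ := Psi (Gs F l w.im) (bt l w.re) + (c : ℂ) * 𝕚
def F2 (F : ℂ → ℂ) (l c : ℝ) (w : ℂ) : ℂ := l * Gs F l w.im (Phi (Gs F l w.im) (qS F l c w)) + sh l w.im - ((l * c : ℝ) : ℂ) * 𝕚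
section
variable {F : X → ℂ → ℂ} {l : X → ℝ} (H : Dat F l)
include H
lemma qS_im (x : X) (c : ℝ) (w : ℂ) : (qS (F x) (l x) c w).im = c - π / 4 := by
  have := Psi_orient H.g (x, w.im) (bt_abs (l x) w.re)
  simp only [bt_im] at this
  rw [qS, add_im, this]; simp; ring
lemma qS_St (x : X) {c : ℝ} (hc : c ∈ Icc 0 (π / 4)) (w : ℂ) : qS (F x) (l x) c w ∈ St := by
  show |(qS _ _ _ _).im| ≤ _
  rw [qS_im H, abs_le]
  constructor <;> linarith [hc.1, hc.2, pi_pos]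
lemma F2_eq (x : X) (c : ℝ) (w : ℂ) : F2 (F x) (l x) c w =
    F x (l x * Phi (Gs (F x) (l x) w.im) (qS (F x) (l x) c w) + sh (l x) w.im) - ((l x * c : ℝ) : ℂ) * 𝕚 := by
  rw [F2, Gs, mul_div_cancel₀ _ (H.ne x)]; ring
lemma F2_zero (x : X) : F2 (F x) (l x) 0 = F x := by
  funext w
  have h := Phi_Psi (H.g.adm.adm (x, w.im)) (bt_St (l x) w.re)
  simp only at h
  rw [F2_eq H, qS, ofReal_zero, zero_mul, add_zero, h, mul_zero, ofReal_zero, zero_mul, sub_zero]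
  congr 1
  have := H.pos x
  apply cxt
  · simp [bt_re, sh_re]; field_simp
  · simp [bt_im, sh_im]
lemma F2_iff (x : X) {c : ℝ} (hc : c ∈ Icc 0 (π / 4)) {u y : ℂ} (hu : F x u = y + ((l x * c : ℝ) : ℂ) * 𝕚) (w : ℂ) :
    F2 (F x) (l x) c w = y ↔ (w.im ≤ u.im ∧ u.im ≤ w.im + l x * (π / 2)) ∧
      Psi (Gs (F x) (l x) w.im) (vS (l x) w.im u) = qS (F x) (l x) c w := by
  have hA := H.g.adm.adm (x, w.im)
  have hl := H.pos x
  have hlp : 0 < l x * π := mul_pos hl pi_pos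
  have h0 : F2 (F x) (l x) c w = y ↔ Phi (Gs (F x) (l x) w.im) (qS (F x) (l x) c w) = vS (l x) w.im u := by
    rw [F2_eq H, sub_eq_iff_eq_add, ← hu, (H.fam.bij x).injective.eq_iff, vS, eq_div_iff (H.ne x), eq_sub_iff_add_eq, mul_comm]
  rw [h0]
  constructor
  · intro h
    have h1 : vS (l x) w.im u ∈ St := h ▸ Phi_mem hA _
    have h2 : |(vS (l x) w.im u).im| ≤ π / 4 := h1
    rw [vS_im hl, abs_le] at h2
    have h3 : 0 ≤ (u.im - w.im) / l x := by linarith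
    have h4 : (u.im - w.im) / l x ≤ π / 2 := by linarith
    rw [div_le_iff₀ hl] at h4
    rw [le_div_iff₀ hl] at h3
    exact ⟨⟨by linarith, by linarith⟩, by rw [← h]; exact Psi_Phi hA (qS_St H x hc w)⟩
  · rintro ⟨⟨h1, h2⟩, h3⟩
    rw [← h3]
    exact Phi_Psi hA (vS_St hl h1 h2)
lemma F2_bij (x : X) {c : ℝ} (hc : c ∈ Icc 0 (π / 4)) : Bijective (F2 (F x) (l x) c) := by
  have hl := H.pos x
  have hlp : 0 < l x * π := mul_pos hl pi_pos
  have hpi := pi_pos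
  have key : ∀ y, ∃! w, F2 (F x) (l x) c w = y := by
    intro y
    obtain ⟨u, hu⟩ := (H.fam.bij x).surjective (y + ((l x * c : ℝ) : ℂ) * 𝕚)
    simp only [F2_iff H x hc hu]
    have hcont : Continuous fun s => Om (F x) (l x) s u := by
      have h0 := (Psi_cont H.g).comp (f := fun s : ℝ => (((x, s), vS (l x) s u) : (X × ℝ) × ℂ)) (by unfold vS sh; fun_prop)
      exact continuous_im.comp h0
    obtain ⟨s, hs, hs'⟩ := intermediate_value_Icc' (f := fun s => Om (F x) (l x) s u) (a := u.im - l x * (π / 2)) (b := u.im) (by nlinarith) hcont.continuousOn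
      (show c - π / 4 ∈ _ by
        rw [Om_bot H, Om_top H x (by ring)]; exact ⟨by linarith [hc.1], by linarith [hc.2]⟩)
    have hA := H.g.adm.adm (x, s)
    set p := Psi (Gs (F x) (l x) s) (vS (l x) s u) - (c : ℂ) * 𝕚 with hp
    have hpi : p.im = -(π / 4) := by
      have : (Psi (Gs (F x) (l x) s) (vS (l x) s u)).im = c - π / 4 := hs'
      rw [hp, sub_im, this]; simp
    have hpa : |p.im| = π / 4 := by rw [hpi, abs_neg, abs_of_pos (by positivity)]
    have hph := Phi_orient H.g (x, s) hpa
    simp only at hph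
    set r := Phi (Gs (F x) (l x) s) p with hr
    have hrb : bt (l x) (l x * r.re) = r := by
      apply cxt
      · rw [bt_re]; field_simp
      · rw [bt_im, hph, hpi]
    have hPr : Psi (Gs (F x) (l x) s) r = p := Psi_Phi hA (show |p.im| ≤ _ from hpa.le)
    refine ⟨⟨l x * r.re, s⟩, ⟨⟨hs.2, by linarith [hs.1]⟩, ?_⟩, ?_⟩
    · rw [qS]
      simp only
      rw [hrb, hPr, hp]; ring
    · rintro w ⟨⟨h1, h2⟩, h3⟩
      have h4 : Om (F x) (l x) w.im u = c - π / 4 := by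
        rw [Om, h3, qS_im H]
      have h5 : w.im = s := by
        rcases lt_trichotomy w.im s with h | h | h
        · have := Om_lt H x h hs.2 h2
          simp only at hs'
          linarith
        · exact h
        · have := Om_lt H x h h1 (by linarith [hs.1])
          simp only at hs'
          linarith
      have h6 : Psi (Gs (F x) (l x) s) (bt (l x) w.re) = p := by
        rw [← h5, hp, ← h5, h3, qS]; ring
      have h7 : bt (l x) w.re = r := by
        rw [hr, ← h6]; exact (Phi_Psi hA (bt_St _ _)).symm
      apply cxt
      · have := congrArg Complex.re h7
        rw [bt_re, div_eq_iff hl.ne'] at this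
        rw [this, mul_comm]
      · exact h5
  exact ⟨fun a b h => (key (F2 (F x) (l x) c b)).unique h rfl, fun y => (key y).exists⟩
lemma bt_nn (l r : ℝ) : bt l (-r) = nn (bt l r) := by apply cxt <;> simp [bt_re, bt_im, nn_re, nn_im, neg_div]
lemma F2_gam (x : X) {c : ℝ} (hc : c ∈ Icc 0 (π / 4)) (w : ℂ) : F2 (F x) (l x) c (Gam w) = Gam (F2 (F x) (l x) c w) := by
  have hn : ∀ v, Gs (F x) (l x) (w.im + π) (nn v) = nn (Gs (F x) (l x) w.im v) := by
    intro v
    have e : l x * nn v + sh (l x) (w.im + π) = Gam (l x * v + sh (l x) w.im) := by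
      apply cxt <;> simp [Gam_re, Gam_im, nn_re, nn_im, sh_re, sh_im]; ring
    rw [Gs, e, H.fam.gam, Gs]
    apply cxt
    · simp only [nn_re, Complex.div_ofReal_re, sub_re, Gam_re, sh_re]; ring
    · simp only [nn_im, div_ofReal_im, sub_im, Gam_im, sh_im]; ring
  have h1 := strip_nsym H.g (x := (x, w.im)) (y := (x, w.im + π)) hn (bt_St (l x) w.re) (c := c) (qS_St H x hc w)
  simp only at h1
  rw [F2, qS, Gam_im, Gam_re, bt_nn H, h1, hn, F2, qS]
  apply cxt
  · simp [nn_re, Gam_re, sh_re]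
  · simp [nn_im, Gam_im, sh_im]; ring
lemma F2_id {x : X} (h : ∀ w, F x w = w) {c : ℝ} (hc : c ∈ Icc 0 (π / 4)) (w : ℂ) : F2 (F x) (l x) c w = w := by
  have hn : ∀ v, Gs (F x) (l x) w.im v = v := fun v => by rw [Gs, h, add_sub_cancel_right, mul_div_cancel_left₀ _ (H.ne x)]
  have h1 := strip_id H.g (x := (x, w.im)) hn (bt_St (l x) w.re) (c := c) (by
    show |(_ + _ : ℂ).im| ≤ _
    rw [add_im, bt_im, abs_le]; simp; constructor <;> linarith [hc.1, hc.2, pi_pos])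
  simp only at h1
  rw [F2, qS, h1, hn]
  have := H.pos x
  apply cxt
  · simp [bt_re, sh_re]; field_simp
  · simp [bt_im, sh_im]; ring
def cq (t : ℝ) : ℝ := max 0 (min 1 t) * (π / 4)
omit H in
lemma cq_mem (t : ℝ) : cq t ∈ Icc 0 (π / 4) :=
  ⟨mul_nonneg (le_max_left _ _) (by positivity), mul_le_of_le_one_left (by positivity) (max_le zero_le_one (min_le_left _ _))⟩
lemma F2_fam : Fam fun p : X × ℝ => F2 (F p.1) (l p.1) (cq p.2) where
  gam p := F2_gam H p.1 (cq_mem _)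
  bij p := F2_bij H p.1 (cq_mem _)
  cont := by
    have h0 := H.lc
    have hn := fun x => (H.pos x).ne'
    have hb : Continuous fun p : (X × ℝ) × ℂ => bt (l p.1.1) p.2.re := by
      unfold bt
      have : Continuous fun p : (X × ℝ) × ℂ => p.2.re / l p.1.1 := Continuous.div (by fun_prop) (by fun_prop) fun p => hn _
      fun_prop
    have hy : Continuous fun p : (X × ℝ) × ℂ => (p.1.1, p.2.im) := by fun_prop
    have h1 := (Psi_cont H.g).comp (hy.prodMk hb)
    have h2 : Continuous fun p : (X × ℝ) × ℂ => qS (F p.1.1) (l p.1.1) (cq p.1.2) p.2 := h1.add (by unfold cq; fun_prop)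
    have h3 := (Phi_cont H.g).comp (hy.prodMk h2)
    have h4 := H.g.cont.comp (hy.prodMk h3)
    exact ((Continuous.mul (by fun_prop) h4).add (by unfold sh; fun_prop)).sub (by unfold cq; fun_prop)
  ends := by
    refine ends_of_slices (fun p => F2_gam H p.1 (cq_mem _)) ?_
    rintro ⟨x0, t0⟩ s0 M
    obtain ⟨T1, h1⟩ := Phi_top H.g (x0, s0) (|M| + 1)
    obtain ⟨T2, h2⟩ := Psi_top H.g (x0, s0) T1
    have h3 : ∀ᶠ y : X × ℝ in 𝓝 (x0, s0), l y.1 < l x0 + 1 :=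
      (H.lc.comp continuous_fst).continuousAt.eventually_lt_const (by simp)
    refine ⟨|T2| * (l x0 + 1), ?_⟩
    have hc : Tendsto (fun p : (X × ℝ) × ℝ => (p.1.1, p.2)) (𝓝 ((x0, t0), s0)) (𝓝 (x0, s0)) :=
      Continuous.tendsto' (by fun_prop) _ _ rfl
    filter_upwards [hc.eventually h1, hc.eventually h2, hc.eventually h3] with ⟨⟨x, t⟩, s⟩ h1 h2 h3 w hw hT
    simp only at h1 h2 h3 hw
    subst hw
    have hl := H.pos x
    have h4 := h2 (bt (l x) w.re) (by
      rw [bt_re, le_div_iff₀ hl]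
      nlinarith [le_abs_self T2, abs_nonneg T2])
    have h5 := h1 (qS (F x) (l x) (cq t) w) (by rw [qS]; simpa using h4)
    have h6 := (abs_re_le_norm _).trans (H.g.disp (x, w.im) (Phi (Gs (F x) (l x) w.im) (qS (F x) (l x) (cq t) w)))
    rw [sub_re, abs_le] at h6
    simp only at h6
    have h7 : |M| ≤ (Gs (F x) (l x) w.im (Phi (Gs (F x) (l x) w.im) (qS (F x) (l x) (cq t) w))).re := by linarith
    simp only [F2, add_re, sub_re, Complex.re_ofReal_mul, sh_re, I_re, mul_zero, sub_zero, add_zero]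
    nlinarith [le_abs_self M, abs_nonneg M, H.l1 x]
lemma F2_mono (x : X) (s : ℝ) : StrictMono fun r : ℝ => (F2 (F x) (l x) (cq 1) (r + s * 𝕚)).re := by
  have hl := H.pos x
  have hcq : cq 1 = π / 4 := by simp [cq]
  have hA := H.g.adm.adm (x, s)
  have hq : ∀ r : ℝ, qS (F x) (l x) (cq 1) (r + s * 𝕚) = ((Psi (Gs (F x) (l x) s) (bt (l x) r)).re : ℝ) := by
    intro r
    apply cxt
    · simp [qS]
    · rw [qS_im H, hcq]; simp
  have hi : Injective fun r : ℝ => (Psi (Gs (F x) (l x) s) (bt (l x) r)).re := by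
    intro a b h
    simp only at h
    have h1 := Psi_orient H.g (x, s) (bt_abs (l x) a)
    have h2 := Psi_orient H.g (x, s) (bt_abs (l x) b)
    rw [bt_im] at h1 h2
    have h3 : Psi (Gs (F x) (l x) s) (bt (l x) a) = Psi (Gs (F x) (l x) s) (bt (l x) b) := cxt h (h1.trans h2.symm)
    have h4 := Phi_Psi hA (bt_St (l x) a)
    simp only at h4
    rw [h3] at h4
    have h5 := congrArg Complex.re (h4.symm.trans (Phi_Psi hA (bt_St (l x) b)))
    rw [bt_re, bt_re, div_left_inj' hl.ne'] at h5
    exact h5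
  have hc : Continuous fun r : ℝ => (Psi (Gs (F x) (l x) s) (bt (l x) r)).re :=
    continuous_re.comp ((Psi_c1 H.g (x, s)).comp (by unfold bt; fun_prop))
  have hm : StrictMono fun r : ℝ => (Psi (Gs (F x) (l x) s) (bt (l x) r)).re := by
    rcases hc.strictMono_of_inj hi with h | h
    · exact h
    · obtain ⟨T, hT⟩ := Psi_top H.g (x, s) ((Psi (Gs (F x) (l x) s) (bt (l x) 0)).re)
      have h1 := hT.self_of_nhds (bt (l x) ((|T| + 1) * l x)) (by
        rw [bt_re, mul_div_assoc, div_self hl.ne']; linarith [le_abs_self T])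
      have h2 := h (show (0:ℝ) < (|T| + 1) * l x by positivity)
      simp only at h1 h2
      linarith
  intro a b hab
  have h1 := psi_mono H.g (x, s) (hm hab)
  simp only [F2, add_re, sub_re, hq]
  simp at h1 ⊢
  exact mul_lt_mul_of_pos_left h1 hl
lemma F2_im (x : X) (w : ℂ) : |(F2 (F x) (l x) (cq 1) w).im - w.im| ≤ l x / 20 := by
  have hl := H.pos x
  have hcq : cq 1 = π / 4 := by simp [cq]
  have h0 : (qS (F x) (l x) (cq 1) w).im = 0 := by rw [qS_im H, hcq, sub_self]
  have h1 := psi_im H.g (x, w.im) (ζ := qS (F x) (l x) (cq 1) w) (by show |(qS _ _ _ _).im| < _; rw [h0, abs_zero]; positivity)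
  rw [h0, sub_zero] at h1
  rw [F2, hcq] at *
  simp only [add_im, sub_im, sh_im, Complex.im_ofReal_mul, I_im, mul_one]
  rw [show ∀ a : ℝ, l x * a + (w.im + l x * (π / 4)) - l x * (π / 4) - w.im = l x * a by intro a; ring, abs_mul, abs_of_pos hl]
  have := mul_le_mul_of_nonneg_left h1 hl.le
  simp only at this
  linarith
end

def cl (t : ℝ) : ℝ := max 0 (min 1 t)
lemma cl_cont : Continuous cl := by unfold cl; fun_prop
lemma cl_mem (t : ℝ) : 0 ≤ cl t ∧ 0 ≤ 1 - cl t := ⟨le_max_left _ _, sub_nonneg.2 (max_le zero_le_one (min_le_left _ _))⟩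
lemma cl_zero : cl 0 = 0 := by simp [cl]
lemma cl_one : cl 1 = 1 := by simp [cl]
lemma conv_mono {f g : ℝ → ℝ} (hf : StrictMono f) (hg : StrictMono g) (t : ℝ) : StrictMono fun r => (1 - cl t) * f r + cl t * g r := by
  intro a b h
  have h1 := hf h
  have h2 := hg h
  obtain ⟨h3, h4⟩ := cl_mem t
  rcases h3.eq_or_lt with h5 | h5
  · simp only [← h5]; linarith
  · have h6 := mul_lt_mul_of_pos_left h2 h5
    have h7 := mul_le_mul_of_nonneg_left h1.le h4
    simp only; linarith
def F3 (A : ℂ → ℂ) (t : ℝ) (w : ℂ) : ℂ := ((A w).re : ℂ) + (((1 - cl t) * (A w).im + cl t * w.im : ℝ) : ℂ) * 𝕚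
def F4 (A : ℂ → ℂ) (t : ℝ) (w : ℂ) : ℂ := (((1 - cl t) * (A w).re + cl t * w.re : ℝ) : ℂ) + (w.im : ℂ) * 𝕚
lemma F3_re (A : ℂ → ℂ) (t : ℝ) (w : ℂ) : (F3 A t w).re = (A w).re := by simp [F3]
lemma F3_im (A : ℂ → ℂ) (t : ℝ) (w : ℂ) : (F3 A t w).im = (1 - cl t) * (A w).im + cl t * w.im := by simp [F3]
lemma F4_re (A : ℂ → ℂ) (t : ℝ) (w : ℂ) : (F4 A t w).re = (1 - cl t) * (A w).re + cl t * w.re := by simp [F4]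
lemma F4_im (A : ℂ → ℂ) (t : ℝ) (w : ℂ) : (F4 A t w).im = w.im := by simp [F4]
lemma F3_zero (A : ℂ → ℂ) : F3 A 0 = A := by funext w; apply cxt <;> simp [F3_re, F3_im, cl_zero]
lemma F34 (A : ℂ → ℂ) : F3 A 1 = F4 A 0 := by funext w; apply cxt <;> simp [F3_re, F3_im, F4_re, F4_im, cl_zero, cl_one]
lemma F4_one (A : ℂ → ℂ) (w : ℂ) : F4 A 1 w = w := by apply cxt <;> simp [F4_re, F4_im, cl_one]
lemma F3_id {A : ℂ → ℂ} (h : ∀ w, A w = w) (t : ℝ) (w : ℂ) : F3 A t w = w := by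
  apply cxt <;> simp only [F3_re, F3_im, h]; ring
lemma F4_id {A : ℂ → ℂ} (h : ∀ w, A w = w) (t : ℝ) (w : ℂ) : F4 A t w = w := by
  apply cxt <;> simp only [F4_re, F4_im, h]; ring
lemma surj_of {f : ℝ → ℝ} (hf : Continuous f) (h1 : ∀ M, ∃ r, M ≤ f r) (h2 : ∀ M, ∃ r, f r ≤ M) : Surjective f :=
  fun M => mem_range_of_exists_le_of_exists_ge hf (h2 M) (h1 M)
structure Mon (A : X → ℂ → ℂ) : Prop where
  fam : Fam A
  mono : ∀ x (s : ℝ), StrictMono fun r : ℝ => (A x (r + s * 𝕚)).re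
  bd : ∀ x, ∃ b : ℝ, ∀ w, |(A x w).im - w.im| ≤ b
section
variable {A : X → ℂ → ℂ} (H : Mon A)
include H
lemma conv_ge {t M a b : ℝ} (ha : M ≤ a) (hb : M ≤ b) : M ≤ (1 - cl t) * a + cl t * b := by
  obtain ⟨h3, h4⟩ := cl_mem t
  nlinarith [mul_le_mul_of_nonneg_left ha h4, mul_le_mul_of_nonneg_left hb h3]
lemma conv_le {t M a b : ℝ} (ha : a ≤ M) (hb : b ≤ M) : (1 - cl t) * a + cl t * b ≤ M := by
  obtain ⟨h3, h4⟩ := cl_mem t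
  nlinarith [mul_le_mul_of_nonneg_left ha h4, mul_le_mul_of_nonneg_left hb h3]
lemma F4_fam : Fam fun p : X × ℝ => F4 (A p.1) p.2 where
  cont := by
    have h1 := H.fam.cont.comp (f := fun p : (X × ℝ) × ℂ => (p.1.1, p.2)) (by fun_prop)
    have h2 := continuous_re.comp h1
    have h3 : Continuous fun p : (X × ℝ) × ℂ => cl p.1.2 := cl_cont.comp (by fun_prop)
    exact (continuous_ofReal.comp (((continuous_const.sub h3).mul h2).add (h3.mul (by fun_prop)))).add (by fun_prop)
  gam p w := by
    apply cxt
    · rw [Gam_re, F4_re, F4_re, H.fam.gam, Gam_re, Gam_re]; ring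
    · rw [Gam_im, F4_im, F4_im, Gam_im]
  bij := by
    rintro ⟨x, t⟩
    have hm : ∀ s : ℝ, StrictMono fun r : ℝ => (F4 (A x) t (r + s * 𝕚)).re := fun s => by
      have := conv_mono (H.mono x s) strictMono_id t
      simpa [F4_re] using this
    have hc : ∀ s : ℝ, Continuous fun r : ℝ => (F4 (A x) t (r + s * 𝕚)).re := fun s => by
      have h := slice H.fam.cont x
      simp only [F4_re]; fun_prop
    have hw : ∀ w : ℂ, w = (w.re : ℂ) + (w.im : ℂ) * 𝕚 := fun w => (re_add_im w).symm
    constructor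
    · intro a b h
      have h1 := congrArg Complex.im h
      simp only [F4_im] at h1
      have h2 := congrArg Complex.re h
      rw [hw a, hw b, h1] at h2
      exact cxt ((hm _).injective h2) h1
    · intro y
      have hs : Surjective fun r : ℝ => (F4 (A x) t (r + y.im * 𝕚)).re := by
        refine surj_of (hc _) (fun M => ?_) fun M => ?_
        · obtain ⟨T, hT⟩ := H.fam.ends x M
          refine ⟨max T M, ?_⟩
          rw [F4_re]
          exact conv_ge H (hT.self_of_nhds _ (by simp)) (by simp)
        · obtain ⟨T, hT⟩ := H.fam.ends' x M
          refine ⟨min T M, ?_⟩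
          rw [F4_re]
          exact conv_le H (hT.self_of_nhds _ (by simp)) (by simp)
      obtain ⟨r, hr⟩ := hs y.re
      exact ⟨r + y.im * 𝕚, cxt hr (by simp [F4_im])⟩
  ends := by
    rintro ⟨x, t⟩ M
    obtain ⟨T, hT⟩ := H.fam.ends x M
    refine ⟨max T M, ?_⟩
    filter_upwards [continuousAt_fst.eventually hT] with p hp w hw
    rw [F4_re]
    exact conv_ge H (hp w ((le_max_left _ _).trans hw)) ((le_max_right _ _).trans hw)
lemma F3_fam : Fam fun p : X × ℝ => F3 (A p.1) p.2 where
  cont := by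
    have h1 := H.fam.cont.comp (f := fun p : (X × ℝ) × ℂ => (p.1.1, p.2)) (by fun_prop)
    have h3 : Continuous fun p : (X × ℝ) × ℂ => cl p.1.2 := cl_cont.comp (by fun_prop)
    exact (continuous_ofReal.comp (continuous_re.comp h1)).add ((continuous_ofReal.comp
      (((continuous_const.sub h3).mul (continuous_im.comp h1)).add (h3.mul (by fun_prop)))).mul continuous_const)
  gam p w := by
    apply cxt
    · rw [Gam_re, F3_re, F3_re, H.fam.gam, Gam_re]
    · rw [Gam_im, F3_im, F3_im, H.fam.gam, Gam_im, Gam_im]; ring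
  bij := by
    rintro ⟨x, t⟩
    have hE : IsHomeomorph (F4 (A x) 0) := (F4_fam H).homeo (x, 0)
    let e := hE.homeomorph
    have heE : ∀ w, F4 (A x) 0 (e.symm w) = w := fun w => e.apply_symm_apply w
    have hre : ∀ w, (A x (e.symm w)).re = w.re := fun w => by
      have := congrArg Complex.re (heE w)
      rwa [F4_re, cl_zero, zero_mul, add_zero, sub_zero, one_mul] at this
    have him : ∀ w, (e.symm w).im = w.im := fun w => by
      have := congrArg Complex.im (heE w)
      rwa [F4_im] at this
    obtain ⟨b, hb⟩ := H.bd x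
    have hb' : ∀ w, |(A x (e.symm w)).im - w.im| ≤ b := fun w => by rw [← him w]; exact hb _
    have hgc : ∀ r : ℝ, Continuous fun s : ℝ => (A x (e.symm (r + s * 𝕚))).im := fun r => by
      have h := slice H.fam.cont x
      have h' := e.symm.continuous
      fun_prop
    have hgb : ∀ r s : ℝ, |(A x (e.symm (r + s * 𝕚))).im - s| ≤ b := fun r s => by simpa using hb' (r + s * 𝕚)
    have hgm : ∀ r : ℝ, StrictMono fun s : ℝ => (A x (e.symm (r + s * 𝕚))).im := fun r => by
      rcases (hgc r).strictMono_of_inj (fun s s' h => by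
        have h1 : A x (e.symm (r + s * 𝕚)) = A x (e.symm (r + s' * 𝕚)) := cxt (by rw [hre, hre]; simp) h
        have h2 := congrArg Complex.im (e.symm.injective ((H.fam.bij x).injective h1))
        simpa using h2) with h | h
      · exact h
      · have h0 := abs_le.1 (hgb r 0)
        have h1 := abs_le.1 (hgb r (2 * b + 1))
        have h2 := h (show (0:ℝ) < 2 * b + 1 by linarith)
        simp only at h2
        linarith
    have hm : ∀ r : ℝ, StrictMono fun s : ℝ => (F3 (A x) t (e.symm (r + s * 𝕚))).im := fun r => by
      have := conv_mono (hgm r) strictMono_id t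
      simpa [F3_im, him] using this
    have hw : ∀ w : ℂ, w = (w.re : ℂ) + (w.im : ℂ) * 𝕚 := fun w => (re_add_im w).symm
    suffices h : Bijective (F3 (A x) t ∘ e.symm) by
      have := h.comp e.bijective
      rwa [Function.comp_assoc, e.symm_comp_self, Function.comp_id] at this
    constructor
    · intro a b h
      have h1 := congrArg Complex.re h
      simp only [Function.comp, F3_re, hre] at h1
      have h2 := congrArg Complex.im h
      simp only [Function.comp] at h2
      rw [hw a, hw b, h1] at h2
      exact cxt h1 ((hm _).injective h2)
    · intro y
      have hs : Surjective fun s : ℝ => (F3 (A x) t (e.symm (y.re + s * 𝕚))).im := by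
        have hd : ∀ s : ℝ, |(F3 (A x) t (e.symm (y.re + s * 𝕚))).im - s| ≤ b := fun s => by
          have h1 := abs_le.1 (hgb y.re s)
          have hs : (e.symm (y.re + s * 𝕚)).im = s := by simp [him]
          rw [F3_im, hs, abs_le]
          have h2 := conv_ge H (t := t) (M := s - b) (a := (A x (e.symm (y.re + s * 𝕚))).im) (b := s) (by linarith) (by linarith)
          have h3 := conv_le H (t := t) (M := s + b) (a := (A x (e.symm (y.re + s * 𝕚))).im) (b := s) (by linarith) (by linarith)
          constructor <;> linarith
        refine surj_of ?_ (fun M => ⟨M + b, ?_⟩) fun M => ⟨M - b, ?_⟩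
        · have h1 := hgc y.re
          simp only [F3_im, him]
          fun_prop
        · have := abs_le.1 (hd (M + b)); linarith
        · have := abs_le.1 (hd (M - b)); linarith
      obtain ⟨r, hr⟩ := hs y.im
      exact ⟨y.re + r * 𝕚, cxt (by simp [F3_re, hre]) hr⟩
  ends := by
    rintro ⟨x, t⟩ M
    obtain ⟨T, hT⟩ := H.fam.ends x M
    refine ⟨T, ?_⟩
    filter_upwards [continuousAt_fst.eventually hT] with p hp w hw
    rw [F3_re]; exact hp w hw
end
def lF (F : ℂ → ℂ) : ℝ := 20 * (CL F + CE F + 1)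
def AF (F : ℂ → ℂ) : ℂ → ℂ := F2 (F1 F 0) (lF F) (cq 1)
def SS (F : ℂ → ℂ) (t : ℝ) : ℂ → ℂ := if t ≤ 1 then F1 F (1 - t) else if t ≤ 2 then F2 (F1 F 0) (lF F) (cq (t - 1)) else
  if t ≤ 3 then F3 (AF F) (t - 2) else F4 (AF F) (t - 3)
section
variable {F : X → ℂ → ℂ} (H : Fam F)
include H
lemma dat : Dat (fun x => F1 (F x) 0) (fun x => lF (F x)) where
  fam := (F1_fam H).comp (u := fun x : X => (x, (0:ℝ))) (by fun_prop)
  lc := by have := CL_cont H; have := CE_cont H; unfold lF; fun_prop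
  l1 x := by have := (norm_nonneg _).trans (F1_zero H x 0); unfold lF; linarith
  disp x w := by have := F1_zero H x w; unfold lF; linarith
lemma mon : Mon fun x => AF (F x) where
  fam := (F2_fam (dat H)).comp (u := fun x : X => (x, (1:ℝ))) (by fun_prop)
  mono x s := F2_mono (dat H) x s
  bd x := ⟨_, F2_im (dat H) x⟩
lemma SS_fam : Fam fun p : X × ℝ => SS (F p.1) p.2 := by
  have h1 : Fam fun p : X × ℝ => F1 (F p.1) (1 - p.2) := (F1_fam H).comp (u := fun p : X × ℝ => (p.1, 1 - p.2)) (by fun_prop)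
  have h2 : Fam fun p : X × ℝ => F2 (F1 (F p.1) 0) (lF (F p.1)) (cq (p.2 - 1)) :=
    (F2_fam (dat H)).comp (u := fun p : X × ℝ => (p.1, p.2 - 1)) (by fun_prop)
  have h3 : Fam fun p : X × ℝ => F3 (AF (F p.1)) (p.2 - 2) := (F3_fam (mon H)).comp (u := fun p : X × ℝ => (p.1, p.2 - 2)) (by fun_prop)
  have h4 : Fam fun p : X × ℝ => F4 (AF (F p.1)) (p.2 - 3) := (F4_fam (mon H)).comp (u := fun p : X × ℝ => (p.1, p.2 - 3)) (by fun_prop)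
  refine h1.glue (h2.glue (h3.glue h4 3 fun x => ?_) 2 fun x => ?_) 1 fun x => ?_
  · simp only; norm_num; exact F34 _
  · simp only; norm_num; rw [F3_zero, AF]
  · simp only; norm_num
    have := F2_zero (dat H) x
    rw [show cq 0 = 0 by simp [cq], this]
lemma SS_id {x : X} (h : ∀ w, F x w = w) (t : ℝ) (w : ℂ) : SS (F x) t w = w := by
  have hA : ∀ c ∈ Icc 0 (π / 4), ∀ w, F2 (F1 (F x) 0) (lF (F x)) c w = w := fun c hc w =>
    F2_id (dat H) (x := x) (F1_id H h 0) hc w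
  rw [SS]; split_ifs
  · exact F1_id H h _ _
  · exact hA _ (cq_mem _) w
  · exact F3_id (hA _ (cq_mem _)) _ _
  · exact F4_id (hA _ (cq_mem _)) _ _
end
def RR (F : ℂ → ℂ) (t : ℝ) (w : ℂ) : ℂ := SS (fun w => F w - (F 0).im * 𝕚) (4 * t) w + (F 0).im * 𝕚
lemma Fam.addI (H : Fam F) {b : X → ℝ} (hb : Continuous b) : Fam fun x w => F x w + b x * 𝕚 where
  cont := H.cont.add (by fun_prop)
  gam x w := by rw [H.gam, Gam, Gam, nn_add]; ring
  bij x := (Homeomorph.addRight ((b x : ℂ) * 𝕚)).bijective.comp (H.bij x)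
  ends x0 M := by simpa using H.ends x0 M
section
variable {F : X → ℂ → ℂ} (H : Fam F)
include H
lemma a_cont : Continuous fun x => (F x 0).im := continuous_im.comp (H.cont.comp (f := fun x => (x, (0:ℂ))) (by fun_prop))
lemma N_fam : Fam fun x w => F x w - (F x 0).im * 𝕚 := by
  have := H.addI (a_cont H).neg
  simpa [sub_eq_add_neg] using this
lemma RR_fam : Fam fun p : X × ℝ => RR (F p.1) p.2 :=
  ((SS_fam (N_fam H)).comp (u := fun p : X × ℝ => (p.1, 4 * p.2)) (by fun_prop)).addI ((a_cont H).comp continuous_fst)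
lemma RR_zero (x : X) (w : ℂ) : RR (F x) 0 w = F x w := by
  have := F1_one (N_fam H) x
  rw [RR, SS, if_pos (by norm_num), mul_zero, sub_zero, this]; ring
lemma RR_one (x : X) (w : ℂ) : RR (F x) 1 w = w + (F x 0).im * 𝕚 := by
  rw [RR, SS, if_neg (by norm_num), if_neg (by norm_num), if_neg (by norm_num), show (4 * 1 - 3 : ℝ) = 1 by norm_num, F4_one]
lemma RR_id {x : X} {b : ℝ} (h : ∀ w, F x w = w + b * 𝕚) (t : ℝ) (w : ℂ) : RR (F x) t w = F x w := by
  have := SS_id (N_fam H) (x := x) (fun w => by simp [h]) (4 * t) w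
  rw [RR, this, h, h]; simp
omit H in
lemma RR_add (F : ℂ → ℂ) (b t : ℝ) (w : ℂ) : RR (fun w => F w + b * 𝕚) t w = RR F t w + b * 𝕚 := by
  have e : (fun w => F w + b * 𝕚 - ((F 0 + b * 𝕚).im : ℂ) * 𝕚) = fun w => F w - (F 0).im * 𝕚 := by
    funext w; simp; ring
  rw [RR, e, RR]; simp; ring
end

lemma sph_iff (x : E3) : x ∈ sphere (0 : E3) 1 ↔ x 0 ^ 2 + x 1 ^ 2 + x 2 ^ 2 = 1 := by
  rw [mem_sphere_zero_iff_norm, EuclideanSpace.norm_eq, Real.sqrt_eq_one]; simp [Fin.sum_univ_three]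
lemma sph_eq (x : Sph) : x.1 0 ^ 2 + x.1 1 ^ 2 + x.1 2 ^ 2 = 1 := (sph_iff _).1 x.2
lemma E3_ext {x y : E3} (h0 : x 0 = y 0) (h1 : x 1 = y 1) (h2 : x 2 = y 2) : x = y := by
  ext i; fin_cases i <;> assumption
def Sv (z : ℂ) : E3 := !₂[2 * z.re / (z.re ^ 2 + z.im ^ 2 + 1), 2 * z.im / (z.re ^ 2 + z.im ^ 2 + 1), (z.re ^ 2 + z.im ^ 2 - 1) / (z.re ^ 2 + z.im ^ 2 + 1)]
lemma Npos (z : ℂ) : z.re ^ 2 + z.im ^ 2 + 1 ≠ 0 := by positivity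
def Ss (z : ℂ) : Sph := ⟨Sv z, by rw [sph_iff]; have := Npos z; simp [Sv]; field_simp; ring⟩
lemma Ss0 (z : ℂ) : (Ss z).1 0 = 2 * z.re / (z.re ^ 2 + z.im ^ 2 + 1) := rfl
lemma Ss1 (z : ℂ) : (Ss z).1 1 = 2 * z.im / (z.re ^ 2 + z.im ^ 2 + 1) := rfl
lemma Ss2 (z : ℂ) : (Ss z).1 2 = (z.re ^ 2 + z.im ^ 2 - 1) / (z.re ^ 2 + z.im ^ 2 + 1) := rfl
lemma Ss_cont : Continuous Ss := by
  refine Continuous.subtype_mk ?_ _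
  refine (PiLp.continuous_toLp 2 _).comp (continuous_pi fun i => ?_)
  fin_cases i <;> simp <;> refine Continuous.div (by fun_prop) (by fun_prop) Npos
def sg (x : E3) : ℂ := ⟨x 0 / (1 - x 2), x 1 / (1 - x 2)⟩
lemma sg_Ss (z : ℂ) : sg (Ss z).1 = z := by
  have := Npos z
  have e : 1 - (Ss z).1 2 = 2 / (z.re ^ 2 + z.im ^ 2 + 1) := by rw [Ss2]; field_simp; ring
  apply cxt <;> simp only [sg, e, Ss0, Ss1] <;> field_simp
lemma Ss2_ne (z : ℂ) : (Ss z).1 2 ≠ 1 := by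
  have := Npos z
  rw [Ss2]; intro h; rw [div_eq_one_iff_eq this] at h; linarith
lemma Ss_sg (x : Sph) (h : x.1 2 ≠ 1) : Ss (sg x.1) = x := by
  have e := sph_eq x
  have h' : 1 - x.1 2 ≠ 0 := fun h'' => h (by linarith)
  have e2 : (sg x.1).re ^ 2 + (sg x.1).im ^ 2 = (1 + x.1 2) / (1 - x.1 2) := by
    simp only [sg]; field_simp; linear_combination e
  have e3 : (1 + x.1 2) / (1 - x.1 2) + 1 = 2 / (1 - x.1 2) := by field_simp; ring
  refine Subtype.ext (E3_ext ?_ ?_ ?_)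
  · rw [Ss0, e2, e3]; simp only [sg]; field_simp
  · rw [Ss1, e2, e3]; simp only [sg]; field_simp
  · rw [Ss2, e2, e3]; field_simp; ring
lemma sg_cont : ContinuousOn (fun x : Sph => sg x.1) {x | x.1 2 ≠ 1} := by
  have : (fun x : Sph => sg x.1) = fun x => equivRealProdCLM.symm (x.1 0 / (1 - x.1 2), x.1 1 / (1 - x.1 2)) := rfl
  rw [this]
  refine equivRealProdCLM.symm.continuous.comp_continuousOn (ContinuousOn.prodMk ?_ ?_) <;>
  refine ContinuousOn.div (by fun_prop) (by fun_prop) fun x hx h => hx (by linarith)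
def e3 : Sph := ⟨!₂[0, 0, 1], by rw [sph_iff]; simp⟩
def pp : P2 := ⟦e3⟧
def EE (w : ℂ) : Sph := Ss (exp w)
def Pi (w : ℂ) : P2 := ⟦EE w⟧
lemma mk_eq {x y : Sph} : (⟦x⟧ : P2) = ⟦y⟧ ↔ x = y ∨ x = -y := by
  rw [Quotient.eq]; exact or_congr Subtype.ext_iff.symm (by rw [Subtype.ext_iff]; rfl)
lemma neg_ap (x : Sph) (i : Fin 3) : (-x).1 i = -x.1 i := rfl
lemma mk_cont : Continuous fun x : Sph => (⟦x⟧ : P2) := continuous_quotient_mk'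
lemma EE_cont : Continuous EE := Ss_cont.comp Complex.continuous_exp
lemma Pi_cont : Continuous Pi := mk_cont.comp EE_cont
lemma exp_Gam (w : ℂ) : exp (Gam w) = - (conj (exp w))⁻¹ := by
  rw [Gam, nn, exp_add, Complex.exp_pi_mul_I, Complex.exp_neg, Complex.exp_conj]; ring
lemma Ss_neg (hz : z ≠ 0) : Ss (-(conj z)⁻¹) = -Ss z := by
  have h0 : z.re ^ 2 + z.im ^ 2 ≠ 0 := fun h => hz (Complex.normSq_eq_zero.1 (by rw [normSq_apply]; linarith))
  have h1 := Npos z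
  have a : (-(conj z)⁻¹).re = -z.re / (z.re ^ 2 + z.im ^ 2) := by simp [Complex.inv_re, normSq_apply]; ring
  have b : (-(conj z)⁻¹).im = -z.im / (z.re ^ 2 + z.im ^ 2) := by simp [Complex.inv_im, normSq_apply]; ring
  have e : (-z.re / (z.re ^ 2 + z.im ^ 2)) ^ 2 + (-z.im / (z.re ^ 2 + z.im ^ 2)) ^ 2 = 1 / (z.re ^ 2 + z.im ^ 2) := by field_simp
  have e' : 1 / (z.re ^ 2 + z.im ^ 2) + 1 = (z.re ^ 2 + z.im ^ 2 + 1) / (z.re ^ 2 + z.im ^ 2) := by field_simp; ring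
  refine Subtype.ext (E3_ext ?_ ?_ ?_)
  · rw [neg_ap, Ss0, Ss0, a, b, e, e']; field_simp
  · rw [neg_ap, Ss1, Ss1, a, b, e, e']; field_simp
  · rw [neg_ap, Ss2, Ss2, a, b, e, e']; field_simp; ring
lemma EE_Gam (w : ℂ) : EE (Gam w) = -EE w := by rw [EE, exp_Gam, Ss_neg (exp_ne_zero w), EE]
lemma Pi_Gam (w : ℂ) : Pi (Gam w) = Pi w := mk_eq.2 (Or.inr (EE_Gam w))
lemma EE_ne (w : ℂ) : (EE w).1 2 ≠ 1 ∧ (EE w).1 2 ≠ -1 := ⟨Ss2_ne _, fun h => Ss2_ne (exp (Gam w)) (by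
  have := EE_Gam w; rw [EE] at this; rw [this, neg_ap, h, neg_neg])⟩
lemma e3_ap : e3.1 0 = 0 ∧ e3.1 1 = 0 ∧ e3.1 2 = 1 := by simp [e3]
lemma eq_pp {x : Sph} : (⟦x⟧ : P2) = pp ↔ x.1 2 = 1 ∨ x.1 2 = -1 := by
  have e := sph_eq x
  rw [pp, mk_eq]
  refine or_congr ⟨fun h => by rw [h]; exact e3_ap.2.2, fun h => ?_⟩ ⟨fun h => by rw [h, neg_ap, e3_ap.2.2], fun h => ?_⟩ <;>
  rw [h] at e <;> refine Subtype.ext (E3_ext ?_ ?_ ?_) <;> simp only [neg_ap, e3_ap] <;> nlinarith [sq_nonneg (x.1 0), sq_nonneg (x.1 1)]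
lemma Pi_ne (w : ℂ) : Pi w ≠ pp := fun h => (eq_pp.1 h).elim (EE_ne w).1 (EE_ne w).2
lemma EE_surj {x : Sph} (h : (⟦x⟧ : P2) ≠ pp) : ∃ w, EE w = x := by
  rw [Ne, eq_pp, not_or] at h
  refine ⟨Complex.log (sg x.1), ?_⟩
  rw [EE, exp_log, Ss_sg x h.1]
  intro h0
  have := congrArg (fun y : Sph => y.1 2) (Ss_sg x h.1)
  simp only [h0, Ss2] at this
  norm_num at this; exact h.2 this.symm
lemma Pi_surj {q : P2} (h : q ≠ pp) : ∃ w, Pi w = q := by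
  obtain ⟨x, rfl⟩ := Quotient.exists_rep q
  obtain ⟨w, hw⟩ := EE_surj h
  exact ⟨w, by rw [Pi, hw]⟩
def GZ (n : ℤ) (w : ℂ) : ℂ := ⟨(-1) ^ n * w.re, w.im + n * π⟩
lemma GZ_re (n : ℤ) (w : ℂ) : (GZ n w).re = (-1) ^ n * w.re := rfl
lemma GZ_im (n : ℤ) (w : ℂ) : (GZ n w).im = w.im + n * π := rfl
lemma GZ_add (m n : ℤ) (w : ℂ) : GZ (m + n) w = GZ m (GZ n w) := by
  apply cxt
  · rw [GZ_re, GZ_re, GZ_re, zpow_add₀ (by norm_num)]; ring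
  · rw [GZ_im, GZ_im, GZ_im]; push_cast; ring
lemma GZ_zero (w : ℂ) : GZ 0 w = w := by apply cxt <;> simp [GZ]
lemma GZ_one (w : ℂ) : GZ 1 w = Gam w := by apply cxt <;> simp [GZ, Gam_re, Gam_im]
lemma GZ_two (n : ℤ) (w : ℂ) : GZ (2 * n) w = w + n * (2 * π * 𝕚) := by
  apply cxt
  · rw [GZ_re, zpow_mul]; simp
  · rw [GZ_im]; simp; ring
lemma GZ_cont (n : ℤ) : Continuous (GZ n) := by
  have : GZ n = fun w => equivRealProdCLM.symm ((-1) ^ n * w.re, w.im + n * π) := rfl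
  rw [this]; fun_prop
lemma EE_eq {w w' : ℂ} : EE w = EE w' ↔ ∃ n : ℤ, w = GZ (2 * n) w' := by
  simp only [GZ_two]; rw [← Complex.exp_eq_exp_iff_exists_int]
  exact ⟨fun h => by rw [← sg_Ss (exp w), ← sg_Ss (exp w')]; exact congrArg (fun y : Sph => sg y.1) h, fun h => by rw [EE, h, EE]⟩
lemma GZ_Gam (n : ℤ) (w : ℂ) : GZ n (Gam w) = GZ (n + 1) w := by rw [GZ_add, GZ_one]
lemma Gam_GZ (n : ℤ) (w : ℂ) : Gam (GZ n w) = GZ (n + 1) w := by rw [add_comm, GZ_add, GZ_one]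
lemma Pi_eq {w w' : ℂ} : Pi w = Pi w' ↔ ∃ n, w = GZ n w' := by
  rw [Pi, Pi, mk_eq, ← EE_Gam, EE_eq, EE_eq]
  constructor
  · rintro (⟨n, h⟩ | ⟨n, h⟩)
    exacts [⟨_, h⟩, ⟨2 * n + 1, by rw [h, GZ_Gam]⟩]
  · rintro ⟨n, h⟩
    obtain ⟨k, rfl | rfl⟩ := Int.even_or_odd' n
    exacts [Or.inl ⟨k, h⟩, Or.inr ⟨k, by rw [h, GZ_Gam]⟩]
lemma Pi_open : IsOpenMap Pi := by
  intro W hW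
  have hV : IsOpen {x : Sph | x.1 2 ≠ 1 ∧ sg x.1 ∈ exp '' W} :=
    sg_cont.isOpen_inter_preimage (isOpen_ne_fun (by fun_prop) continuous_const) (Complex.isOpenMap_exp W hW)
  have hm : ∀ x : Sph, (x.1 2 ≠ 1 ∧ sg x.1 ∈ exp '' W) ↔ ∃ w ∈ W, EE w = x := fun x => by
    constructor
    · rintro ⟨h, w, hw, e⟩; exact ⟨w, hw, by rw [EE, e, Ss_sg x h]⟩
    · rintro ⟨w, hw, rfl⟩; exact ⟨Ss2_ne _, w, hw, (sg_Ss _).symm⟩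
  refine isQuotientMap_quotient_mk'.isOpen_preimage.1 ?_
  convert hV.union (hV.preimage (continuous_neg (G := Sph))) using 1
  ext x
  show (∃ w ∈ W, Pi w = ⟦x⟧) ↔ (_ ∧ _) ∨ ((-x).1 2 ≠ 1 ∧ sg (-x).1 ∈ _)
  rw [hm, hm, ← exists_or]
  exact exists_congr fun w => by rw [Pi, mk_eq]; tauto

lemma GZ_inj {n : ℤ} (h : GZ n w = w) : n = 0 := by
  have := congrArg Complex.im h
  rw [GZ_im] at this
  have hp := pi_pos
  have : (n : ℝ) * π = 0 := by linarith
  simpa [hp.ne'] using this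
lemma GZ_neg (n : ℤ) (w : ℂ) : GZ (-n) (GZ n w) = w := by rw [← GZ_add, neg_add_cancel, GZ_zero]
lemma Pi_GZ (n : ℤ) (w : ℂ) : Pi (GZ n w) = Pi w := Pi_eq.2 ⟨n, rfl⟩
lemma GZ_abs (n : ℤ) (w : ℂ) : |(GZ n w).re| = |w.re| := by rw [GZ_re, abs_mul, abs_zpow]; simp
lemma comm_GZ {F : ℂ → ℂ} {k : ℤ} (h : ∀ w, F (Gam w) = GZ k (F w)) (n : ℤ) (w : ℂ) : F (GZ n w) = GZ (k * n) (F w) := by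
  induction n using Int.induction_on with
  | zero => simp [GZ_zero]
  | succ n ih => rw [← Gam_GZ, h, ih, ← GZ_add]; congr 1; ring
  | pred n ih =>
    rw [← GZ_neg k (F _), ← h, Gam_GZ, sub_add_cancel, ih, ← GZ_add]; congr 1; ring
lemma comm_GZ' {F : ℂ → ℂ} (h : ∀ w, F (Gam w) = Gam (F w)) (n : ℤ) (w : ℂ) : F (GZ n w) = GZ n (F w) := by
  rw [comm_GZ (F := F) (k := 1) (fun w => by rw [h, GZ_one]), one_mul]
def Pm (w : ℂ) : {q : P2 // q ≠ pp} := ⟨Pi w, Pi_ne w⟩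
lemma Pm_cov : IsCoveringMap Pm := by
  let _ : AddAction ℤ ℂ := { vadd := GZ, zero_vadd := GZ_zero, add_vadd := GZ_add }
  have hv : ∀ (n : ℤ) (w : ℂ), n +ᵥ w = GZ n w := fun _ _ => rfl
  have hc : Continuous Pm := Pi_cont.subtype_mk _
  have ho : IsOpenMap Pm := fun W hW => by
    convert (Pi_open W hW).preimage (continuous_subtype_val (p := fun q : P2 => q ≠ pp)) using 1
    ext q; exact exists_congr fun w => and_congr_right fun _ => Subtype.ext_iff
  have hs : Surjective Pm := fun q => (Pi_surj q.2).imp fun w hw => Subtype.ext hw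
  refine IsAddQuotientCoveringMap.isCoveringMap (G := ℤ) Pm ⟨ho.isQuotientMap hc hs, ⟨fun n => ?_⟩, ?_, fun w => ?_⟩
  · exact GZ_cont n
  · intro a b
    rw [Subtype.ext_iff]
    show Pi a = Pi b ↔ _
    rw [Pi_eq]
    exact exists_congr fun n => eq_comm
  · refine ⟨ball w 1, ball_mem_nhds _ one_pos, ?_⟩
    rintro n ⟨_, ⟨v, hv, rfl⟩, hv'⟩
    have h3 := pi_gt_three
    rw [mem_ball, dist_eq_norm] at hv hv'
    have h1 := (abs_im_le_norm _).trans_lt hv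
    have h2 := (abs_im_le_norm _).trans_lt hv'
    rw [sub_im] at h1 h2
    change |(GZ n v).im - w.im| < 1 at h2
    rw [GZ_im] at h2
    rw [abs_lt] at h1 h2
    have h4 : |(n : ℝ) * π| < 2 := by rw [abs_lt]; constructor <;> linarith [h1.1, h1.2, h2.1, h2.2]
    rw [abs_mul, abs_of_pos pi_pos] at h4
    by_contra hn
    have : (1:ℝ) ≤ |(n : ℝ)| := by exact_mod_cast Int.one_le_abs hn
    nlinarith
lemma lift_unique {F G : ℂ → ℂ} (hF : Continuous F) (hG : Continuous G) (h : ∀ w, Pi (F w) = Pi (G w)) : ∃ n, ∀ w, F w = GZ n (G w) := by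
  obtain ⟨n, hn⟩ := Pi_eq.1 (h 0)
  have := Pm_cov.eq_of_comp_eq hF ((GZ_cont n).comp hG) (funext fun w => Subtype.ext ((h w).trans (Pi_GZ n _).symm)) 0 hn
  exact ⟨n, congrFun this⟩
lemma lift_fam {g : X × ℂ → P2} (hg : Continuous g) (hn : ∀ p, g p ≠ pp) {c : X → ℂ} (hc : Continuous c) (h : ∀ x, Pi (c x) = g (x, 0)) :
    ∃ F : X → ℂ → ℂ, (Continuous fun p : X × ℂ => F p.1 p.2) ∧ ∀ x w, Pi (F x w) = g (x, w) := by
  let H : C(I × (X × ℂ), {q : P2 // q ≠ pp}) := ⟨fun p => ⟨g (p.2.1, (p.1 : ℝ) * p.2.2), hn _⟩, (hg.comp (by fun_prop)).subtype_mk _⟩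
  have H0 : ∀ a, H (0, a) = Pm ((⟨fun a => c a.1, by fun_prop⟩ : C(X × ℂ, ℂ)) a) := fun a => by
    refine Subtype.ext ?_
    show g (a.1, ((0 : I) : ℝ) * a.2) = Pi (c a.1)
    simp [h]
  refine ⟨fun x w => Pm_cov.liftHomotopy H _ H0 (1, (x, w)), (Pm_cov.liftHomotopy H _ H0).continuous.comp (by fun_prop), fun x w => ?_⟩
  have := congrArg Subtype.val (congrFun (Pm_cov.liftHomotopy_lifts H _ H0) (1, (x, w)))
  refine this.trans ?_
  show g (x, ((1 : I) : ℝ) * w) = _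
  simp
lemma lift_loc {g : X × ℂ → P2} (hg : Continuous g) (hn : ∀ p, g p ≠ pp) (x0 : X) :
    ∃ U : Set X, IsOpen U ∧ x0 ∈ U ∧ ∃ F : U → ℂ → ℂ, (Continuous fun p : U × ℂ => F p.1 p.2) ∧ ∀ x w, Pi (F x w) = g (x, w) := by
  obtain ⟨w0, hw0⟩ := Pi_surj (hn (x0, 0))
  obtain ⟨e, he, hee⟩ := Pm_cov.isLocalHomeomorph w0
  let q : X → {q : P2 // q ≠ pp} := fun x => ⟨g (x, 0), hn _⟩
  have hq : Continuous q := (hg.comp (by fun_prop)).subtype_mk _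
  have hq0 : q x0 = e w0 := by rw [← hee]; exact Subtype.ext hw0.symm
  refine ⟨q ⁻¹' e.target, e.open_target.preimage hq, by rw [mem_preimage, hq0]; exact e.map_source he, ?_⟩
  refine lift_fam (g := fun p : (q ⁻¹' e.target) × ℂ => g (p.1, p.2)) (c := fun x => e.symm (q x)) (hg.comp (by fun_prop)) (fun _ => hn _) ?_ ?_
  · exact continuousOn_iff_continuous_domRestrict.1 (e.continuousOn_symm.comp hq.continuousOn fun x hx => hx)
  · intro x
    have : Pm (e.symm (q x)) = q x := by rw [hee]; exact e.right_inv x.2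
    exact congrArg Subtype.val this
lemma mk_open : IsOpenMap fun x : Sph => (⟦x⟧ : P2) := fun W hW => by
  refine isQuotientMap_quotient_mk'.isOpen_preimage.1 ?_
  convert hW.union (hW.preimage (continuous_neg (G := Sph))) using 1
  ext x
  show (∃ w ∈ W, (⟦w⟧ : P2) = ⟦x⟧) ↔ x ∈ W ∨ -x ∈ W
  simp only [mk_eq]
  exact ⟨by rintro ⟨w, h, rfl | rfl⟩ <;> tauto, by rintro (h | h); exacts [⟨x, h, Or.inl rfl⟩, ⟨-x, h, Or.inr rfl⟩]⟩
lemma mk_oq : IsOpenQuotientMap fun x : Sph => (⟦x⟧ : P2) := ⟨Quotient.mk_surjective, mk_cont, mk_open⟩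
instance : T2Space P2 := by
  have hl : ∀ i j, ∀ x y : Sph, x ≈ y → x.1 i * x.1 j = y.1 i * y.1 j := by
    rintro i j x y (h | h) <;> rw [h]
    simp
  refine T2Space.of_injective_continuous (f := fun q : P2 => fun i j : Fin 3 => Quotient.lift (fun x : Sph => x.1 i * x.1 j) (hl i j) q) ?_
    (continuous_pi fun i => continuous_pi fun j => Continuous.quotient_lift (by fun_prop) _)
  intro q q' h
  obtain ⟨x, rfl⟩ := Quotient.exists_rep q
  obtain ⟨y, rfl⟩ := Quotient.exists_rep q'
  have h : ∀ i j, x.1 i * x.1 j = y.1 i * y.1 j := fun i j => congrFun (congrFun h i) j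
  have ey := sph_eq y
  have ex := sph_eq x
  set c := x.1 0 * y.1 0 + x.1 1 * y.1 1 + x.1 2 * y.1 2 with hc
  have hx : ∀ j, x.1 j = c * y.1 j := fun j => by
    rw [hc]; linear_combination -(x.1 j) * ex + x.1 0 * h 0 j + x.1 1 * h 1 j + x.1 2 * h 2 j
  have hcc : (c - 1) * (c + 1) = 0 := by
    simp only [hx] at ex; linear_combination ex - c ^ 2 * ey
  rw [mk_eq]
  rcases mul_eq_zero.1 hcc with h' | h'
  · left; refine Subtype.ext (PiLp.ext fun i => ?_); rw [hx, sub_eq_zero.1 h', one_mul]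
  · right; refine Subtype.ext (PiLp.ext fun i => ?_); rw [hx, neg_ap, eq_neg_of_add_eq_zero_left h']; ring
lemma pp_nhd1 {V : Set P2} (hV : V ∈ 𝓝 pp) : ∃ M : ℝ, ∀ w : ℂ, M ≤ |w.re| → Pi w ∈ V := by
  have hc : IsCompact (interior V)ᶜ := isOpen_interior.isClosed_compl.isCompact
  have h1 : (interior V)ᶜ ⊆ ⋃ M : ℝ, Pi '' {w | |w.re| < M} := fun q hq => by
    obtain ⟨w, rfl⟩ := Pi_surj (q := q) (fun h => hq (h ▸ mem_interior_iff_mem_nhds.2 hV))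
    exact mem_iUnion.2 ⟨|w.re| + 1, w, lt_add_one |w.re|, rfl⟩
  obtain ⟨M, hM⟩ := hc.elim_directed_cover _ (fun M => Pi_open _ (isOpen_lt (by fun_prop) continuous_const)) h1
    (Monotone.directed_le fun a b hab => image_mono fun w (hw : |w.re| < a) => hw.trans_le hab)
  refine ⟨M, fun w hw => ?_⟩
  by_contra h
  obtain ⟨v, hv, e⟩ := hM fun h' => h (interior_subset h')
  obtain ⟨n, rfl⟩ := Pi_eq.1 e.symm
  rw [GZ_abs] at hw
  exact absurd hv hw.not_gt
lemma pp_nhd2 (T : ℝ) : {q : P2 | q = pp ∨ ∃ w : ℂ, T < w.re ∧ Pi w = q} ∈ 𝓝 pp := by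
  have hK : IsCompact (Pi '' (Icc (-T) T ×ℂ Icc 0 (2 * π))) := (isCompact_Icc.reProdIm isCompact_Icc).image Pi_cont
  refine mem_of_superset (hK.isClosed.isOpen_compl.mem_nhds (by rintro ⟨w, -, h⟩; exact Pi_ne w h)) fun q hq => ?_
  by_cases h : q = pp
  · exact Or.inl h
  obtain ⟨w, rfl⟩ := Pi_surj h
  right
  by_cases h1 : T < w.re
  · exact ⟨w, h1, rfl⟩
  refine ⟨Gam w, ?_, Pi_Gam w⟩
  rw [Gam_re]
  by_contra h2
  obtain ⟨n, v, hv, hi, e⟩ := red_im w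
  refine hq ⟨v, ⟨⟨by rw [hv]; linarith, by rw [hv]; linarith⟩, hi⟩, ?_⟩
  rw [e, ← GZ_two, Pi_GZ]
open Classical in
def PsP (F : ℂ → ℂ) (q : P2) : P2 := if h : q = pp then pp else Pi (F (Pi_surj h).choose)
lemma PsP_pp (F : ℂ → ℂ) : PsP F pp = pp := dif_pos rfl
lemma PsP_Pi {F : ℂ → ℂ} (h : ∀ w, F (Gam w) = Gam (F w)) (w : ℂ) : PsP F (Pi w) = Pi (F w) := by
  rw [PsP, dif_neg (Pi_ne w)]
  obtain ⟨n, hn⟩ := Pi_eq.1 (Pi_surj (Pi_ne w)).choose_spec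
  rw [hn, comm_GZ' h, Pi_GZ]
lemma PsP_cont (H : Fam F) : Continuous fun p : X × P2 => PsP (F p.1) p.2 := by
  rw [continuous_iff_continuousAt]
  rintro ⟨x0, q⟩
  by_cases hq : q = pp
  · subst hq
    intro V hV
    simp only [PsP_pp] at hV
    obtain ⟨M, hM⟩ := pp_nhd1 hV
    obtain ⟨T, hT⟩ := H.ends x0 M
    rw [nhds_prod_eq, mem_map]
    filter_upwards [prod_mem_prod hT (pp_nhd2 T)]
    rintro ⟨x, q⟩ ⟨hx, rfl | ⟨w, hw, rfl⟩⟩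
    · show PsP _ pp ∈ V
      rw [PsP_pp]; exact mem_of_mem_nhds hV
    · show PsP _ (Pi w) ∈ V
      rw [PsP_Pi (H.gam x)]; exact hM _ ((hx w hw.le).trans (le_abs_self _))
  · obtain ⟨w, rfl⟩ := Pi_surj hq
    have ho : IsOpenMap (Prod.map (id : X → X) Pi) := IsOpenMap.id.prodMap Pi_open
    have hm := ho.nhds_le (x0, w)
    refine Tendsto.mono_left (tendsto_map'_iff.2 ?_) hm
    have e : ((fun p : X × P2 => PsP (F p.1) p.2) ∘ Prod.map id Pi) = fun p => Pi (F p.1 p.2) := funext fun p => PsP_Pi (H.gam p.1) p.2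
    rw [e]; simp only [PsP_Pi (H.gam x0)]
    exact (Pi_cont.comp H.cont).tendsto (x0, w)
lemma PsP_bij (H : Fam F) (x : X) : Bijective (PsP (F x)) := by
  constructor
  · intro q q' h
    by_cases hq : q = pp <;> by_cases hq' : q' = pp
    · rw [hq, hq']
    · obtain ⟨w, rfl⟩ := Pi_surj hq'
      rw [hq, PsP_pp, PsP_Pi (H.gam x)] at h; exact (Pi_ne _ h.symm).elim
    · obtain ⟨w, rfl⟩ := Pi_surj hq
      rw [hq', PsP_pp, PsP_Pi (H.gam x)] at h; exact (Pi_ne _ h).elim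
    · obtain ⟨w, rfl⟩ := Pi_surj hq
      obtain ⟨w', rfl⟩ := Pi_surj hq'
      rw [PsP_Pi (H.gam x), PsP_Pi (H.gam x), Pi_eq] at h
      obtain ⟨n, hn⟩ := h
      rw [← comm_GZ' (H.gam x)] at hn
      rw [(H.bij x).1 hn, Pi_GZ]
  · intro q
    by_cases hq : q = pp
    · exact ⟨pp, by rw [PsP_pp, hq]⟩
    · obtain ⟨w, rfl⟩ := Pi_surj hq
      obtain ⟨v, rfl⟩ := (H.bij x).2 w
      exact ⟨Pi v, PsP_Pi (H.gam x) v⟩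
def PsH {F : X → ℂ → ℂ} (H : Fam F) (x : X) : HomP2 :=
  ⟨⟨PsP (F x), (PsP_cont H).comp (Continuous.prodMk_right x)⟩, isHomeomorph_iff_continuous_bijective.2 ⟨(PsP_cont H).comp (Continuous.prodMk_right x), PsP_bij H x⟩⟩

abbrev SO := Matrix.specialOrthogonalGroup (Fin 3) ℝ
lemma SO_l (Q : SO) : Q.1.transpose * Q.1 = 1 := (Matrix.mem_orthogonalGroup_iff' _ _).1 (Matrix.mem_specialOrthogonalGroup_iff.1 Q.2).1
lemma SO_r (Q : SO) : Q.1 * Q.1.transpose = 1 := (Matrix.mem_orthogonalGroup_iff _ _).1 (Matrix.mem_specialOrthogonalGroup_iff.1 Q.2).1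
lemma mv_ap (Q : Matrix (Fin 3) (Fin 3) ℝ) (v : Fin 3 → ℝ) (i : Fin 3) : Q.mulVec v i = Q i 0 * v 0 + Q i 1 * v 1 + Q i 2 * v 2 := by
  simp [Matrix.mulVec, dotProduct, Fin.sum_univ_three]
lemma SO_ent (Q : SO) (i j : Fin 3) : Q.1 0 i * Q.1 0 j + Q.1 1 i * Q.1 1 j + Q.1 2 i * Q.1 2 j = if i = j then 1 else 0 := by
  have := congrFun (congrFun (SO_l Q) i) j
  simpa [Matrix.mul_apply, Fin.sum_univ_three, Matrix.one_apply] using this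
def sa (Q : SO) (x : Sph) : Sph := ⟨WithLp.toLp 2 (Q.1.mulVec x.1.ofLp), by
  rw [sph_iff]; simp only [mv_ap]
  have e := sph_eq x
  have h00 := SO_ent Q 0 0; have h01 := SO_ent Q 0 1; have h02 := SO_ent Q 0 2
  have h11 := SO_ent Q 1 1; have h12 := SO_ent Q 1 2; have h22 := SO_ent Q 2 2
  simp only [Fin.isValue, ↓reduceIte, Fin.reduceEq] at h00 h01 h02 h11 h12 h22
  linear_combination e + x.1 0 ^ 2 * h00 + x.1 1 ^ 2 * h11 + x.1 2 ^ 2 * h22 + 2 * x.1 0 * x.1 1 * h01 + 2 * x.1 0 * x.1 2 * h02 + 2 * x.1 1 * x.1 2 * h12⟩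
lemma sa_ap (Q : SO) (x : Sph) (i : Fin 3) : (sa Q x).1 i = Q.1 i 0 * x.1 0 + Q.1 i 1 * x.1 1 + Q.1 i 2 * x.1 2 := mv_ap _ _ _
lemma sa_mul (P Q : SO) (x : Sph) : sa (P * Q) x = sa P (sa Q x) :=
  Subtype.ext (congrArg (WithLp.toLp 2) (Matrix.mulVec_mulVec _ _ _).symm)
lemma sa_one (x : Sph) : sa 1 x = x := Subtype.ext (congrArg (WithLp.toLp 2) (Matrix.one_mulVec _))
lemma sa_neg (Q : SO) (x : Sph) : sa Q (-x) = -sa Q x := Subtype.ext (congrArg (WithLp.toLp 2) (Matrix.mulVec_neg _ _))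
lemma sa_cont : Continuous fun p : SO × Sph => sa p.1 p.2 := by
  refine Continuous.subtype_mk ((PiLp.continuous_toLp 2 _).comp (Continuous.matrix_mulVec (by fun_prop) ?_)) _
  exact (PiLp.continuous_ofLp 2 _).comp (by fun_prop)
def rP (Q : SO) : P2 → P2 := Quotient.map (sa Q) fun x y h => by
  refine Quotient.exact (mk_eq.2 ?_)
  rcases mk_eq.1 (Quotient.sound h) with rfl | rfl
  exacts [Or.inl rfl, Or.inr (sa_neg _ _)]
lemma rP_mk (Q : SO) (x : Sph) : rP Q ⟦x⟧ = ⟦sa Q x⟧ := rfl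
lemma rP_mul (P Q : SO) (q : P2) : rP (P * Q) q = rP P (rP Q q) := by
  obtain ⟨x, rfl⟩ := Quotient.exists_rep q
  rw [rP_mk, rP_mk, rP_mk, sa_mul]
lemma rP_one (q : P2) : rP 1 q = q := by
  obtain ⟨x, rfl⟩ := Quotient.exists_rep q
  rw [rP_mk, sa_one]
lemma rP_inv (Q : SO) (q : P2) : rP Q⁻¹ (rP Q q) = q := by rw [← rP_mul, inv_mul_cancel, rP_one]
lemma rP_inv' (Q : SO) (q : P2) : rP Q (rP Q⁻¹ q) = q := by rw [← rP_mul, mul_inv_cancel, rP_one]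
lemma rP_cont : Continuous fun p : SO × P2 => rP p.1 p.2 := by
  have h : IsOpenQuotientMap (Prod.map (id : SO → SO) fun x : Sph => (⟦x⟧ : P2)) := IsOpenQuotientMap.id.prodMap mk_oq
  rw [h.isQuotientMap.continuous_iff]
  exact mk_cont.comp sa_cont
lemma rP_bij (Q : SO) : Bijective (rP Q) :=
  ⟨fun a b h => by rw [← rP_inv Q a, h, rP_inv], fun b => ⟨_, rP_inv' Q b⟩⟩
def rH (Q : SO) : HomP2 := ⟨⟨rP Q, rP_cont.comp (Continuous.prodMk_right Q)⟩, isHomeomorph_iff_continuous_bijective.2 ⟨rP_cont.comp (Continuous.prodMk_right Q), rP_bij Q⟩⟩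
lemma ind_eq {g : HomP2} {Q : SO} (h : InducedBy g Q.1) (q : P2) : g.1 q = rP Q q := by
  obtain ⟨x, rfl⟩ := Quotient.exists_rep q
  exact h x (sa Q x) rfl
lemma ind_of {g : HomP2} {Q : SO} (h : ∀ q, g.1 q = rP Q q) : InducedBy g Q.1 := fun x y e => by
  rw [h, rP_mk]; exact congrArg _ (Subtype.ext (congrArg (WithLp.toLp 2) e.symm))
def Rz (b : ℝ) : SO := ⟨!![cos b, -sin b, 0; sin b, cos b, 0; 0, 0, 1], by
  have := sin_sq_add_cos_sq b
  rw [Matrix.mem_specialOrthogonalGroup_iff, Matrix.mem_orthogonalGroup_iff]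
  constructor
  · ext i j; fin_cases i <;> fin_cases j <;> simp [Matrix.mul_apply, Fin.sum_univ_three] <;> linarith
  · simp [Matrix.det_fin_three]; linarith⟩
lemma Rz_pp (b : ℝ) : rP (Rz b) pp = pp := by
  rw [pp, rP_mk]; refine congrArg _ (Subtype.ext (E3_ext ?_ ?_ ?_)) <;> rw [sa_ap] <;> simp [Rz, e3]
lemma Rz_Pi (b : ℝ) (w : ℂ) : rP (Rz b) (Pi w) = Pi (w + b * 𝕚) := by
  have e := sin_sq_add_cos_sq b
  have hr : (exp (w + b * 𝕚)).re = cos b * (exp w).re - sin b * (exp w).im := by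
    rw [exp_add, mul_re, Complex.exp_ofReal_mul_I_re, Complex.exp_ofReal_mul_I_im]; ring
  have hi : (exp (w + b * 𝕚)).im = sin b * (exp w).re + cos b * (exp w).im := by
    rw [exp_add, mul_im, Complex.exp_ofReal_mul_I_re, Complex.exp_ofReal_mul_I_im]; ring
  have hN : (exp (w + b * 𝕚)).re ^ 2 + (exp (w + b * 𝕚)).im ^ 2 = (exp w).re ^ 2 + (exp w).im ^ 2 := by
    rw [hr, hi]; linear_combination ((exp w).re ^ 2 + (exp w).im ^ 2) * e
  rw [Pi, rP_mk]; refine congrArg _ (Subtype.ext (E3_ext ?_ ?_ ?_)) <;> rw [sa_ap] <;> simp only [EE, Ss0, Ss1, Ss2, hN] <;>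
    simp [Rz] <;> simp only [hr, hi] <;> ring
def Hm (m : {m : E3 // m ≠ 0}) : SO := ⟨Matrix.of fun i j => 2 * m.1 i * m.1 j / (m.1 0 ^ 2 + m.1 1 ^ 2 + m.1 2 ^ 2) - if i = j then 1 else 0, by
  have hs : m.1 0 ^ 2 + m.1 1 ^ 2 + m.1 2 ^ 2 ≠ 0 := fun h => m.2 (E3_ext (by simp; nlinarith) (by simp; nlinarith) (by simp; nlinarith))
  rw [Matrix.mem_specialOrthogonalGroup_iff, Matrix.mem_orthogonalGroup_iff]
  constructor
  · ext i j; fin_cases i <;> fin_cases j <;> simp [Matrix.mul_apply, Fin.sum_univ_three] <;> field_simp <;> ring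
  · simp [Matrix.det_fin_three]; field_simp; ring⟩
lemma Hm_ap (m : {m : E3 // m ≠ 0}) (i j : Fin 3) : (Hm m).1 i j = 2 * m.1 i * m.1 j / (m.1 0 ^ 2 + m.1 1 ^ 2 + m.1 2 ^ 2) - if i = j then 1 else 0 := rfl
lemma ssq_ne (m : {m : E3 // m ≠ 0}) : m.1 0 ^ 2 + m.1 1 ^ 2 + m.1 2 ^ 2 ≠ 0 := fun h => m.2 (E3_ext (by simp; nlinarith) (by simp; nlinarith) (by simp; nlinarith))
lemma Hm_cont : Continuous Hm := by
  refine Continuous.subtype_mk (continuous_matrix fun i j => ?_) _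
  exact (Continuous.div (by fun_prop) (by fun_prop) ssq_ne).sub continuous_const
lemma Hm_inv (m : {m : E3 // m ≠ 0}) : (Hm m)⁻¹ = Hm m := by
  refine Subtype.ext (Matrix.ext fun i j => ?_)
  show (Hm m).1 j i = (Hm m).1 i j
  rw [Hm_ap, Hm_ap]; simp only [eq_comm]; ring
def Cc : SO := Hm ⟨!₂[0, 1, 0], fun h => by have := congrArg (fun v : E3 => v 1) h; simp at this⟩
lemma Cc_sa (x : Sph) : (sa Cc x).1 0 = - x.1 0 ∧ (sa Cc x).1 1 = x.1 1 ∧ (sa Cc x).1 2 = - x.1 2 := by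
  refine ⟨?_, ?_, ?_⟩ <;> rw [sa_ap, Cc, Hm_ap, Hm_ap, Hm_ap] <;> simp <;> norm_num
lemma Cc_pp : rP Cc pp = pp := by
  rw [pp, rP_mk, mk_eq]; right
  obtain ⟨h0, h1, h2⟩ := Cc_sa e3
  refine Subtype.ext (E3_ext ?_ ?_ ?_) <;> simp only [neg_ap, h0, h1, h2, e3_ap] <;> simp
lemma Cc_Pi (w : ℂ) : rP Cc (Pi w) = Pi (conj w) := by
  rw [Pi, rP_mk, Pi, mk_eq]; right
  obtain ⟨h0, h1, h2⟩ := Cc_sa (EE w)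
  refine Subtype.ext (E3_ext ?_ ?_ ?_) <;> simp only [neg_ap, h0, h1, h2] <;> simp only [EE, Ss0, Ss1, Ss2, Complex.exp_conj, conj_re, conj_im] <;> ring
lemma Cc_inv : Cc⁻¹ = Cc := Hm_inv _
lemma fix_e3 {M : SO} (h : sa M e3 = e3) : ∃ b, M = Rz b := by
  have h' : ∀ i, M.1 i 2 = e3.1 i := fun i => by rw [← h, sa_ap]; simp [e3]
  have d : ∀ i, e3.1 i = if i = 2 then 1 else 0 := fun i => by fin_cases i <;> simp [e3]
  simp only [d] at h'
  have h00 := SO_ent M 0 0; have h11 := SO_ent M 1 1; have h02 := SO_ent M 0 2; have h12 := SO_ent M 1 2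
  have hd := (Matrix.mem_specialOrthogonalGroup_iff.1 M.2).2
  rw [Matrix.det_fin_three] at hd
  simp [h'] at h00 h11 h02 h12 hd
  simp [h02, h12] at h00 h11 hd
  have e1 : M.1 1 1 = M.1 0 0 := by nlinarith [sq_nonneg (M.1 0 0 - M.1 1 1), sq_nonneg (M.1 1 0 + M.1 0 1)]
  have e2 : M.1 0 1 = - M.1 1 0 := by nlinarith [sq_nonneg (M.1 0 0 - M.1 1 1), sq_nonneg (M.1 1 0 + M.1 0 1)]
  have hz : ‖(⟨M.1 0 0, M.1 1 0⟩ : ℂ)‖ = 1 := by rw [Complex.norm_def, Complex.normSq_mk, h00, Real.sqrt_one]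
  have hc := Complex.norm_mul_cos_arg (⟨M.1 0 0, M.1 1 0⟩ : ℂ)
  have hs := Complex.norm_mul_sin_arg (⟨M.1 0 0, M.1 1 0⟩ : ℂ)
  rw [hz, one_mul] at hc hs
  refine ⟨Complex.arg ⟨M.1 0 0, M.1 1 0⟩, Subtype.ext (Matrix.ext fun i j => ?_)⟩
  fin_cases i <;> fin_cases j <;> simp [Rz, hc, hs, h', h02, h12, e1, e2]
lemma fix_pp {M : SO} (h : rP M pp = pp) : ∃ b, M = Rz b ∨ M = Cc * Rz b := by
  rw [pp, rP_mk, mk_eq] at h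
  rcases h with h | h
  · exact (fix_e3 h).imp fun b => Or.inl
  · have h2 : sa (Cc * M) e3 = e3 := by
      rw [sa_mul, h]
      obtain ⟨h0, h1, h2⟩ := Cc_sa (-e3)
      refine Subtype.ext (E3_ext ?_ ?_ ?_) <;> simp only [h0, h1, h2, neg_ap, e3_ap] <;> simp
    obtain ⟨b, hb⟩ := fix_e3 h2
    exact ⟨b, Or.inr (by rw [← hb, ← mul_assoc]; nth_rw 1 [← Cc_inv]; rw [inv_mul_cancel, one_mul])⟩

structure PF (Φ : X → P2 → P2) : Prop where
  cont : Continuous fun p : X × P2 => Φ p.1 p.2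
  bij : ∀ x, Bijective (Φ x)
  fix : ∀ x, Φ x pp = pp
lemma PF.ne {Φ : X → P2 → P2} (H : PF Φ) (x : X) {q : P2} (hq : q ≠ pp) : Φ x q ≠ pp := fun h => hq ((H.bij x).1 (h.trans (H.fix x).symm))
lemma PF.c1 {Φ : X → P2 → P2} (H : PF Φ) (x : X) : Continuous (Φ x) := H.cont.comp (Continuous.prodMk_right x)
lemma lift_deg {φ ψ : P2 → P2} (hφ : ∀ q, φ (ψ q) = q) (hψ : Continuous ψ) (hψ' : ∀ q ≠ pp, ψ q ≠ pp) (hi : ∀ q, ψ (φ q) = q)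
    {F : ℂ → ℂ} (hF : Continuous F) (h : ∀ w, Pi (F w) = φ (Pi w)) : ∃ k : ℤ, (k = 1 ∨ k = -1) ∧ ∀ w, F (Gam w) = GZ k (F w) := by
  obtain ⟨c, hc⟩ := Pi_surj (hψ' _ (Pi_ne 0))
  obtain ⟨G', hG', hG⟩ := lift_fam (X := Unit) (g := fun p => ψ (Pi p.2)) (hψ.comp (Pi_cont.comp continuous_snd)) (fun p => hψ' _ (Pi_ne _)) (c := fun _ => c) continuous_const (fun _ => hc)
  have hGc : Continuous (G' ()) := slice hG' ()
  obtain ⟨k, hk⟩ := lift_unique (hF.comp Gam_cont) hF fun w => by rw [Function.comp, h, h, Pi_Gam]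
  obtain ⟨k', hk'⟩ := lift_unique (hGc.comp Gam_cont) hGc fun w => by rw [Function.comp, hG, hG, Pi_Gam]
  obtain ⟨n, hn⟩ := lift_unique (hF.comp hGc) continuous_id fun w => by rw [Function.comp, h, hG, hφ]; rfl
  refine ⟨k, Int.eq_one_or_neg_one_of_mul_eq_one (v := k') ?_, hk⟩
  have e1 := hn (Gam 0)
  have e2 := hn 0
  simp only [Function.comp, id] at e1 e2 hk' hk
  rw [hk', comm_GZ hk, e2, ← GZ_add, GZ_Gam] at e1
  have := congrArg Complex.im e1
  rw [GZ_im, GZ_im] at this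
  have := mul_right_cancel₀ pi_pos.ne' (add_left_cancel this)
  have : k * k' + n = n + 1 := by exact_mod_cast this
  linarith
lemma PF.deg {Φ : X → P2 → P2} (H : PF Φ) (x : X) {F : ℂ → ℂ} (hF : Continuous F) (h : ∀ w, Pi (F w) = Φ x (Pi w)) :
    ∃ k : ℤ, (k = 1 ∨ k = -1) ∧ ∀ w, F (Gam w) = GZ k (F w) := by
  let e := (isHomeomorph_iff_continuous_bijective.2 ⟨H.c1 x, H.bij x⟩).homeomorph
  refine lift_deg (φ := Φ x) (ψ := e.symm) e.apply_symm_apply e.symm.continuous (fun q hq h' => hq ?_) e.symm_apply_apply hF h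
  rw [← e.apply_symm_apply q, h']; exact H.fix x
lemma PF.ends {Φ : X → P2 → P2} (H : PF Φ) (h : ∀ x w, Pi (F x w) = Φ x (Pi w)) (x0 : X) (M : ℝ) :
    ∃ T : ℝ, ∀ᶠ x in 𝓝 x0, ∀ w : ℂ, T ≤ w.re → M < |(F x w).re| := by
  have hc := H.cont.tendsto (x0, pp)
  simp only [H.fix] at hc
  have := hc (pp_nhd2 M)
  rw [mem_map, nhds_prod_eq] at this
  obtain ⟨U, hU, W, hW, hs⟩ := mem_prod_iff.1 this
  obtain ⟨T, hT⟩ := pp_nhd1 hW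
  refine ⟨T, mem_of_superset hU fun x hx w hw => ?_⟩
  have := hs (mk_mem_prod hx (hT w (hw.trans (le_abs_self _))))
  change Φ x (Pi w) = pp ∨ _ at this
  simp only [← h] at this
  rcases this with h' | ⟨v, hv, e⟩
  · exact (Pi_ne _ h').elim
  · obtain ⟨n, rfl⟩ := Pi_eq.1 e
    rw [← GZ_abs n]; exact hv.trans_le (le_abs_self _)
def kap (k j : ℤ) (w : ℂ) : ℂ := GZ j ⟨w.re, k * w.im⟩
lemma kap_re (k j : ℤ) (w : ℂ) : (kap k j w).re = (-1) ^ j * w.re := rfl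
lemma kap_im (k j : ℤ) (w : ℂ) : (kap k j w).im = k * w.im + j * π := rfl
lemma kap_cont (k j : ℤ) : Continuous (kap k j) := by
  refine (GZ_cont j).comp (?_ : Continuous fun w : ℂ => equivRealProdCLM.symm (w.re, k * w.im))
  fun_prop
lemma kap_C {k : ℤ} (hk : k = 1 ∨ k = -1) (j : ℤ) : ∃ C : SO, rP C pp = pp ∧ ∀ w, rP C (Pi (kap k j w)) = Pi w := by
  rcases hk with rfl | rfl
  · exact ⟨1, rP_one _, fun w => by rw [rP_one, kap, Pi_GZ]; congr 1; apply cxt <;> simp⟩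
  · exact ⟨Cc, Cc_pp, fun w => by rw [kap, Pi_GZ, Cc_Pi]; congr 1; apply cxt <;> simp⟩
lemma kap_Gam {k : ℤ} (hk : k = 1 ∨ k = -1) (j : ℤ) (w : ℂ) : kap k j (GZ k w) = Gam (kap k j w) := by
  apply cxt
  · rw [Gam_re, kap_re, kap_re, GZ_re]; rcases hk with rfl | rfl <;> simp
  · rw [Gam_im, kap_im, kap_im, GZ_im]; rcases hk with rfl | rfl <;> push_cast <;> ring
lemma PF.bij' {Φ : X → P2 → P2} (H : PF Φ) (x : X) {C : SO} {κ F : ℂ → ℂ} (hC : rP C pp = pp) (hκ : ∀ w, rP C (Pi (κ w)) = Pi w)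
    (h : ∀ w, Pi (F w) = Φ x (Pi w)) (hg : ∀ w, κ (F (Gam w)) = Gam (κ (F w))) : Bijective fun w => κ (F w) := by
  have e : ∀ w, rP C (Pi (κ (F w))) = Φ x (Pi w) := fun w => by rw [hκ, h]
  constructor
  · intro a b hab
    simp only at hab
    have := e a
    rw [hab, e] at this
    obtain ⟨n, rfl⟩ := Pi_eq.1 ((H.bij x).1 this)
    have h2 := comm_GZ' (F := fun w => κ (F w)) hg n a
    rw [← hab] at h2
    rw [GZ_inj h2.symm, GZ_zero]
  · intro z
    obtain ⟨q, hq⟩ := (H.bij x).2 (rP C (Pi z))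
    obtain ⟨w, rfl⟩ := Pi_surj (q := q) fun h' => by
      rw [h', H.fix, ← hC] at hq; exact Pi_ne z ((rP_bij C).1 hq).symm
    rw [← e] at hq
    obtain ⟨n, hn⟩ := Pi_eq.1 ((rP_bij C).1 hq).symm
    exact ⟨GZ n w, by rw [hn]; exact comm_GZ' (F := fun w => κ (F w)) hg n w⟩
lemma PF.fam {Φ : X → P2 → P2} (H : PF Φ) (hF : Continuous fun p : X × ℂ => F p.1 p.2) (h : ∀ x w, Pi (F x w) = Φ x (Pi w)) (x0 : X) :
    ∃ U : Set X, IsOpen U ∧ x0 ∈ U ∧ ∃ (C : SO) (κ : ℂ → ℂ), rP C pp = pp ∧ (∀ w, rP C (Pi (κ w)) = Pi w) ∧ Fam fun (x : U) w => κ (F x w) := by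
  obtain ⟨k, hk, hk0⟩ := H.deg x0 (slice hF x0) (h x0)
  obtain ⟨T1, hT1⟩ := H.ends h x0 0
  obtain ⟨U2, hU2, hU2o, hx2⟩ := eventually_nhds_iff.1 hT1
  obtain ⟨j, hj⟩ : ∃ j : ℤ, 0 < (-1) ^ j * (F x0 T1).re := by
    have := hU2 x0 hx2 (T1 : ℂ) (by simp)
    rcases abs_pos.1 this |>.lt_or_gt with h' | h'
    exacts [⟨1, by simpa using h'⟩, ⟨0, by simpa using h'⟩]
  obtain ⟨C, hC, hCk⟩ := kap_C hk j
  have hp := pi_pos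
  have cF : ∀ w, Continuous fun x => F x w := fun w => hF.comp (f := fun x => (x, w)) (by fun_prop)
  let U : Set X := U2 ∩ {x | 0 < (-1) ^ j * (F x T1).re} ∩ {x | |(F x (Gam 0)).im - (F x 0).im - k * π| < π}
  have hcm : ∀ x ∈ U, ∀ w, F x (Gam w) = GZ k (F x w) := by
    rintro x ⟨-, hx⟩
    obtain ⟨k', -, hk'⟩ := H.deg x (slice hF x) (h x)
    change |(F x (Gam 0)).im - (F x 0).im - k * π| < π at hx
    rw [hk', GZ_im, show (F x 0).im + k' * π - (F x 0).im - k * π = (k' - k) * π by ring, abs_mul, abs_of_pos hp, mul_lt_iff_lt_one_left hp] at hx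
    have : |k' - k| < 1 := by exact_mod_cast hx
    rw [sub_eq_zero.1 (Int.abs_lt_one_iff.1 this)] at hk'
    exact hk'
  have hpos : ∀ x ∈ U, ∀ w : ℂ, T1 ≤ w.re → 0 < (-1) ^ j * (F x w).re := by
    rintro x ⟨⟨hx, hx1⟩, -⟩ w hw
    by_contra hn
    have hs := slice hF x
    obtain ⟨v, hv, e⟩ := (convex_halfSpace_re_ge T1).isPreconnected.intermediate_value (f := fun w => (-1) ^ j * (F x w).re) (a := w) (b := (T1 : ℂ)) hw (by simp)
      (by fun_prop) ⟨not_lt.1 hn, le_of_lt hx1⟩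
    have := hU2 x hx v hv
    rcases mul_eq_zero.1 (e : _ * _ = (0:ℝ)) with e | e
    · exact zpow_ne_zero j (by norm_num) e
    · rw [e] at this; simp at this
  refine ⟨U, ((hU2o.inter (isOpen_lt continuous_const ?_)).inter (isOpen_lt ?_ continuous_const)), ⟨⟨hx2, hj⟩, ?_⟩, C, kap k j, hC, hCk, ?_, ?_, ?_, ?_⟩
  · have := cF T1; fun_prop
  · have := cF (Gam 0); have := cF 0; fun_prop
  · show |(F x0 (Gam 0)).im - (F x0 0).im - k * π| < π
    rw [hk0, GZ_im]; simpa using hp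
  · exact (kap_cont k j).comp (hF.comp (f := fun p : U × ℂ => ((p.1 : X), p.2)) (by fun_prop))
  · intro x w; rw [hcm x x.2, kap_Gam hk]
  · intro x
    exact H.bij' x hC hCk (h x) fun w => by rw [hcm x x.2, kap_Gam hk]
  · intro x M
    obtain ⟨T, hT⟩ := H.ends h (x : X) M
    refine ⟨max T T1, (continuous_subtype_val.tendsto x).eventually hT |>.mono fun y hy w hw => ?_⟩
    have h1 := hy w ((le_max_left _ _).trans hw)
    have h2 := hpos y y.2 w ((le_max_right _ _).trans hw)
    rw [kap_re]
    rw [← abs_of_pos h2, abs_mul, abs_zpow]; simpa using h1.le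
structure IsD (f : HomP2) (Q : SO) (F : ℂ → ℂ) : Prop where
  fam : Fam fun _ : Unit => F
  pt : f.1 pp = rP Q pp
  eq : ∀ w, f.1 (Pi w) = rP Q (Pi (F w))
def dv (n x : E3) : ℝ := n 0 * x 0 + n 1 * x 1 + n 2 * x 2
def mv (n x : E3) : E3 := dv n x • x + |dv n x| • e3.1
lemma mv_pp {n x : Sph} (h : mv n.1 x.1 ≠ 0) : rP (Hm ⟨mv n.1 x.1, h⟩) ⟦x⟧ = pp := by
  have hs := ssq_ne ⟨_, h⟩
  rw [rP_mk, eq_pp, sa_ap, Hm_ap, Hm_ap, Hm_ap]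
  simp only at hs ⊢
  have e := sph_eq x
  set d := dv n.1 x.1 with hd
  have h0 : (mv n.1 x.1) 0 = d * x.1 0 := by simp [mv, e3]; left; rfl
  have h1 : (mv n.1 x.1) 1 = d * x.1 1 := by simp [mv, e3]; left; rfl
  have h2 : (mv n.1 x.1) 2 = d * x.1 2 + |d| := by simp [mv, e3]; rfl
  rw [h0, h1, h2] at hs ⊢
  simp only [Fin.isValue, ↓reduceIte, Fin.reduceEq]
  have hms : (d * x.1 0) ^ 2 + (d * x.1 1) ^ 2 + (d * x.1 2 + |d|) ^ 2 = 2 * d * (d + |d| * x.1 2) := by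
    linear_combination d ^ 2 * e + sq_abs d
  rw [hms] at hs ⊢
  have hd0 : d ≠ 0 := by rintro h; simp [h] at hs
  have hm0 : d + |d| * x.1 2 ≠ 0 := by rintro h; simp [h] at hs
  have sK : d * x.1 0 * x.1 0 + d * x.1 1 * x.1 1 + (d * x.1 2 + |d|) * x.1 2 = d + |d| * x.1 2 := by linear_combination d * e
  have fin : (2 * (d * x.1 2 + |d|) * (d * x.1 0) / (2 * d * (d + |d| * x.1 2)) - 0) * x.1 0 + (2 * (d * x.1 2 + |d|) * (d * x.1 1) / (2 * d * (d + |d| * x.1 2)) - 0) * x.1 1 +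
      (2 * (d * x.1 2 + |d|) * (d * x.1 2 + |d|) / (2 * d * (d + |d| * x.1 2)) - 1) * x.1 2 = |d| / d := by
    trans 2 * (d * x.1 2 + |d|) * (d * x.1 0 * x.1 0 + d * x.1 1 * x.1 1 + (d * x.1 2 + |d|) * x.1 2) / (2 * d * (d + |d| * x.1 2)) - x.1 2
    · ring
    · rw [sK]; generalize d + |d| * x.1 2 = K at *; field_simp; ring
  rw [fin]
  rcases hd0.lt_or_gt with h' | h'
  · right; rw [abs_of_neg h']; field_simp
  · left; rw [abs_of_pos h']; field_simp
lemma mv_neg (n x : E3) : mv n (-x) = mv n x := by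
  have : dv n (-x) = - dv n x := by simp [dv]; ring
  rw [mv, this, mv, abs_neg]; simp
lemma ev_cont (q : P2) : Continuous fun f : HomP2 => f.1 q := (continuous_eval_const q).comp continuous_subtype_val
lemma ev_cont2 : Continuous fun p : HomP2 × P2 => p.1.1 p.2 := Continuous.eval (by fun_prop) (by fun_prop)
lemma local_data (f0 : HomP2) : ∃ (Y : Type) (_ : TopologicalSpace Y) (j : Y → HomP2) (y0 : Y) (Q : Y → SO) (F : Y → ℂ → ℂ),
    IsOpenMap j ∧ j y0 = f0 ∧ Continuous Q ∧ Fam F ∧ ∀ y, IsD (j y) (Q y) (F y) := by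
  obtain ⟨n, hn, hn2⟩ : ∃ n : Sph, ⟦n⟧ = f0.1 pp ∧ 0 ≤ n.1 2 := by
    obtain ⟨n, hn⟩ := Quotient.exists_rep (f0.1 pp)
    rcases le_total 0 (n.1 2) with h | h
    · exact ⟨n, hn, h⟩
    · exact ⟨-n, by rw [← hn, mk_eq]; exact Or.inr rfl, by rw [neg_ap]; linarith⟩
  let mq : P2 → E3 := Quotient.lift (fun x : Sph => mv n.1 x.1) (by
    intro x y h
    rcases mk_eq.1 (Quotient.sound h) with rfl | rfl
    · rfl
    · exact mv_neg _ _)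
  have hmq : Continuous mq := Continuous.quotient_lift (by unfold mv dv; fun_prop) _
  have hm0 : mq (f0.1 pp) ≠ 0 := by
    rw [← hn]
    have e : dv n.1 n.1 = 1 := by rw [dv]; linear_combination sph_eq n
    intro h
    have := congrArg (fun v : E3 => v 2) h
    change (mv n.1 n.1) 2 = 0 at this
    rw [mv, e] at this
    simp [e3_ap] at this
    linarith
  let Y1 := {f : HomP2 // mq (f.1 pp) ≠ 0}
  have ho1 : IsOpen {f : HomP2 | mq (f.1 pp) ≠ 0} := isOpen_ne_fun (hmq.comp (ev_cont pp)) continuous_const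
  let A : Y1 → SO := fun f => Hm ⟨mq (f.1.1 pp), f.2⟩
  have hA : Continuous A := Hm_cont.comp ((hmq.comp ((ev_cont pp).comp continuous_subtype_val)).subtype_mk _)
  have hPF : PF fun (f : Y1) q => rP (A f) (f.1.1 q) := by
    refine ⟨rP_cont.comp ((hA.comp continuous_fst).prodMk (ev_cont2.comp ((continuous_subtype_val.comp continuous_fst).prodMk continuous_snd))), fun f => (rP_bij _).comp f.1.2.bijective, fun f => ?_⟩
    obtain ⟨x, hx⟩ := Quotient.exists_rep (f.1.1 pp)
    have h2 : mv n.1 x.1 ≠ 0 := by have := f.2; rw [← hx] at this; exact this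
    have h3 : (⟨mq (f.1.1 pp), f.2⟩ : {m : E3 // m ≠ 0}) = ⟨mv n.1 x.1, h2⟩ := Subtype.ext (by simp only [← hx]; rfl)
    show rP (Hm _) _ = pp
    rw [h3, ← hx, mv_pp]
  obtain ⟨U1, hU1, hx1, F, hF, hFl⟩ := lift_loc (g := fun p : Y1 × ℂ => rP (A p.1) (p.1.1.1 (Pi p.2)))
    (hPF.cont.comp (f := fun p : Y1 × ℂ => (p.1, Pi p.2)) (continuous_fst.prodMk (Pi_cont.comp continuous_snd))) (fun p => hPF.ne p.1 (Pi_ne _)) ⟨f0, hm0⟩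
  have hPF1 : PF fun (f : U1) q => rP (A f.1) (f.1.1.1 q) := ⟨hPF.cont.comp (f := fun p : U1 × P2 => (p.1.1, p.2)) (by fun_prop), fun f => hPF.bij f.1, fun f => hPF.fix f.1⟩
  obtain ⟨U2, hU2, hx2, C, κ, hC, hκ, hfam⟩ := hPF1.fam hF hFl ⟨_, hx1⟩
  refine ⟨U2, inferInstance, fun y => y.1.1.1, ⟨_, hx2⟩, fun y => A y.1.1 * C, _, ?_, rfl, (hA.comp (by fun_prop)).mul continuous_const, hfam, fun y => ?_⟩
  · exact ho1.isOpenMap_subtype_val.comp (hU1.isOpenMap_subtype_val.comp hU2.isOpenMap_subtype_val)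
  · have hinv : ∀ q, rP (A y.1.1) (rP (A y.1.1) q) = q := fun q => by
      have := rP_inv (A y.1.1) q
      rwa [Hm_inv] at this
    refine ⟨hfam.comp (u := fun _ : Unit => y) continuous_const, ?_, fun w => ?_⟩
    · rw [rP_mul, hC]
      have h := hinv (y.1.1.1.1 pp)
      rw [show rP (A y.1.1) (y.1.1.1.1 pp) = pp from hPF.fix y.1.1] at h
      exact h.symm
    · rw [rP_mul, hκ, hFl, hinv]

lemma P2_cases {p : P2 → Prop} (h : p pp) (h' : ∀ w, p (Pi w)) (q : P2) : p q := by
  by_cases hq : q = pp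
  · rwa [hq]
  · obtain ⟨w, rfl⟩ := Pi_surj hq; exact h' w
def pf (Q : SO) {F : ℂ → ℂ} (H : Fam fun _ : Unit => F) (t : ℝ) : HomP2 := compH (rH Q) (PsH (RR_fam H) ((), t))
lemma pf_ap (Q : SO) {F : ℂ → ℂ} (H : Fam fun _ : Unit => F) (t : ℝ) (q : P2) : (pf Q H t).1 q = rP Q (PsP (RR F t) q) := rfl
lemma pf_pp (Q : SO) {F : ℂ → ℂ} (H : Fam fun _ : Unit => F) (t : ℝ) : (pf Q H t).1 pp = rP Q pp := by rw [pf_ap, PsP_pp]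
lemma pf_Pi (Q : SO) {F : ℂ → ℂ} (H : Fam fun _ : Unit => F) (t : ℝ) (w : ℂ) : (pf Q H t).1 (Pi w) = rP Q (Pi (RR F t w)) := by
  rw [pf_ap, PsP_Pi ((RR_fam H).gam ((), t))]
lemma H_ext {f g : HomP2} (h : f.1 pp = g.1 pp) (h' : ∀ w, f.1 (Pi w) = g.1 (Pi w)) : f = g :=
  Subtype.ext (ContinuousMap.ext (P2_cases h h'))
lemma pf_unique {f : HomP2} {Q Q' : SO} {F F' : ℂ → ℂ} (D : IsD f Q F) (D' : IsD f Q' F') (t : ℝ) : pf Q D.fam t = pf Q' D'.fam t := by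
  refine H_ext (by rw [pf_pp, pf_pp, ← D.pt, D'.pt]) fun w => ?_
  rw [pf_Pi, pf_Pi]
  have hM : rP (Q'⁻¹ * Q) pp = pp := by rw [rP_mul, ← D.pt, D'.pt, rP_inv]
  have hF : ∀ w, Pi (F' w) = rP (Q'⁻¹ * Q) (Pi (F w)) := fun w => by rw [rP_mul, ← D.eq, D'.eq, rP_inv]
  have hQ : rP Q (Pi (RR F t w)) = rP Q' (rP (Q'⁻¹ * Q) (Pi (RR F t w))) := by rw [rP_mul, rP_inv']
  have c : Continuous F := D.fam.cont.comp (Continuous.prodMk_right ())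
  have c' : Continuous F' := D'.fam.cont.comp (Continuous.prodMk_right ())
  rw [hQ]; congr 1
  obtain ⟨b, h | h⟩ := fix_pp hM
  · rw [h] at hF ⊢
    simp only [Rz_Pi] at hF ⊢
    obtain ⟨n, hn⟩ := lift_unique c' (c.add continuous_const) hF
    obtain ⟨T, hT⟩ := D.fam.ends () 1
    obtain ⟨T', hT'⟩ := D'.fam.ends () 1
    have h1 := hT.self_of_nhds (max T T' : ℝ) (by simp)
    have h2 := hT'.self_of_nhds (max T T' : ℝ) (by simp)
    have hev : ((-1 : ℝ)) ^ n = 1 := by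
      rcases Int.even_or_odd n with he | ho
      · exact he.neg_one_zpow
      · rw [hn, GZ_re, ho.neg_one_zpow] at h2
        simp [add_re, mul_re, I_re, ofReal_im, I_im] at h2
        linarith
    have hF' : F' = fun w => F w + ((b + n * π : ℝ) : ℂ) * 𝕚 := by
      funext w
      rw [hn]
      apply cxt
      · rw [GZ_re, hev]; simp
      · rw [GZ_im]; simp; ring
    rw [hF', RR_add, ← Pi_GZ n]
    congr 1
    apply cxt
    · rw [GZ_re, hev]; simp
    · rw [GZ_im]; simp; ring
  · exfalso
    rw [h] at hF
    simp only [rP_mul, Rz_Pi, Cc_Pi] at hF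
    obtain ⟨n, hn⟩ := lift_unique c' (Complex.continuous_conj.comp (c.add continuous_const)) hF
    have e1 := congrArg Complex.im (hn (Gam 0))
    have e2 := congrArg Complex.im (hn 0)
    rw [D'.fam.gam (), GZ_im] at e1
    rw [GZ_im] at e2
    simp only [Function.comp, Pi.add_apply, D.fam.gam (), Gam_im, conj_im, add_im] at e1 e2
    linarith [pi_pos]
lemma ex_data (f : HomP2) : ∃ (Q : SO) (F : ℂ → ℂ), IsD f Q F := by
  obtain ⟨Y, _, j, y0, Q, F, -, rfl, -, -, h⟩ := local_data f
  exact ⟨_, _, h y0⟩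
def rho (p : HomP2 × unitInterval) : HomP2 := pf (ex_data p.1).choose (ex_data p.1).choose_spec.choose_spec.fam p.2
lemma rho_eq {f : HomP2} {Q : SO} {F : ℂ → ℂ} (D : IsD f Q F) (t : unitInterval) : rho (f, t) = pf Q D.fam t := pf_unique (ex_data f).choose_spec.choose_spec D t
lemma rho_cont : Continuous rho := by
  rw [continuous_iff_continuousAt]
  rintro ⟨f, t⟩
  obtain ⟨Y, _, j, y0, Q, F, hj, rfl, hQ, H, h⟩ := local_data f
  have ho : IsOpenMap (Prod.map j (id : unitInterval → unitInterval)) := hj.prodMap IsOpenMap.id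
  have hc : Continuous fun p : Y × unitInterval => rho (j p.1, p.2) := by
    refine Continuous.subtype_mk (f := fun p : Y × unitInterval => (rho (j p.1, p.2)).1) ?_ _
    refine ContinuousMap.continuous_of_continuous_uncurry _ ?_
    have : Continuous fun p : (Y × unitInterval) × P2 => rP (Q p.1.1) (PsP (RR (F p.1.1) p.1.2) p.2) :=
      rP_cont.comp ((hQ.comp (by fun_prop)).prodMk ((PsP_cont (RR_fam H)).comp (f := fun p : (Y × unitInterval) × P2 => ((p.1.1, (p.1.2 : ℝ)), p.2)) (by fun_prop)))
    refine this.congr fun p => ?_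
    show _ = (rho (j p.1.1, p.1.2)).1 p.2
    rw [rho_eq (h p.1.1), pf_ap]
  exact (tendsto_map'_iff.2 (hc.tendsto (y0, t))).mono_left (ho.nhds_le (y0, t))
lemma id_fam : Fam fun _ : Unit => fun w : ℂ => w := ⟨continuous_snd, fun _ _ => rfl, fun _ => Function.bijective_id, fun _ M => ⟨M, Eventually.of_forall fun _ _ h => h⟩⟩
theorem main_aux : Continuous rho ∧
      (∀ f : HomP2, rho (f, 0) = f) ∧
      (∀ f : HomP2, ∃ Q ∈ Matrix.specialOrthogonalGroup (Fin 3) ℝ, InducedBy (rho (f, 1)) Q) ∧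
      (∀ Q ∈ Matrix.specialOrthogonalGroup (Fin 3) ℝ, ∀ qbar : HomP2, InducedBy qbar Q →
        ∀ t : unitInterval, rho (qbar, t) = qbar) ∧
      (∀ Q ∈ Matrix.specialOrthogonalGroup (Fin 3) ℝ, ∀ qbar : HomP2, InducedBy qbar Q →
        ∀ f : HomP2, ∀ t : unitInterval,
          rho (compH qbar f, t) = compH qbar (rho (f, t))) := by
  refine ⟨rho_cont, fun f => ?_, fun f => ?_, fun Q hQ g hg t => ?_, fun Q hQ g hg f t => ?_⟩
  · obtain ⟨Q, F, D⟩ := ex_data f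
    rw [rho_eq D]
    exact H_ext (by rw [pf_pp, D.pt]) fun w => by rw [pf_Pi, D.eq]; exact congrArg (fun z => rP Q (Pi z)) (RR_zero D.fam () w)
  · obtain ⟨Q, F, D⟩ := ex_data f
    refine ⟨(Q * Rz (F 0).im).1, (Q * Rz (F 0).im).2, ind_of ?_⟩
    rw [rho_eq D]
    refine P2_cases (by rw [pf_pp, rP_mul, Rz_pp]) fun w => ?_
    rw [pf_Pi, rP_mul, Rz_Pi]; exact congrArg (fun z => rP Q (Pi z)) (RR_one D.fam () w)
  · have e := ind_eq (Q := ⟨Q, hQ⟩) hg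
    have D : IsD g ⟨Q, hQ⟩ fun w => w := ⟨id_fam, e _, fun w => e _⟩
    rw [rho_eq D]
    refine H_ext (by rw [pf_pp, D.pt]) fun w => ?_
    rw [pf_Pi, D.eq]; exact congrArg (fun z => rP _ (Pi z)) (RR_id (b := 0) (x := ()) D.fam (fun w => by simp) t w)
  · have e := ind_eq (Q := ⟨Q, hQ⟩) hg
    obtain ⟨Q1, F, D⟩ := ex_data f
    have D' : IsD (compH g f) (⟨Q, hQ⟩ * Q1) F := ⟨D.fam, by rw [rP_mul, ← D.pt]; exact e _, fun w => by rw [rP_mul, ← D.eq]; exact e _⟩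
    rw [rho_eq D, rho_eq D']
    refine Subtype.ext (ContinuousMap.ext fun q => ?_)
    rw [pf_ap, rP_mul]; exact (e _).symm

/-- There is a strong `SO₃`-equivariant deformation retraction from `Hom(P²)` to `SO₃`. -/
theorem deformation_retraction_homP2_to_SO3 :
    ∃ ρ : HomP2 × unitInterval → HomP2,
      Continuous ρ ∧
      (∀ f : HomP2, ρ (f, 0) = f) ∧
      (∀ f : HomP2, ∃ Q ∈ Matrix.specialOrthogonalGroup (Fin 3) ℝ, InducedBy (ρ (f, 1)) Q) ∧
      (∀ Q ∈ Matrix.specialOrthogonalGroup (Fin 3) ℝ, ∀ qbar : HomP2, InducedBy qbar Q →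
        ∀ t : unitInterval, ρ (qbar, t) = qbar) ∧
      (∀ Q ∈ Matrix.specialOrthogonalGroup (Fin 3) ℝ, ∀ qbar : HomP2, InducedBy qbar Q →
        ∀ f : HomP2, ∀ t : unitInterval,
          ρ (compH qbar f, t) = compH qbar (ρ (f, t))) := by
  exact ⟨rho, main_aux⟩
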